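/- For all integers ℓ ≥ 3 and k ≥ 1, the k-color Gallai-Ramsey number of the odd cycle satisfies gr_k(K_3 : C_{2ℓ+1}) = ℓ·2^k + 1. Equivalently: (i) for every n ≥ ℓ·2^k + 1, every k-coloring of the edges of K_n contains a rainbow triangle or a monochromatic copy of C_{2ℓ+1}, and (ii) there exists a k-coloring of the edges of K_{ℓ·2^k} containing neither a rainbow triangle nor a monochromatic copy of C_{2ℓ+1}. -/

import Mathlib

open SimpleGraph

/-- The edge coloring `c` of the complete graph on `V` contains a rainbow triangle. -/
def HasRainbowTriangle {V α : Type*} (c : Sym2 V → α) : Prop :=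
  ∃ x y z : V, x ≠ y ∧ x ≠ z ∧ y ≠ z ∧
    c s(x, y) ≠ c s(x, z) ∧ c s(x, y) ≠ c s(y, z) ∧ c s(x, z) ≠ c s(y, z)

/-- The edge coloring `c` contains a copy of `H` all of whose edges have color `i`. -/
def HasMonoCopyIn {V W α : Type*} (c : Sym2 V → α) (H : SimpleGraph W) (i : α) : Prop :=
  ∃ f : W ↪ V, ∀ u v, H.Adj u v → c s(f u, f v) = i

/-- The edge coloring `c` contains a monochromatic copy of `H`. -/
def HasMonoCopy {V W α : Type*} (c : Sym2 V → α) (H : SimpleGraph W) : Prop :=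
  ∃ i, HasMonoCopyIn c H i

/-- Every `k`-coloring of the edges of `K_n` contains a rainbow triangle or a
monochromatic copy of `H`. -/
def grProp {W : Type*} (k : ℕ) (H : SimpleGraph W) (n : ℕ) : Prop :=
  ∀ c : Sym2 (Fin n) → Fin k, HasRainbowTriangle c ∨ HasMonoCopy c H

/-- The `k`-color Gallai–Ramsey number `gr_k(K₃ : H)`: the minimum `N` such that for all
`n ≥ N`, every `k`-coloring of the edges of `K_n` contains a rainbow triangle or a
monochromatic copy of `H`. -/
noncomputable def gr {W : Type*} (k : ℕ) (H : SimpleGraph W) : ℕ :=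
  sInf {N | ∀ n, N ≤ n → grProp k H n}

namespace GR
set_option linter.unusedSectionVars false

/-- A path in `G` from `a` to `b` with vertex set `F`. -/
inductive Pth {V : Type*} [DecidableEq V] (G : V → V → Prop) : V → V → Finset V → Prop
  | single (a : V) : Pth G a a {a}
  | cons {a b c : V} {F : Finset V} : G a b → a ∉ F → Pth G b c F → Pth G a c (insert a F)

/-- A cycle in `G` with `n` vertices inside `S`. -/
def HasCyc {V : Type*} [DecidableEq V] (G : V → V → Prop) (S : Finset V) (n : ℕ) : Prop :=
  ∃ a b F, Pth G a b F ∧ G b a ∧ F ⊆ S ∧ F.card = n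

section basic
variable {V : Type*} [DecidableEq V] {G : V → V → Prop}

theorem HasCyc.mono {S T : Finset V} {n : ℕ} (h : HasCyc G S n) (hST : S ⊆ T) : HasCyc G T n := by
  obtain ⟨a, b, F, h1, h2, h3, h4⟩ := h
  exact ⟨a, b, F, h1, h2, h3.trans hST, h4⟩

theorem Pth.imp {G' : V → V → Prop} {a b : V} {F : Finset V} (h : Pth G a b F)
    (hG : ∀ x ∈ F, ∀ y ∈ F, G x y → G' x y) : Pth G' a b F := by
  have key : ∀ {a b : V} {F : Finset V}, Pth G a b F → a ∈ F := by
    intro a b F h; cases h <;> simp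
  induction h with
  | single a => exact Pth.single a
  | @cons a b c F h1 h2 h3 ih =>
    refine Pth.cons (hG a (by simp) b ?_ h1) h2 (ih ?_)
    · simp [key h3]
    · intro x hx y hy; exact hG x (by simp [hx]) y (by simp [hy])

theorem Pth.head_mem {a b : V} {F : Finset V} (h : Pth G a b F) : a ∈ F := by
  cases h <;> simp

theorem Pth.last_mem {a b : V} {F : Finset V} (h : Pth G a b F) : b ∈ F := by
  induction h with
  | single a => simp
  | cons _ _ _ ih => simp [ih]

theorem Pth.append {a b c d : V} {F F' : Finset V} (h : Pth G a b F) (hbc : G b c)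
    (h' : Pth G c d F') (hd : Disjoint F F') : Pth G a d (F ∪ F') := by
  induction h with
  | single a =>
    rw [← Finset.insert_eq]
    exact Pth.cons hbc (by simpa using hd) h'
  | @cons a b e F h1 h2 h3 ih =>
    rw [Finset.insert_union]
    rw [Finset.disjoint_insert_left] at hd
    exact Pth.cons h1 (by simp [h2, hd.1]) (ih hbc hd.2)

theorem Pth.snoc {a b c : V} {F : Finset V} (h : Pth G a b F) (hbc : G b c) (hc : c ∉ F) :
    Pth G a c (insert c F) := by
  have := h.append hbc (Pth.single c) (by simpa using hc)
  rwa [Finset.union_comm, ← Finset.insert_eq] at this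

theorem Pth.rev (hs : ∀ x y, G x y → G y x) {a b : V} {F : Finset V} (h : Pth G a b F) :
    Pth G b a F := by
  induction h with
  | single a => exact Pth.single a
  | cons h1 h2 h3 ih => exact ih.snoc (hs _ _ h1) h2

theorem Pth.card_pos {a b : V} {F : Finset V} (h : Pth G a b F) : 1 ≤ F.card :=
  Finset.card_pos.2 ⟨a, h.head_mem⟩

theorem Pth.of_fun (f : ℕ → V) (m : ℕ) (hi : ∀ i ≤ m, ∀ j ≤ m, f i = f j → i = j)
    (ha : ∀ i < m, G (f i) (f (i + 1))) :
    Pth G (f 0) (f m) ((Finset.range (m + 1)).image f) := by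
  induction m with
  | zero => simpa using Pth.single (f 0)
  | succ m ih =>
    have := ih (fun i hi' j hj => hi i (by omega) j (by omega)) (fun i hi => ha i (by omega))
    rw [Finset.range_add_one, Finset.image_insert]
    refine this.snoc (ha m (by omega)) ?_
    simp only [Finset.mem_image, Finset.mem_range, not_exists, not_and]
    intro x hx h
    have := hi x (by omega) (m+1) le_rfl h
    omega

theorem card_of_fun (f : ℕ → V) (m : ℕ) (hi : ∀ i ≤ m, ∀ j ≤ m, f i = f j → i = j) :
    ((Finset.range (m + 1)).image f).card = m + 1 := by
  rw [Finset.card_image_of_injOn, Finset.card_range]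
  intro i hi' j hj h
  simp at hi' hj
  exact hi i (by omega) j (by omega) h

theorem Pth.to_fun {a b : V} {F : Finset V} (h : Pth G a b F) :
    ∃ f : ℕ → V, f 0 = a ∧ f (F.card - 1) = b ∧
      (∀ i < F.card, ∀ j < F.card, f i = f j → i = j) ∧
      (∀ i, i + 1 < F.card → G (f i) (f (i + 1))) ∧ (Finset.range F.card).image f = F := by
  induction h with
  | single a => exact ⟨fun _ => a, by simp⟩
  | @cons a b c F h1 h2 h3 ih =>
    obtain ⟨f, f0, fl, fi, fa, fF⟩ := ih
    have hc := h3.card_pos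
    have hmem : ∀ i < F.card, f i ∈ F := fun i hi => by
      have : f i ∈ (Finset.range F.card).image f := Finset.mem_image_of_mem _ (by simpa using hi)
      rwa [fF] at this
    refine ⟨fun i => if i = 0 then a else f (i - 1), by simp, ?_, ?_, ?_, ?_⟩
    · rw [Finset.card_insert_of_notMem h2]
      simp only [Nat.add_sub_cancel]
      rw [if_neg (by omega)]; exact fl
    · rw [Finset.card_insert_of_notMem h2]
      intro i hi j hj hij
      rcases Nat.eq_zero_or_pos i with rfl | hi0 <;> rcases Nat.eq_zero_or_pos j with rfl | hj0
      · rfl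
      · simp only [if_true, if_neg (show j ≠ 0 by omega)] at hij
        exact absurd (hij ▸ hmem (j-1) (by omega)) h2
      · simp only [if_true, if_neg (show i ≠ 0 by omega)] at hij
        exact absurd (hij ▸ hmem (i-1) (by omega)) h2
      · simp only [if_neg (show i ≠ 0 by omega), if_neg (show j ≠ 0 by omega)] at hij
        have := fi (i-1) (by omega) (j-1) (by omega) hij
        omega
    · rw [Finset.card_insert_of_notMem h2]
      intro i hi
      rcases Nat.eq_zero_or_pos i with rfl | hi0
      · simpa [f0] using h1
      · simp only [if_neg (show i ≠ 0 by omega), if_neg (show i + 1 ≠ 0 by omega)]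
        have := fa (i-1) (by omega)
        rwa [Nat.sub_add_cancel hi0] at this
    · rw [Finset.card_insert_of_notMem h2]
      ext x
      simp only [Finset.mem_image, Finset.mem_range, Finset.mem_insert]
      constructor
      · rintro ⟨i, hi, rfl⟩
        split_ifs with h0
        · simp
        · right; exact hmem _ (by omega)
      · rintro (rfl | hx)
        · exact ⟨0, by omega, by simp⟩
        · rw [← fF] at hx
          simp only [Finset.mem_image, Finset.mem_range] at hx
          obtain ⟨i, hi, rfl⟩ := hx
          exact ⟨i+1, by omega, by simp⟩

/-- cycle as a function on an initial segment -/
theorem HasCyc.of_fun (f : ℕ → V) (m : ℕ) (S : Finset V)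
    (hi : ∀ i ≤ m, ∀ j ≤ m, f i = f j → i = j)
    (ha : ∀ i < m, G (f i) (f (i + 1))) (hc : G (f m) (f 0)) (hS : ∀ i ≤ m, f i ∈ S) :
    HasCyc G S (m + 1) := by
  refine ⟨_, _, _, Pth.of_fun f m hi ha, hc, ?_, card_of_fun f m hi⟩
  intro x hx
  simp only [Finset.mem_image, Finset.mem_range] at hx
  obtain ⟨i, hi, rfl⟩ := hx
  exact hS i (by omega)

/-- cycle as periodic function -/
theorem HasCyc.to_fun {S : Finset V} {n : ℕ} (h : HasCyc G S n) :
    ∃ v : ℕ → V, (∀ i j, v i = v j ↔ i % n = j % n) ∧ (∀ i, G (v i) (v (i + 1))) ∧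
      (∀ i, v i ∈ S) ∧ 0 < n := by
  obtain ⟨a, b, F, h1, h2, h3, h4⟩ := h
  obtain ⟨f, f0, fl, fi, fa, fF⟩ := h1.to_fun
  have hc := h1.card_pos
  rw [h4] at *
  have hm : ∀ i, i % n < n := fun i => Nat.mod_lt _ (by omega)
  refine ⟨fun i => f (i % n), ?_, ?_, ?_, by omega⟩
  · intro i j
    exact ⟨fun h => fi _ (hm i) _ (hm j) h, fun h => by simp [h]⟩
  · intro i
    by_cases h : i % n + 1 = n
    · have e1 : (i + 1) % n = 0 := by
        rw [Nat.add_mod]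
        rcases Nat.lt_or_ge 1 n with h1 | h1
        · rw [Nat.mod_eq_of_lt h1, h, Nat.mod_self]
        · have : n = 1 := by omega
          subst this; simp [Nat.mod_one]
      have e2 : i % n = n - 1 := by omega
      simp only [e1, e2, f0, fl]; exact h2
    · have h' : i % n + 1 < n := by have := hm i; omega
      have e1 : (i + 1) % n = i % n + 1 := by
        rw [Nat.add_mod, Nat.mod_eq_of_lt (show 1 < n by omega), Nat.mod_eq_of_lt h']
      simp only [e1]; exact fa _ h'
  · intro i
    apply h3
    rw [← fF]
    exact Finset.mem_image_of_mem _ (by simpa using hm i)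

/-- `P × Q` is complete in `G`. -/
def Bic (G : V → V → Prop) (P Q : Finset V) : Prop := ∀ p ∈ P, ∀ q ∈ Q, G p q ∧ G q p

theorem Bic.symm {P Q : Finset V} (h : Bic G P Q) : Bic G Q P := fun p hp q hq => (h q hq p hp).symm

theorem Bic.mono {P Q P' Q' : Finset V} (h : Bic G P Q) (hP : P' ⊆ P) (hQ : Q' ⊆ Q) :
    Bic G P' Q' := fun p hp q hq => h p (hP hp) q (hQ hq)

theorem alt3 (j : ℕ) : ∀ {P Q : Finset V} {p0 q0 : V}, Bic G P Q → Disjoint P Q →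
    p0 ∈ P → q0 ∈ Q → 1 ≤ j → j ≤ P.card → j ≤ Q.card →
    ∃ F, F ⊆ P ∪ Q ∧ Pth G p0 q0 F ∧ F.card = 2 * j := by
  induction j with
  | zero => intros; omega
  | succ j ih =>
    intro P Q p0 q0 hb hd hp hq _ hP hQ
    have hne : p0 ≠ q0 := fun h => Finset.disjoint_left.1 hd hp (h ▸ hq)
    rcases Nat.eq_zero_or_pos j with rfl | hj
    · refine ⟨{p0, q0}, ?_, Pth.cons (hb _ hp _ hq).1 (by simpa using hne) (Pth.single q0), ?_⟩
      · intro x hx; simp at hx; rcases hx with rfl | rfl <;> simp [hp, hq]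
      · rw [Finset.card_pair hne]
    · have c1 : 0 < (Q.erase q0).card := by rw [Finset.card_erase_of_mem hq]; omega
      have c2 : 0 < (P.erase p0).card := by rw [Finset.card_erase_of_mem hp]; omega
      obtain ⟨q, hq'⟩ := Finset.card_pos.1 c1
      obtain ⟨p, hp'⟩ := Finset.card_pos.1 c2
      rw [Finset.mem_erase] at hq' 
      have hpP := Finset.mem_of_mem_erase hp'
      obtain ⟨F, hF, hF1, hF2⟩ := ih (P := P.erase p0) (Q := Q.erase q) (p0 := p) (q0 := q0)
        (hb.mono (Finset.erase_subset _ _) (Finset.erase_subset _ _))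
        (hd.mono (Finset.erase_subset _ _) (Finset.erase_subset _ _)) hp'
        (by simp [hq, hq'.1.symm]) hj (by rw [Finset.card_erase_of_mem hp]; omega)
        (by rw [Finset.card_erase_of_mem hq'.2]; omega)
      have hqF : q ∉ F := fun h => by
        have := hF h
        simp only [Finset.mem_union, Finset.mem_erase, ne_eq, not_true_eq_false, false_and,
          or_false] at this
        exact Finset.disjoint_left.1 hd this.2 hq'.2
      have hpF : p0 ∉ insert q F := fun h => by
        rw [Finset.mem_insert] at h
        rcases h with h | h
        · exact Finset.disjoint_left.1 hd hp (h ▸ hq'.2)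
        have := hF h
        simp only [Finset.mem_union, Finset.mem_erase, ne_eq, not_true_eq_false, false_and,
          false_or] at this
        exact Finset.disjoint_left.1 hd hp this.2
      refine ⟨insert p0 (insert q F), ?_, ?_, ?_⟩
      · intro x hx
        simp only [Finset.mem_insert] at hx
        rcases hx with rfl | rfl | hx
        · simp [hp]
        · simp [hq'.2]
        · exact Finset.union_subset_union (Finset.erase_subset _ _) (Finset.erase_subset _ _) (hF hx)
      · exact Pth.cons (hb _ hp _ hq'.2).1 hpF (Pth.cons (hb _ hpP _ hq'.2).2 hqF hF1)
      · rw [Finset.card_insert_of_notMem hpF, Finset.card_insert_of_notMem hqF, hF2]; ring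

theorem alt2 {j : ℕ} {P Q : Finset V} {p0 p1 : V} (hb : Bic G P Q) (hd : Disjoint P Q)
    (hp : p0 ∈ P) (hp1 : p1 ∈ P) (hne : p0 ≠ p1) (hj : 1 ≤ j) (hP : j + 1 ≤ P.card)
    (hQ : j ≤ Q.card) : ∃ F, F ⊆ P ∪ Q ∧ Pth G p0 p1 F ∧ F.card = 2 * j + 1 := by
  obtain ⟨q, hq⟩ := Finset.card_pos.1 (show 0 < Q.card by omega)
  obtain ⟨F, hF, hF1, hF2⟩ := alt3 j (P := Q) (Q := P.erase p0) (p0 := q) (q0 := p1)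
    (hb.symm.mono subset_rfl (Finset.erase_subset _ _))
    (hd.symm.mono_right (Finset.erase_subset _ _)) hq (by simp [hp1, hne.symm]) hj hQ
    (by rw [Finset.card_erase_of_mem hp]; omega)
  have hpF : p0 ∉ F := fun h => by
    have := hF h
    simp at this
    exact Finset.disjoint_left.1 hd hp this
  refine ⟨insert p0 F, ?_, Pth.cons (hb _ hp _ hq).1 hpF hF1, ?_⟩
  · intro x hx
    rw [Finset.mem_insert] at hx
    rcases hx with rfl | hx
    · simp [hp]
    · have := hF hx
      simp only [Finset.mem_union, Finset.mem_erase] at this ⊢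
      tauto
  · rw [Finset.card_insert_of_notMem hpF, hF2]

theorem alt1 {j : ℕ} {P Q : Finset V} {p0 : V} (hb : Bic G P Q) (hd : Disjoint P Q)
    (hp : p0 ∈ P) (hP : j + 1 ≤ P.card)
    (hQ : j ≤ Q.card) : ∃ p1 ∈ P, ∃ F, F ⊆ P ∪ Q ∧ Pth G p0 p1 F ∧ F.card = 2 * j + 1 := by
  rcases Nat.eq_zero_or_pos j with rfl | hj
  · exact ⟨p0, hp, {p0}, by simp [hp], Pth.single _, by simp⟩
  · obtain ⟨p1, hp1⟩ := Finset.card_pos.1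
      (show 0 < (P.erase p0).card by rw [Finset.card_erase_of_mem hp]; omega)
    rw [Finset.mem_erase] at hp1
    exact ⟨p1, hp1.2, alt2 hb hd hp hp1.2 hp1.1.symm hj hP hQ⟩

theorem closeSame {j m : ℕ} {P Q L : Finset V} {a b p0 p1 : V} (hb : Bic G P Q)
    (hd : Disjoint P Q) (hL : Pth G a b L) (hLd : Disjoint L (P ∪ Q)) (h0 : p0 ∈ P) (h1 : p1 ∈ P)
    (hne : p0 ≠ p1) (e0 : G b p0) (e1 : G p1 a) (hj : 1 ≤ j) (hP : j + 1 ≤ P.card)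
    (hQ : j ≤ Q.card) (hm : L.card + (2 * j + 1) = m) : HasCyc G (L ∪ (P ∪ Q)) m := by
  obtain ⟨F, hF, hF1, hF2⟩ := alt2 hb hd h0 h1 hne hj hP hQ
  refine ⟨a, p1, L ∪ F, hL.append e0 hF1 (hLd.mono_right hF), e1,
    Finset.union_subset_union subset_rfl hF, ?_⟩
  rw [Finset.card_union_of_disjoint (hLd.mono_right hF), hF2, hm]

theorem closeOpp {j m : ℕ} {P Q L : Finset V} {a b p0 q0 : V} (hb : Bic G P Q)
    (hd : Disjoint P Q) (hL : Pth G a b L) (hLd : Disjoint L (P ∪ Q)) (h0 : p0 ∈ P) (h1 : q0 ∈ Q)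
    (e0 : G b p0) (e1 : G q0 a) (hj : 1 ≤ j) (hP : j ≤ P.card)
    (hQ : j ≤ Q.card) (hm : L.card + 2 * j = m) : HasCyc G (L ∪ (P ∪ Q)) m := by
  obtain ⟨F, hF, hF1, hF2⟩ := alt3 j hb hd h0 h1 hj hP hQ
  refine ⟨a, q0, L ∪ F, hL.append e0 hF1 (hLd.mono_right hF), e1,
    Finset.union_subset_union subset_rfl hF, ?_⟩
  rw [Finset.card_union_of_disjoint (hLd.mono_right hF), hF2, hm]

theorem U1 {ℓ : ℕ} {P Q : Finset V} {a b : V} (hl : 1 ≤ ℓ) (hb : Bic G P Q)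
    (hd : Disjoint P Q) (ha : a ∈ P) (hb' : b ∈ P) (hne : a ≠ b) (e : G b a)
    (hP : ℓ + 1 ≤ P.card) (hQ : ℓ ≤ Q.card) : HasCyc G (P ∪ Q) (2 * ℓ + 1) := by
  obtain ⟨F, hF, hF1, hF2⟩ := alt2 hb hd ha hb' hne hl hP hQ
  exact ⟨a, b, F, hF1, e, hF, hF2⟩

theorem U2 {ℓ : ℕ} {P Q : Finset V} {v p q : V} (hl : 1 ≤ ℓ) (hb : Bic G P Q)
    (hd : Disjoint P Q) (hv : v ∉ P ∪ Q) (hp : p ∈ P) (hq : q ∈ Q) (e1 : G v p) (e2 : G q v)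
    (hP : ℓ ≤ P.card) (hQ : ℓ ≤ Q.card) : HasCyc G (insert v (P ∪ Q)) (2 * ℓ + 1) := by
  have := closeOpp hb hd (Pth.single v) (by simpa using hv) hp hq e1 e2 hl hP hQ rfl
  rw [Finset.insert_eq]
  simpa [add_comm] using this

theorem U3 {ℓ : ℕ} {A B : Finset V} {r r' b b' : V} (hl : 2 ≤ ℓ) (hb : Bic G B A)
    (hd : Disjoint B A) (hr : r ∉ B ∪ A) (hr' : r' ∉ B ∪ A) (hrr : r ≠ r') (err : G r r')
    (hb1 : b ∈ B) (hb2 : b' ∈ B) (hbb : b ≠ b') (e1 : G b r) (e2 : G r' b')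
    (hB : ℓ ≤ B.card) (hA : ℓ ≤ A.card + 1) : HasCyc G (insert r (insert r' (B ∪ A))) (2 * ℓ + 1) := by
  have := closeSame (j := ℓ - 1) (m := 2 * ℓ + 1) hb hd (Pth.cons err (by simpa using hrr) (Pth.single r'))
    (by
      rw [Finset.disjoint_left]; intro x hx; simp only [Finset.mem_insert, Finset.mem_singleton] at hx
      rcases hx with rfl | rfl <;> assumption) hb2 hb1 hbb.symm e2 e1 (by omega) (by omega) (by omega)
    (by rw [Finset.card_pair hrr]; omega)
  refine this.mono ?_
  intro x; simp

/-- sorted-by-class lemma for complete multipartite graphs -/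
theorem MP {ℓ : ℕ} (hl : 1 ≤ ℓ) (S : Finset V) (cl : V → ℕ)
    (hG : ∀ x ∈ S, ∀ y ∈ S, cl x ≠ cl y → G x y)
    (hc : ∀ x ∈ S, (S.filter (fun y => cl y = cl x)).card ≤ ℓ)
    (hS : 2 * ℓ + 1 ≤ S.card) : HasCyc G S (2 * ℓ + 1) := by
  obtain ⟨T, hTS, hT⟩ := Finset.exists_subset_card_eq hS
  let e := T.equivFinOfCardEq hT
  let g : Fin (2 * ℓ + 1) → V := fun i => (e.symm i : V)
  have gi : Function.Injective g := fun i j h => e.symm.injective (Subtype.ext h)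
  have gT : ∀ i, g i ∈ T := fun i => (e.symm i).2
  let σ := Tuple.sort (cl ∘ g)
  have hmono : Monotone ((cl ∘ g) ∘ σ) := Tuple.monotone_sort _
  let s : Fin (2 * ℓ + 1) → V := fun i => g (σ i)
  have si : Function.Injective s := fun i j h => σ.injective (gi h)
  have hmono' : ∀ i j, i ≤ j → cl (s i) ≤ cl (s j) := fun i j h => hmono h
  have sS : ∀ i, s i ∈ S := fun i => hTS (gT _)
  have hdiff : ∀ i j : Fin (2 * ℓ + 1), i.1 + ℓ ≤ j.1 → cl (s i) ≠ cl (s j) := by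
    intro i j hij h
    have hcard := hc (s i) (sS i)
    have : (Finset.Icc i j).image s ⊆ S.filter (fun y => cl y = cl (s i)) := by
      intro x hx
      simp only [Finset.mem_image, Finset.mem_Icc] at hx
      obtain ⟨t, ⟨h1, h2⟩, rfl⟩ := hx
      simp only [Finset.mem_filter]
      refine ⟨sS t, le_antisymm ?_ (hmono' _ _ h1)⟩
      rw [h]; exact hmono' _ _ h2
    have := Finset.card_le_card this
    rw [Finset.card_image_of_injective _ si, Fin.card_Icc] at this
    omega
  have hN : 0 < 2 * ℓ + 1 := by omega
  let f : ℕ → V := fun i => s ⟨(ℓ * i) % (2 * ℓ + 1), Nat.mod_lt _ hN⟩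
  have hstep : ∀ i, G (f i) (f (i + 1)) := by
    intro i
    apply hG _ (sS _) _ (sS _)
    have hm := Nat.mod_lt (ℓ * i) hN
    have : (ℓ * (i + 1)) % (2 * ℓ + 1) = ((ℓ * i) % (2 * ℓ + 1) + ℓ) % (2 * ℓ + 1) := by
      rw [mul_add, mul_one, Nat.mod_add_mod]
    by_cases h : (ℓ * i) % (2 * ℓ + 1) + ℓ < 2 * ℓ + 1
    · rw [Nat.mod_eq_of_lt h] at this
      apply hdiff
      simp only [this]; omega
    · have e2 : (ℓ * i % (2 * ℓ + 1) + ℓ) % (2 * ℓ + 1) = ℓ * i % (2 * ℓ + 1) + ℓ - (2 * ℓ + 1) := by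
        rw [Nat.mod_eq_sub_mod (by omega), Nat.mod_eq_of_lt (by omega)]
      rw [e2] at this
      apply Ne.symm
      apply hdiff
      simp only [this]; omega
  refine HasCyc.of_fun f (2 * ℓ) S ?_ (fun i _ => hstep i) ?_ (fun i _ => sS _)
  · intro i hi j hj h
    have := congrArg Fin.val (si h)
    simp only at this
    have hcop : Nat.gcd (2 * ℓ + 1) ℓ = 1 := by
      have : Nat.Coprime (1 + 2 * ℓ) ℓ := by simp
      rwa [add_comm] at this
    have h2 : i ≡ j [MOD (2 * ℓ + 1)] := Nat.ModEq.cancel_left_of_coprime hcop this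
    rw [Nat.ModEq, Nat.mod_eq_of_lt (by omega), Nat.mod_eq_of_lt (by omega)] at h2
    exact h2
  · have := hstep (2 * ℓ)
    have e : f (2 * ℓ + 1) = f 0 := by simp [f]
    rwa [e] at this

/-- Depth-first search lemma. -/
theorem DFS (hs : ∀ x y, G x y → G y x) (H : Finset V) : ∃ U S T : Finset V, U ∪ S ∪ T = H ∧ Disjoint U S ∧ Disjoint U T ∧
    Disjoint S T ∧ S.card = T.card ∧ (∀ x ∈ S, ∀ y ∈ T, ¬ G x y) ∧
    (U = ∅ ∨ ∃ a b, Pth G a b U) := by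
  suffices h : ∀ d : ℕ, d ≤ H.card → ∃ U S T : Finset V, U ∪ S ∪ T = H ∧ Disjoint U S ∧ Disjoint U T ∧
    Disjoint S T ∧ T.card = S.card + d ∧ (∀ x ∈ S, ∀ y ∈ T, ¬ G x y) ∧
    (U = ∅ ∨ ∃ a b, Pth G a b U) by
    obtain ⟨U, S, T, h1, h2, h3, h4, h5, h6⟩ := h 0 (by omega)
    exact ⟨U, S, T, h1, h2, h3, h4, by omega, h6⟩
  intro d hd
  obtain ⟨e, rfl⟩ : ∃ e, d = H.card - e := ⟨H.card - d, by omega⟩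
  clear hd
  induction e with
  | zero => exact ⟨∅, ∅, H, by simp⟩
  | succ e ih =>
    obtain ⟨U, S, T, h1, h2, h3, h4, h5, h6, h7⟩ := ih
    rcases Nat.lt_or_ge e H.card with hlt | hge
    swap
    · exact ⟨U, S, T, h1, h2, h3, h4, by omega, h6, h7⟩
    have hT : 0 < T.card := by omega
    rcases h7 with rfl | ⟨a, b, hp⟩
    · obtain ⟨t, ht⟩ := Finset.card_pos.1 hT
      refine ⟨{t}, S, T.erase t, ?_, ?_, ?_, ?_, ?_, ?_, Or.inr ⟨t, t, Pth.single t⟩⟩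
      · rw [← h1]; ext x; simp; by_cases h : x = t <;> simp [h, ht]
      · simpa using fun h => Finset.disjoint_left.1 h4 h ht
      · simp
      · exact h4.mono_right (Finset.erase_subset _ _)
      · rw [Finset.card_erase_of_mem ht]; omega
      · exact fun x hx y hy => h6 x hx y (Finset.mem_of_mem_erase hy)
    · by_cases hex : ∃ t ∈ T, G b t
      · obtain ⟨t, ht, hbt⟩ := hex
        have htU : t ∉ U := fun h => Finset.disjoint_left.1 h3 h ht
        refine ⟨insert t U, S, T.erase t, ?_, ?_, ?_, ?_, ?_, ?_, Or.inr ⟨a, t, hp.snoc hbt htU⟩⟩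
        · rw [← h1]; ext x; simp; by_cases h : x = t <;> simp [h, ht]
        · rw [Finset.disjoint_insert_left]
          exact ⟨fun h => Finset.disjoint_left.1 h4 h ht, h2⟩
        · rw [Finset.disjoint_insert_left]
          exact ⟨by simp, h3.mono_right (Finset.erase_subset _ _)⟩
        · exact h4.mono_right (Finset.erase_subset _ _)
        · rw [Finset.card_erase_of_mem ht]; omega
        · exact fun x hx y hy => h6 x hx y (Finset.mem_of_mem_erase hy)
      · push Not at hex
        have hbU := hp.last_mem
        have hbS : b ∉ S := Finset.disjoint_left.1 h2 hbU
        have hbT : b ∉ T := Finset.disjoint_left.1 h3 hbU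
        refine ⟨U.erase b, insert b S, T, ?_, ?_, ?_, ?_, ?_, ?_, ?_⟩
        · rw [← h1]; ext x; simp; by_cases h : x = b <;> simp [h, hbU]
        · rw [Finset.disjoint_insert_right]
          exact ⟨by simp, h2.mono_left (Finset.erase_subset _ _)⟩
        · exact h3.mono_left (Finset.erase_subset _ _)
        · rw [Finset.disjoint_insert_left]; exact ⟨hbT, h4⟩
        · rw [Finset.card_insert_of_notMem hbS]; omega
        · intro x hx y hy
          rw [Finset.mem_insert] at hx
          rcases hx with rfl | hx
          · exact hex y hy
          · exact h6 x hx y hy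
        · have hr := hp.rev hs
          cases hr with
          | single => left; simp
          | cons e1 e2 e3 =>
            right
            rw [Finset.erase_insert e2]
            exact ⟨_, _, e3.rev hs⟩

end basic
end GR

open SimpleGraph
namespace GR

/-- adjacency in colour `i` -/
def Col {V α : Type*} (c : Sym2 V → α) (i : α) (x y : V) : Prop := x ≠ y ∧ c s(x, y) = i

theorem Col.symm {V α : Type*} {c : Sym2 V → α} {i : α} : ∀ x y, Col c i x y → Col c i y x := by
  intro x y h
  exact ⟨h.1.symm, by rw [Sym2.eq_swap]; exact h.2⟩

theorem mono_of_cyc {V α : Type*} [DecidableEq V] {c : Sym2 V → α} {i : α} {S : Finset V} {n : ℕ}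
    (h : HasCyc (Col c i) S (n + 2)) : HasMonoCopyIn c (cycleGraph (n + 2)) i := by
  obtain ⟨v, h1, h2, -, -⟩ := h.to_fun
  have key : ∀ a b : Fin (n + 2), b - a = 1 → c s(v a.1, v b.1) = i := by
    intro a b hab
    have hb : b = a + 1 := by rw [← hab]; abel
    have : v b.1 = v (a.1 + 1) := by
      rw [h1, hb, Fin.val_add]
      simp
    rw [this]
    exact (h2 _).2
  refine ⟨⟨fun a => v a.1, fun a b hab => ?_⟩, ?_⟩
  · have := (h1 _ _).1 hab
    rw [Nat.mod_eq_of_lt a.2, Nat.mod_eq_of_lt b.2] at this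
    exact Fin.ext this
  · intro a b hab
    rw [cycleGraph_adj] at hab
    rcases hab with hab | hab
    · rw [Sym2.eq_swap]; exact key b a hab
    · exact key a b hab

theorem mono_fun {V α : Type*} {c : Sym2 V → α} {i : α} {n : ℕ}
    (h : HasMonoCopyIn c (cycleGraph (n + 2)) i) : ∃ v : ℕ → V, (∀ i j, v i = v j ↔ i % (n + 2) = j % (n + 2)) ∧
      ∀ t, c s(v t, v (t + 1)) = i := by
  obtain ⟨f, hf⟩ := h
  refine ⟨fun t => f ⟨t % (n + 2), Nat.mod_lt _ (by omega)⟩, ?_, ?_⟩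
  · intro a b; simp
  · intro t
    apply hf
    rw [cycleGraph_adj]
    right
    rw [sub_eq_iff_eq_add]
    apply Fin.ext
    rw [Fin.val_add]
    simp [Nat.add_mod, add_comm]

theorem size_xor_le (a b : ℕ) : Nat.size (a ^^^ b) ≤ max (Nat.size a) (Nat.size b) := by
  rw [Nat.size_le]
  apply Nat.xor_lt_two_pow
  · exact (Nat.lt_size_self a).trans_le (Nat.pow_le_pow_right (by norm_num) (le_max_left _ _))
  · exact (Nat.lt_size_self b).trans_le (Nat.pow_le_pow_right (by norm_num) (le_max_right _ _))

theorem lower (ℓ k : ℕ) (hℓ : 3 ≤ ℓ) (hk : 1 ≤ k) : ∃ c : Sym2 (Fin (ℓ * 2 ^ k)) → Fin k,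
      ¬ HasRainbowTriangle c ∧ ¬ HasMonoCopy c (cycleGraph (2 * ℓ + 1)) := by
  have hq : ∀ x : Fin (ℓ * 2 ^ k), x.1 / (2 * ℓ) < 2 ^ (k - 1) := by
    intro x
    rw [Nat.div_lt_iff_lt_mul (by omega)]
    have h2 : 2 ^ k = 2 ^ (k - 1) * 2 := by rw [← pow_succ, Nat.sub_add_cancel hk]
    have := x.2
    calc x.1 < ℓ * 2 ^ k := this
      _ = 2 ^ (k-1) * (2 * ℓ) := by rw [h2]; ring
  have hb : ∀ x y : Fin (ℓ * 2 ^ k), Nat.size (x.1 / (2 * ℓ) ^^^ y.1 / (2 * ℓ)) < k := by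
    intro x y
    have := Nat.size_le.2 (Nat.xor_lt_two_pow (hq x) (hq y))
    omega
  let c : Sym2 (Fin (ℓ * 2 ^ k)) → Fin k := Sym2.lift
    ⟨fun x y => ⟨Nat.size (x.1 / (2 * ℓ) ^^^ y.1 / (2 * ℓ)), hb x y⟩, fun x y => by
      simp [Nat.xor_comm]⟩
  have hc : ∀ x y, (c s(x, y)).1 = Nat.size (x.1 / (2 * ℓ) ^^^ y.1 / (2 * ℓ)) := fun x y => rfl
  refine ⟨c, ?_, ?_⟩
  · rintro ⟨x, y, z, -, -, -, h1, h2, h3⟩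
    rw [ne_eq, Fin.ext_iff, hc, hc] at h1 h2 h3
    set a := x.1 / (2 * ℓ)
    set b := y.1 / (2 * ℓ)
    set d := z.1 / (2 * ℓ)
    have e1 : (a ^^^ d) ^^^ (b ^^^ d) = a ^^^ b := by
      rw [Nat.xor_comm b d, Nat.xor_assoc, ← Nat.xor_assoc d d b]; simp
    have e2 : (a ^^^ b) ^^^ (b ^^^ d) = a ^^^ d := by
      rw [Nat.xor_assoc, ← Nat.xor_assoc b b d]; simp
    have e3 : (a ^^^ b) ^^^ (a ^^^ d) = b ^^^ d := by
      rw [Nat.xor_comm a b, Nat.xor_assoc, ← Nat.xor_assoc a a d]; simp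
    have f1 := size_xor_le (a ^^^ d) (b ^^^ d)
    have f2 := size_xor_le (a ^^^ b) (b ^^^ d)
    have f3 := size_xor_le (a ^^^ b) (a ^^^ d)
    rw [e1] at f1; rw [e2] at f2; rw [e3] at f3
    omega
  · rintro ⟨i, hi⟩
    obtain ⟨n, rfl⟩ : ∃ n, ℓ = n + 1 := ⟨ℓ - 1, by omega⟩
    obtain ⟨v, v1, v2⟩ := mono_fun (n := 2 * n + 1) hi
    have v2' : ∀ t, Nat.size ((v t).1 / (2 * (n + 1)) ^^^ (v (t + 1)).1 / (2 * (n + 1))) = i.1 := by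
      intro t; rw [← hc, v2]
    rcases Nat.eq_zero_or_pos i.1 with h0 | h0
    · have hall : ∀ t, (v t).1 / (2 * (n + 1)) = (v 0).1 / (2 * (n + 1)) := by
        intro t
        induction t with
        | zero => rfl
        | succ t ih =>
          have := v2' t
          rw [h0, Nat.size_eq_zero, Nat.xor_eq_zero_iff] at this
          rw [← this, ih]
      have := Finset.exists_ne_map_eq_of_card_lt_of_maps_to
        (s := Finset.range (2 * (n + 1) + 1)) (t := Finset.range (2 * (n + 1))) (by simp)
        (f := fun t => (v t).1 % (2 * (n + 1)))
        (by intro t _; simpa using Nat.mod_lt _ (by omega))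
      obtain ⟨x, hx, y, hy, hne, hxy⟩ := this
      simp only [Finset.mem_range] at hx hy
      have : (v x) = v y := by
        apply Fin.ext
        rw [← Nat.div_add_mod (v x).1 (2 * (n + 1)), ← Nat.div_add_mod (v y).1 (2 * (n + 1)), hall x, hall y]
        rw [hxy]
      rw [v1, Nat.mod_eq_of_lt (by omega), Nat.mod_eq_of_lt (by omega)] at this
      exact hne this
    · obtain ⟨s, hs⟩ : ∃ s, i.1 = s + 1 := ⟨i.1 - 1, by omega⟩
      have hbit : ∀ t, ((v (t + 1)).1 / (2 * (n + 1))).testBit s = !((v t).1 / (2 * (n + 1))).testBit s := by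
        intro t
        have h := v2' t
        rw [hs] at h
        have hlt := (Nat.size_le (n := s + 1)).1 h.le
        have hge : 2 ^ s ≤ ((v t).1 / (2 * (n + 1)) ^^^ (v (t + 1)).1 / (2 * (n + 1))) := by
          by_contra hcon
          have := Nat.size_le.2 (not_le.1 hcon)
          omega
        have := Nat.testBit_of_two_pow_le_and_two_pow_add_one_gt hge hlt
        rw [Nat.testBit_xor] at this
        revert this
        cases ((v t).1 / (2 * (n + 1))).testBit s <;> cases ((v (t + 1)).1 / (2 * (n + 1))).testBit s <;> simp
      have hbit2 : ∀ m, ((v (2 * m)).1 / (2 * (n + 1))).testBit s = ((v 0).1 / (2 * (n + 1))).testBit s := by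
        intro m
        induction m with
        | zero => rfl
        | succ m ih =>
          rw [show 2 * (m + 1) = 2 * m + 1 + 1 by ring, hbit, hbit, ih]; simp
      have h3 := hbit (2 * (n + 1))
      have h4 : v (2 * (n + 1) + 1) = v 0 := by
        rw [v1]; simp [show 2 * (n + 1) + 1 = 2 * n + 1 + 2 by ring]
      rw [h4, hbit2] at h3
      simp at h3
end GR

namespace GR
set_option linter.unusedSectionVars false
set_option linter.unusedVariables false
section gallai
variable {V α : Type*} [DecidableEq V]

/-- one step inside `M` along colour `i` -/
def Stp (χ : V → V → α) (i : α) (M : Finset V) (x y : V) : Prop :=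
  x ∈ M ∧ y ∈ M ∧ x ≠ y ∧ χ x y = i

/-- connected inside `M` along colour `i` -/
def Cn (χ : V → V → α) (i : α) (M : Finset V) : V → V → Prop := Relation.ReflTransGen (Stp χ i M)

variable {χ : V → V → α}

theorem Stp.sym (hsym : ∀ x y, χ x y = χ y x) {i : α} {M : Finset V} {x y : V} (h : Stp χ i M x y) : Stp χ i M y x :=
  ⟨h.2.1, h.1, h.2.2.1.symm, by rw [hsym]; exact h.2.2.2⟩

theorem Cn.sym (hsym : ∀ x y, χ x y = χ y x) {i : α} {M : Finset V} {x y : V} (h : Cn χ i M x y) : Cn χ i M y x :=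
  by
  induction h with
  | refl => exact Relation.ReflTransGen.refl
  | tail _ h2 ih => exact Relation.ReflTransGen.head (Stp.sym hsym h2) ih

theorem Cn.mem {i : α} {M : Finset V} {x y : V} (h : Cn χ i M x y) (hx : x ∈ M) : y ∈ M := by
  induction h with
  | refl => exact hx
  | tail _ h2 _ => exact h2.2.1

theorem Cn.mod (hsym : ∀ x y, χ x y = χ y x)
    (hnr : ∀ x y z, x ≠ y → x ≠ z → y ≠ z → χ x y = χ x z ∨ χ x y = χ y z ∨ χ x z = χ y z) {i : α} {M : Finset V} {x y w : V} (h : Cn χ i M x y) (hx : x ∈ M) (hw : w ∈ M)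
    (hn : ¬ Cn χ i M x w) : χ x w = χ y w := by
  induction h with
  | refl => rfl
  | @tail y z h1 h2 ih =>
    rw [ih]
    have hy : ¬ Cn χ i M y w := fun h => hn (h1.trans h)
    have hz : ¬ Cn χ i M z w := fun h => hn ((h1.tail h2).trans h)
    have hyw : y ≠ w := fun h => hy (h ▸ Relation.ReflTransGen.refl)
    have hzw : z ≠ w := fun h => hz (h ▸ Relation.ReflTransGen.refl)
    have c1 : χ y w ≠ i := fun h => hy (Relation.ReflTransGen.single ⟨h2.1, hw, hyw, h⟩)
    have c2 : χ z w ≠ i := fun h => hz (Relation.ReflTransGen.single ⟨h2.2.1, hw, hzw, h⟩)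
    rcases hnr y z w h2.2.2.1 hyw hzw with h | h | h
    · exact absurd (h.symm.trans h2.2.2.2) c1
    · exact absurd (h.symm.trans h2.2.2.2) c2
    · exact h

theorem Cn.exists_step {i : α} {M : Finset V} {x y : V} (h : Cn χ i M x y) (hne : x ≠ y) :
    ∃ z, Stp χ i M x z := by
  rcases Relation.ReflTransGen.cases_head h with h | ⟨z, h, -⟩
  · exact absurd h hne
  · exact ⟨z, h⟩

theorem three_aux (hsym : ∀ x y, χ x y = χ y x)
    (hnr : ∀ x y z, x ≠ y → x ≠ z → y ≠ z → χ x y = χ x z ∨ χ x y = χ y z ∨ χ x z = χ y z) {i j k : α} (hij : i ≠ j) (hik : i ≠ k) (hjk : j ≠ k) {M : Finset V} {v : V}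
    (hv : v ∈ M) (hi : ∀ x ∈ M, ∀ y ∈ M, Cn χ i M x y) (hj : ∀ x ∈ M, ∀ y ∈ M, Cn χ j M x y)
    (hk : ∀ x ∈ M, ∀ y ∈ M, Cn χ k M x y)
    (hd : ∃ a ∈ M.erase v, ∃ b ∈ M.erase v, ¬ Cn χ i (M.erase v) a b) : False := by
  obtain ⟨a, ha, b, hb, hab⟩ := hd
  have reach : ∀ w ∈ M.erase v, ∃ w' ∈ M.erase v, Cn χ i (M.erase v) w w' ∧ χ v w' = i := by
    intro w hw
    have h := hi w (Finset.mem_of_mem_erase hw) v hv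
    induction h using Relation.ReflTransGen.head_induction_on with
    | refl => simp at hw
    | @head w z h1 h2 ih =>
      by_cases hz : z = v
      · subst hz
        exact ⟨w, hw, Relation.ReflTransGen.refl, by rw [hsym]; exact h1.2.2.2⟩
      · have hz' : z ∈ M.erase v := by simp [hz, h1.2.1]
        obtain ⟨w', e1, e2, e3⟩ := ih hz'
        exact ⟨w', e1, Relation.ReflTransGen.head ⟨hw, hz', h1.2.2⟩ e2, e3⟩
  have spread : ∀ j : α, i ≠ j → ∀ y ∈ M.erase v, χ v y = j → ∀ w ∈ M.erase v,
      ¬ Cn χ i (M.erase v) y w → χ y w = j := by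
    intro j hij y hy hvy w hw hyw
    obtain ⟨w', e1, e2, e3⟩ := reach w hw
    have hyw' : ¬ Cn χ i (M.erase v) y w' := fun h => hyw (h.trans (Cn.sym hsym e2))
    have hne : y ≠ w' := fun h => hyw' (h ▸ Relation.ReflTransGen.refl)
    have c1 : χ y w' ≠ i := fun h => hyw' (Relation.ReflTransGen.single ⟨hy, e1, hne, h⟩)
    have c2 : χ y w' = j := by
      rcases hnr v y w' (Finset.ne_of_mem_erase hy).symm (Finset.ne_of_mem_erase e1).symm hne with h | h | h
      · exact absurd (e3.symm.trans (h.symm.trans hvy)) hij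
      · rw [← h, hvy]
      · exact absurd (h.symm.trans e3) c1
    have := Cn.mod hsym hnr e2 hw hy (fun h => hyw (Cn.sym hsym h))
    rw [hsym y w, this, hsym, c2]
  have ham := Finset.mem_of_mem_erase ha
  obtain ⟨y, hy⟩ := (hj v hv a ham).exists_step (Finset.ne_of_mem_erase ha).symm
  obtain ⟨y', hy'⟩ := (hk v hv a ham).exists_step (Finset.ne_of_mem_erase ha).symm
  have hyN : y ∈ M.erase v := by simp [hy.2.2.1.symm, hy.2.1]
  have hyN' : y' ∈ M.erase v := by simp [hy'.2.2.1.symm, hy'.2.1]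
  have s1 := spread j hij y hyN hy.2.2.2
  have s2 := spread k hik y' hyN' hy'.2.2.2
  by_cases hc : Cn χ i (M.erase v) y y'
  · obtain ⟨w, hw, hyw⟩ : ∃ w ∈ M.erase v, ¬ Cn χ i (M.erase v) y w := by
      by_contra hcon
      push Not at hcon
      exact hab ((Cn.sym hsym (hcon a ha)).trans (hcon b hb))
    have e1 := s1 w hw hyw
    have e2 := s2 w hw (fun h => hyw (hc.trans h))
    have := Cn.mod hsym hnr hc hyN hw hyw
    exact hjk (by rw [← e1, ← e2, this])
  · have e1 := s1 y' hyN' hc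
    have e2 := s2 y hyN (fun h => hc (Cn.sym hsym h))
    exact hjk (by rw [← e1, ← e2, hsym])

theorem three_conn (hsym : ∀ x y, χ x y = χ y x)
    (hnr : ∀ x y z, x ≠ y → x ≠ z → y ≠ z → χ x y = χ x z ∨ χ x y = χ y z ∨ χ x z = χ y z) {i j k : α} (hij : i ≠ j) (hik : i ≠ k) (hjk : j ≠ k) (n : ℕ) : ∀ M : Finset V,
    M.card = n + 2 → (∀ x ∈ M, ∀ y ∈ M, Cn χ i M x y) → (∀ x ∈ M, ∀ y ∈ M, Cn χ j M x y) →
    (∀ x ∈ M, ∀ y ∈ M, Cn χ k M x y) → False := by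
  induction n with
  | zero =>
    intro M hM hi hj _
    obtain ⟨x, y, hxy, rfl⟩ := Finset.card_eq_two.1 hM
    obtain ⟨z, hz⟩ := (hi x (by simp) y (by simp)).exists_step hxy
    obtain ⟨z', hz'⟩ := (hj x (by simp) y (by simp)).exists_step hxy
    have e1 : z = y := by
      have h1 := hz.2.1; have h2 := hz.2.2.1; simp at h1; tauto
    have e2 : z' = y := by
      have h1 := hz'.2.1; have h2 := hz'.2.2.1; simp at h1; tauto
    subst e1; subst e2
    exact hij (hz.2.2.2.symm.trans hz'.2.2.2)
  | succ n ih =>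
    intro M hM hi hj hk
    obtain ⟨v, hv⟩ := Finset.card_pos.1 (show 0 < M.card by omega)
    have hc : (M.erase v).card = n + 2 := by rw [Finset.card_erase_of_mem hv]; omega
    by_cases h1 : ∀ x ∈ M.erase v, ∀ y ∈ M.erase v, Cn χ i (M.erase v) x y
    · by_cases h2 : ∀ x ∈ M.erase v, ∀ y ∈ M.erase v, Cn χ j (M.erase v) x y
      · by_cases h3 : ∀ x ∈ M.erase v, ∀ y ∈ M.erase v, Cn χ k (M.erase v) x y
        · exact ih _ hc h1 h2 h3
        · push Not at h3
          exact three_aux hsym hnr hik.symm hjk.symm hij hv hk hi hj h3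
      · push Not at h2
        exact three_aux hsym hnr hij.symm hjk hik hv hj hi hk h2
    · push Not at h1
      exact three_aux hsym hnr hij hik hjk hv hi hj hk h1

theorem gallai_part (hsym : ∀ x y, χ x y = χ y x)
    (hnr : ∀ x y z, x ≠ y → x ≠ z → y ≠ z → χ x y = χ x z ∨ χ x y = χ y z ∨ χ x z = χ y z) [Fintype V] [DecidableEq α] (C : Finset α) (hC : 2 ≤ C.card) (n : ℕ) : ∀ M : Finset V,
    M.card = n → 2 ≤ n → (∀ x ∈ M, ∀ y ∈ M, x ≠ y → χ x y ∈ C) →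
    ∃ (part : V → ℕ) (r b : α), r ∈ C ∧ b ∈ C ∧ r ≠ b ∧
      (∃ x ∈ M, ∃ y ∈ M, part x ≠ part y) ∧
      (∀ x ∈ M, ∀ y ∈ M, part x ≠ part y → χ x y = r ∨ χ x y = b) ∧
      (∀ x ∈ M, ∀ x' ∈ M, ∀ y ∈ M, part x = part x' → part x ≠ part y → χ x y = χ x' y) := by
  induction n using Nat.strong_induction_on with
  | _ n ih =>
  intro M hM hn hcol
  by_cases hcase : ∃ i, (∃ x ∈ M, ∃ y ∈ M, x ≠ y ∧ χ x y = i) ∧ ∃ a ∈ M, ∃ b ∈ M, ¬ Cn χ i M a b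
  · obtain ⟨i, ⟨x, hx, y, hy, hxy, hi⟩, a, ha, b, hb, hab⟩ := hcase
    let st : Setoid V := ⟨Cn χ i M, ⟨fun _ => Relation.ReflTransGen.refl, fun h => Cn.sym hsym h,
      fun h1 h2 => h1.trans h2⟩⟩
    let rep : V → V := fun x => (Quotient.mk st x).out
    have r1 : ∀ x, Cn χ i M x (rep x) := fun x => Cn.sym hsym (Quotient.mk_out (s := st) x)
    have r2 : ∀ x y, Cn χ i M x y → rep x = rep y := fun x y h => by
      simp only [rep]; rw [Quotient.sound (s := st) h]
    have r3 : ∀ x y, rep x ≠ rep y → ¬ Cn χ i M x y := fun x y h h' => h (r2 _ _ h')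
    have r4 : ∀ x y, ¬ Cn χ i M x y → rep x ≠ rep y := fun x y h h' => h
      ((r1 x).trans (h' ▸ Cn.sym hsym (r1 y)))
    have r5 : ∀ x ∈ M, rep x ∈ M := fun x hx => (r1 x).mem hx
    have r6 : ∀ x ∈ M, ∀ y ∈ M, rep x ≠ rep y → χ x y = χ (rep x) (rep y) := by
      intro x hx y hy h
      have h1 := r3 x y h
      rw [Cn.mod hsym hnr (r1 x) hx hy h1, hsym (rep x) y,
        Cn.mod hsym hnr (r1 y) hy (r5 x hx) (fun h => h1 ((r1 x).trans (Cn.sym hsym h))), hsym]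
    have rr : ∀ x, rep (rep x) = rep x := fun x => (r2 _ _ (r1 x)).symm
    have c1 : (M.image rep).card < M.card := by
      refine lt_of_le_of_ne Finset.card_image_le (fun h => ?_)
      rw [Finset.card_image_iff] at h
      exact hxy (h hx hy (r2 _ _ (Relation.ReflTransGen.single ⟨hx, hy, hxy, hi⟩)))
    have c2 : 1 < (M.image rep).card := Finset.one_lt_card.2
      ⟨rep a, Finset.mem_image_of_mem _ ha, rep b, Finset.mem_image_of_mem _ hb, r4 _ _ hab⟩
    have hsub : ∀ x ∈ M.image rep, x ∈ M := by
      intro x hx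
      obtain ⟨y, hy, rfl⟩ := Finset.mem_image.1 hx
      exact r5 y hy
    obtain ⟨part, r, b', p1, p2, p3, ⟨z, hz, w, hw, p4⟩, p5, p6⟩ := ih _ (hM ▸ c1) (M.image rep) rfl c2
      (fun x hx y hy => hcol x (hsub x hx) y (hsub y hy))
    have him : ∀ x ∈ M, rep x ∈ M.image rep := fun x hx => Finset.mem_image_of_mem _ hx
    have hneq : ∀ x y, part (rep x) ≠ part (rep y) → rep x ≠ rep y := fun x y h h' => h (by rw [h'])
    refine ⟨part ∘ rep, r, b', p1, p2, p3, ?_, ?_, ?_⟩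
    · obtain ⟨z', hz', rfl⟩ := Finset.mem_image.1 hz
      obtain ⟨w', hw', rfl⟩ := Finset.mem_image.1 hw
      exact ⟨z', hz', w', hw', p4⟩
    · intro x hx y hy h
      rw [r6 x hx y hy (hneq _ _ h)]
      exact p5 _ (him x hx) _ (him y hy) h
    · intro x hx x' hx' y hy h1 h2
      have h2' : part (rep x') ≠ part (rep y) := by
        simp only [Function.comp] at h1 h2; rw [← h1]; exact h2
      rw [r6 x hx y hy (hneq _ _ h2), r6 x' hx' y hy (hneq _ _ h2')]
      exact p6 _ (him x hx) _ (him x' hx') _ (him y hy) h1 h2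
  · push Not at hcase
    let U := C.filter (fun i => ∃ x ∈ M, ∃ y ∈ M, x ≠ y ∧ χ x y = i)
    classical
    have hU : U.card ≤ 2 := by
      by_contra hcon
      obtain ⟨i, j, k, hi, hj, hk, hij, hik, hjk⟩ := Finset.two_lt_card_iff.1 (not_le.1 hcon)
      simp only [U, Finset.mem_filter] at hi hj hk
      obtain ⟨_, x1, h1, y1, h1', e1⟩ := hi
      obtain ⟨_, x2, h2, y2, h2', e2⟩ := hj
      obtain ⟨_, x3, h3, y3, h3', e3⟩ := hk
      exact three_conn hsym hnr hij hik hjk (n - 2) M (by omega) (hcase i ⟨x1, h1, y1, h1', e1⟩)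
        (hcase j ⟨x2, h2, y2, h2', e2⟩) (hcase k ⟨x3, h3, y3, h3', e3⟩)
    obtain ⟨B, hB1, hB2, hB3⟩ := Finset.exists_subsuperset_card_eq (Finset.filter_subset _ _ : U ⊆ C) hU hC
    obtain ⟨r, b, hrb, rfl⟩ := Finset.card_eq_two.1 hB3
    have inj : ∀ x y : V, (Fintype.equivFin V x).1 = (Fintype.equivFin V y).1 → x = y := fun x y h =>
      (Fintype.equivFin V).injective (Fin.ext h)
    refine ⟨fun x => (Fintype.equivFin V x).1, r, b, hB2 (by simp), hB2 (by simp), hrb, ?_, ?_, ?_⟩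
    · obtain ⟨x, hx, y, hy, hxy⟩ := Finset.one_lt_card.1 (show 1 < M.card by omega)
      exact ⟨x, hx, y, hy, fun h => hxy (inj _ _ h)⟩
    · intro x hx y hy h
      have hxy : x ≠ y := fun h' => h (by rw [h'])
      have : χ x y ∈ U := by
        simp only [U, Finset.mem_filter]
        exact ⟨hcol x hx y hy hxy, x, hx, y, hy, hxy, rfl⟩
      have := hB1 this
      simpa using this
    · intro x _ x' _ y _ h _
      rw [inj _ _ h]
end gallai
end GR

namespace GR
set_option linter.unusedSectionVars false
section multi
variable {V : Type*} [DecidableEq V]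

/-- Two-coloured complete multipartite setting whose classes are modules. -/
structure Multi (ℓ : ℕ) (S : Finset V) (part : V → ℕ) (R B : V → V → Prop) : Prop where
  Rs : ∀ x y, R x y → R y x
  Bs : ∀ x y, B x y → B y x
  Rn : ∀ x y, R x y → part x ≠ part y
  Bn : ∀ x y, B x y → part x ≠ part y
  tot : ∀ x ∈ S, ∀ y ∈ S, part x ≠ part y → R x y ∨ B x y
  ex : ∀ x y, R x y → B x y → False
  Rm : ∀ x ∈ S, ∀ x' ∈ S, ∀ y ∈ S, part x = part x' → R x y → R x' y
  Bm : ∀ x ∈ S, ∀ x' ∈ S, ∀ y ∈ S, part x = part x' → B x y → B x' y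
  sz : ∀ x ∈ S, (S.filter (fun y => part y = part x)).card ≤ ℓ

variable {ℓ : ℕ} {S : Finset V} {part : V → ℕ} {R B : V → V → Prop}

theorem Multi.swap (h : Multi ℓ S part R B) : Multi ℓ S part B R where
  Rs := h.Bs
  Bs := h.Rs
  Rn := h.Bn
  Bn := h.Rn
  tot := fun x hx y hy hn => (h.tot x hx y hy hn).symm
  ex := fun x y h1 h2 => h.ex x y h2 h1
  Rm := h.Bm
  Bm := h.Rm
  sz := h.sz

theorem Multi.mono (h : Multi ℓ S part R B) {T : Finset V} (hT : T ⊆ S) {ℓ' : ℕ}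
    (hsz : ∀ x ∈ T, (T.filter (fun y => part y = part x)).card ≤ ℓ') : Multi ℓ' T part R B where
  Rs := h.Rs
  Bs := h.Bs
  Rn := h.Rn
  Bn := h.Bn
  tot := fun x hx y hy hn => h.tot x (hT hx) y (hT hy) hn
  ex := h.ex
  Rm := fun x hx y hy z hz => h.Rm x (hT hx) y (hT hy) z (hT hz)
  Bm := fun x hx y hy z hz => h.Bm x (hT hx) y (hT hy) z (hT hz)
  sz := hsz

theorem Multi.sub (h : Multi ℓ S part R B) {T : Finset V} (hT : T ⊆ S) : Multi ℓ T part R B :=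
  h.mono hT (fun x hx => (Finset.card_le_card (Finset.filter_subset_filter _ hT)).trans (h.sz x (hT hx)))

/-- a set with more than `ℓ` elements meets two classes -/
theorem Multi.two (h : Multi ℓ S part R B) {T : Finset V} (hT : T ⊆ S) (hc : ℓ + 1 ≤ T.card) :
    ∃ x ∈ T, ∃ y ∈ T, part x ≠ part y := by
  by_contra hcon
  push Not at hcon
  obtain ⟨x, hx⟩ := Finset.card_pos.1 (show 0 < T.card by omega)
  have h1 := h.sz x (hT hx)
  have : T ⊆ S.filter (fun y => part y = part x) := fun y hy => by
    rw [Finset.mem_filter]; exact ⟨hT hy, hcon y hy x hx⟩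
  have := Finset.card_le_card this
  omega

theorem Multi.BLside (h : Multi ℓ S part R B) (hl : 1 ≤ ℓ) {X P T : Finset V} (hP : P ⊆ S) (hT : T ⊆ S)
    (hX : Disjoint S X) (hXR : Bic R X S) (hXc : X.card ≤ ℓ)
    (hPT : Disjoint P T) (hb : Bic R P T) (hPc : ℓ + 1 ≤ P.card)
    (hin : ∀ x ∈ P, ∀ y ∈ P, part x ≠ part y → R x y)
    (noR : ¬ HasCyc R (S ∪ X) (2 * ℓ + 1)) : P.card + T.card + X.card ≤ 2 * ℓ := by
  obtain ⟨x, hx, y, hy, hxy⟩ := h.two hP hPc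
  have hTc : T.card ≤ ℓ := by
    by_contra hcon
    refine noR ((U1 hl hb hPT hx hy (fun e => hxy (e ▸ rfl)) (hin y hy x hx hxy.symm) hPc (by omega)).mono ?_)
    exact Finset.union_subset (hP.trans Finset.subset_union_left) (hT.trans Finset.subset_union_left)
  have hdX : Disjoint (P ∪ T) X := hX.mono_left (Finset.union_subset hP hT)
  by_contra hcon
  refine noR (HasCyc.mono (MP hl (P ∪ T ∪ X) (fun x => if x ∈ X then 0 else if x ∈ T then 1 else part x + 2)
    ?_ ?_ ?_) (Finset.union_subset_union (Finset.union_subset hP hT) subset_rfl))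
  · intro x hx y hy hxy
    have hS : ∀ x ∈ P ∪ T ∪ X, x ∉ X → x ∈ S := by
      intro x hx h; simp only [Finset.mem_union, h, or_false] at hx
      exact hx.elim (fun h => hP h) (fun h => hT h)
    have hPm : ∀ x ∈ P ∪ T ∪ X, x ∉ X → x ∉ T → x ∈ P := by
      intro x hx h h'; simpa only [Finset.mem_union, h, h', or_false] using hx
    by_cases x1 : x ∈ X <;> by_cases y1 : y ∈ X
    · simp [x1, y1] at hxy
    · exact (hXR x x1 y (hS y hy y1)).1
    · exact (hXR y y1 x (hS x hx x1)).2
    by_cases x2 : x ∈ T <;> by_cases y2 : y ∈ T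
    · simp [x1, y1, x2, y2] at hxy
    · exact (hb y (hPm y hy y1 y2) x x2).2
    · exact (hb x (hPm x hx x1 x2) y y2).1
    · simp [x1, y1, x2, y2] at hxy
      exact hin x (hPm x hx x1 x2) y (hPm y hy y1 y2) hxy
  · intro x hx
    by_cases x1 : x ∈ X
    · refine (Finset.card_le_card ?_).trans hXc
      intro y hy
      simp only [Finset.mem_filter, x1, if_true] at hy
      by_contra y1
      have := hy.2
      rw [if_neg y1] at this
      split_ifs at this
    by_cases x2 : x ∈ T
    · refine (Finset.card_le_card ?_).trans hTc
      intro y hy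
      simp only [Finset.mem_filter, x1, x2, if_true, if_false] at hy
      by_contra y2
      have := hy.2
      rw [if_neg y2] at this
      split_ifs at this
      omega
    · have xS : x ∈ S := by
        simp only [Finset.mem_union, x1, x2, or_false] at hx; exact hP hx
      refine (Finset.card_le_card ?_).trans (h.sz x xS)
      intro y hy
      simp only [Finset.mem_filter, x1, x2, if_false] at hy
      obtain ⟨y0, h1⟩ := hy
      by_cases y1 : y ∈ X
      · simp [y1] at h1
      by_cases y2 : y ∈ T
      · simp [y1, y2] at h1
      simp [y1, y2] at h1
      simp only [Finset.mem_union, y1, y2, or_false] at y0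
      simp [h1, hP y0]
  · rw [Finset.card_union_of_disjoint hdX, Finset.card_union_of_disjoint hPT]; omega

theorem Multi.BL (h : Multi ℓ S part R B) (hl : 1 ≤ ℓ) {X P0 Q0 : Finset V} (hP0 : P0 ⊆ S) (hQ0 : Q0 ⊆ S)
    (hX : Disjoint S X) (hXR : Bic R X S) (hXc : X.card ≤ ℓ)
    (hb0 : Bic B P0 Q0) (hPc0 : ℓ + 1 ≤ P0.card) (hQc0 : ℓ + 1 ≤ Q0.card)
    (noR : ¬ HasCyc R (S ∪ X) (2 * ℓ + 1)) (noB : ¬ HasCyc B S (2 * ℓ + 1)) :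
    S.card + 2 * X.card ≤ 4 * ℓ := by
  classical
  let P := S.filter (fun x => ∀ q ∈ Q0, B x q)
  let Q := S.filter (fun x => ∀ p ∈ P, B x p)
  have hPS : P ⊆ S := Finset.filter_subset _ _
  have hQS : Q ⊆ S := Finset.filter_subset _ _
  have hP : ∀ x, x ∈ P ↔ x ∈ S ∧ ∀ q ∈ Q0, B x q := fun x => by simp [P]
  have hQ : ∀ x, x ∈ Q ↔ x ∈ S ∧ ∀ p ∈ P, B x p := fun x => by simp only [Q, Finset.mem_filter]
  have hP0P : P0 ⊆ P := fun x hx => (hP x).2 ⟨hP0 hx, fun q hq => (hb0 x hx q hq).1⟩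
  have hQ0Q : Q0 ⊆ Q := fun x hx => (hQ x).2 ⟨hQ0 hx, fun p hp => h.Bs _ _ (((hP p).1 hp).2 x hx)⟩
  have hPQ : Disjoint P Q := by
    rw [Finset.disjoint_left]
    intro x hx hx'
    exact h.Bn x x (((hQ x).1 hx').2 x hx) rfl
  have hb : Bic B P Q := fun p hp q hq => ⟨h.Bs _ _ (((hQ q).1 hq).2 p hp), ((hQ q).1 hq).2 p hp⟩
  have hPc : ℓ + 1 ≤ P.card := hPc0.trans (Finset.card_le_card hP0P)
  have hQc : ℓ + 1 ≤ Q.card := hQc0.trans (Finset.card_le_card hQ0Q)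
  have hU : P ∪ Q ⊆ S := Finset.union_subset hPS hQS
  have inP : ∀ x ∈ P, ∀ y ∈ P, part x ≠ part y → R x y := by
    intro x hx y hy hxy
    refine (h.tot x (hPS hx) y (hPS hy) hxy).resolve_right (fun hB => ?_)
    exact noB ((U1 hl hb hPQ hx hy (fun e => hxy (e ▸ rfl)) (h.Bs _ _ hB) hPc (by omega)).mono hU)
  have inQ : ∀ x ∈ Q, ∀ y ∈ Q, part x ≠ part y → R x y := by
    intro x hx y hy hxy
    refine (h.tot x (hQS hx) y (hQS hy) hxy).resolve_right (fun hB => ?_)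
    exact noB ((U1 hl hb.symm hPQ.symm hx hy (fun e => hxy (e ▸ rfl)) (h.Bs _ _ hB) hQc (by omega)).mono
      (Finset.union_comm P Q ▸ hU))
  let SP := S.filter (fun s => s ∉ P ∧ s ∉ Q ∧ ∀ p ∈ P, ¬ B s p)
  let SQ := S.filter (fun s => s ∉ P ∧ s ∉ Q ∧ ¬ ∀ p ∈ P, ¬ B s p)
  have twP : ∀ s ∈ S, s ∉ P → ∀ p ∈ P, part s ≠ part p := by
    intro s hs hsP p hp e
    exact hsP ((hP s).2 ⟨hs, fun q hq => h.Bm p (hPS hp) s hs q (hQ0 hq) e.symm (((hP p).1 hp).2 q hq)⟩)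
  have twQ : ∀ s ∈ S, s ∉ Q → ∀ q ∈ Q, part s ≠ part q := by
    intro s hs hsQ q hq e
    exact hsQ ((hQ s).2 ⟨hs, fun p hp => h.Bm q (hQS hq) s hs p (hPS hp) e.symm (((hQ q).1 hq).2 p hp)⟩)
  have b1 : Bic R P SP := by
    intro p hp s hs
    simp only [SP, Finset.mem_filter] at hs
    have : R s p := (h.tot s hs.1 p (hPS hp) (twP s hs.1 hs.2.1 p hp)).resolve_right (hs.2.2.2 p hp)
    exact ⟨h.Rs _ _ this, this⟩
  have b2 : Bic R Q SQ := by
    intro q hq s hs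
    simp only [SQ, Finset.mem_filter] at hs
    obtain ⟨s1, s2, s3, s4⟩ := hs
    push Not at s4
    obtain ⟨p, hp, hsp⟩ := s4
    have : R s q := (h.tot s s1 q (hQS hq) (twQ s s1 s3 q hq)).resolve_right (fun hB =>
      noB ((U2 hl hb hPQ (by simp [s2, s3]) hp hq hsp (h.Bs _ _ hB) (by omega) (by omega)).mono
        (Finset.insert_subset s1 hU)))
    exact ⟨h.Rs _ _ this, this⟩
  have k1 := h.BLside (T := SP) hl hPS (Finset.filter_subset _ _ : SP ⊆ S) hX hXR hXc
    (by rw [Finset.disjoint_left]; intro x hx hx'; simp only [SP, Finset.mem_filter] at hx'; exact hx'.2.1 hx)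
    b1 hPc inP noR
  have k2 := h.BLside (T := SQ) hl hQS (Finset.filter_subset _ _ : SQ ⊆ S) hX hXR hXc
    (by rw [Finset.disjoint_left]; intro x hx hx'; simp only [SQ, Finset.mem_filter] at hx'; exact hx'.2.2.1 hx)
    b2 hQc inQ noR
  have k3 : S.card ≤ ((P ∪ SP) ∪ (Q ∪ SQ)).card := by
    apply Finset.card_le_card
    intro x hx
    simp only [Finset.mem_union, SP, SQ, Finset.mem_filter]
    tauto
  have k4 := Finset.card_union_le (P ∪ SP) (Q ∪ SQ)
  have k5 := Finset.card_union_le P SP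
  have k6 := Finset.card_union_le Q SQ
  omega

theorem Multi.ST (h : Multi ℓ S part R B) (hl : 1 ≤ ℓ) {P Q : Finset V} (hP : P ⊆ S) (hQ : Q ⊆ S)
    (hPQ : Disjoint P Q) (hb : ∀ x ∈ P, ∀ y ∈ Q, part x ≠ part y → B x y)
    (hPc : ℓ + 1 ≤ P.card) (hQc : ℓ + 1 ≤ Q.card)
    (noR : ¬ HasCyc R S (2 * ℓ + 1)) (noB : ¬ HasCyc B S (2 * ℓ + 1)) : S.card ≤ 4 * ℓ := by
  classical
  let P1 := P.filter (fun x => ∀ q ∈ Q, part x ≠ part q)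
  let Q1 := Q.filter (fun y => ∀ p ∈ P, part p ≠ part y)
  have mP1 : ∀ x, x ∈ P1 ↔ x ∈ P ∧ ∀ q ∈ Q, part x ≠ part q := fun x => by simp [P1]
  have mQ1 : ∀ y, y ∈ Q1 ↔ y ∈ Q ∧ ∀ p ∈ P, part p ≠ part y := fun x => by simp [Q1]
  have hP1 : P1 ⊆ P := Finset.filter_subset _ _
  have hQ1 : Q1 ⊆ Q := Finset.filter_subset _ _
  have fin : ∀ A A' : Finset V, A ⊆ S → A' ⊆ S → Bic B A A' → ℓ + 1 ≤ A.card → ℓ + 1 ≤ A'.card →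
      S.card ≤ 4 * ℓ := by
    intro A A' h1 h2 h3 h4 h5
    have := h.BL hl (X := ∅) h1 h2 (by simp) (by intro p hp; simp at hp) (by simp) h3 h4 h5 (by simpa using noR) noB
    simpa using this
  by_cases c1 : ℓ + 1 ≤ P1.card
  · refine fin P1 Q (hP1.trans hP) hQ ?_ c1 hQc
    intro p hp q hq
    have := hb p (hP1 hp) q hq (((mP1 p).1 hp).2 q hq)
    exact ⟨this, h.Bs _ _ this⟩
  by_cases c2 : ℓ + 1 ≤ Q1.card
  · refine fin P Q1 hP (hQ1.trans hQ) ?_ hPc c2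
    intro p hp q hq
    have := hb p hp q (hQ1 hq) (((mQ1 q).1 hq).2 p hp)
    exact ⟨this, h.Bs _ _ this⟩
  exfalso
  have hU : P ∪ Q ⊆ S := Finset.union_subset hP hQ
  -- every two elements of different classes, not both in `P1` or both in `Q1`, are blue
  have twP : ∀ x ∈ P, x ∉ P1 → ∃ q ∈ Q, part x = part q := by
    intro x hx hx'
    by_contra hcon; push Not at hcon
    exact hx' ((mP1 x).2 ⟨hx, hcon⟩)
  have twQ : ∀ x ∈ Q, x ∉ Q1 → ∃ p ∈ P, part p = part x := by
    intro x hx hx'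
    by_contra hcon; push Not at hcon
    exact hx' ((mQ1 x).2 ⟨hx, hcon⟩)
  -- an element of the mixed set is blue to everything of another class
  have mixed : ∀ x ∈ P ∪ Q, x ∉ P1 → x ∉ Q1 → ∀ y ∈ P ∪ Q, part x ≠ part y → B x y := by
    intro x hx hx1 hx2 y hy hxy
    have : (∃ p ∈ P, part p = part x) ∧ (∃ q ∈ Q, part q = part x) := by
      rcases Finset.mem_union.1 hx with hx | hx
      · obtain ⟨q, hq, e⟩ := twP x hx hx1
        exact ⟨⟨x, hx, rfl⟩, ⟨q, hq, e.symm⟩⟩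
      · obtain ⟨p, hp, e⟩ := twQ x hx hx2
        exact ⟨⟨p, hp, e⟩, ⟨x, hx, rfl⟩⟩
    obtain ⟨⟨p, hp, ep⟩, ⟨q, hq, eq⟩⟩ := this
    rcases Finset.mem_union.1 hy with hy' | hy'
    · exact h.Bm q (hQ hq) x (hU hx) y (hU hy) eq (h.Bs _ _ (hb y hy' q hq (by rw [eq]; exact hxy.symm)))
    · exact h.Bm p (hP hp) x (hU hx) y (hU hy) ep (hb p hp y hy' (by rw [ep]; exact hxy))
  have d1 : ∀ x ∈ P1, x ∉ Q1 := fun x hx hx' => Finset.disjoint_left.1 hPQ (hP1 hx) (hQ1 hx')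
  have pP1 : ∀ x ∈ P1, ∀ y ∈ P ∪ Q, y ∉ P1 → part x ≠ part y := by
    intro x hx y hy hy1 e
    rcases Finset.mem_union.1 hy with hy | hy
    · obtain ⟨q, hq, e'⟩ := twP y hy hy1
      exact ((mP1 x).1 hx).2 q hq (e.trans e')
    · exact ((mP1 x).1 hx).2 y hy e
  have pQ1 : ∀ x ∈ Q1, ∀ y ∈ P ∪ Q, y ∉ Q1 → part y ≠ part x := by
    intro x hx y hy hy1 e
    rcases Finset.mem_union.1 hy with hy | hy
    · exact ((mQ1 x).1 hx).2 y hy e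
    · obtain ⟨q, hq, e'⟩ := twQ y hy hy1
      exact ((mQ1 x).1 hx).2 q hq (e'.trans e)
  refine noB (HasCyc.mono (MP hl (P ∪ Q) (fun x => if x ∈ P1 then 0 else if x ∈ Q1 then 1 else part x + 2)
    ?_ ?_ ?_) hU)
  · intro x hx y hy hxy
    by_cases x1 : x ∈ P1 <;> by_cases y1 : y ∈ P1
    · simp [x1, y1] at hxy
    · by_cases y2 : y ∈ Q1
      · exact hb x (hP1 x1) y (hQ1 y2) (((mP1 x).1 x1).2 y (hQ1 y2))
      · exact h.Bs _ _ (mixed y hy y1 y2 x hx (pP1 x x1 y hy y1).symm)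
    · by_cases x2 : x ∈ Q1
      · exact h.Bs _ _ (hb y (hP1 y1) x (hQ1 x2) (((mP1 y).1 y1).2 x (hQ1 x2)))
      · exact (mixed x hx x1 x2 y hy (pP1 y y1 x hx x1).symm)
    by_cases x2 : x ∈ Q1 <;> by_cases y2 : y ∈ Q1
    · simp [x1, y1, x2, y2] at hxy
    · exact h.Bs _ _ (mixed y hy y1 y2 x hx (pQ1 x x2 y hy y2))
    · exact mixed x hx x1 x2 y hy (pQ1 y y2 x hx x2)
    · simp [x1, y1, x2, y2] at hxy
      exact mixed x hx x1 x2 y hy hxy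
  · intro x hx
    by_cases x1 : x ∈ P1
    · refine (Finset.card_le_card ?_).trans (show P1.card ≤ ℓ by omega)
      intro y hy
      simp only [Finset.mem_filter, x1, if_true] at hy
      by_contra y1
      have := hy.2
      rw [if_neg y1] at this
      split_ifs at this
    by_cases x2 : x ∈ Q1
    · refine (Finset.card_le_card ?_).trans (show Q1.card ≤ ℓ by omega)
      intro y hy
      simp only [Finset.mem_filter, x1, x2, if_true, if_false] at hy
      by_contra y2
      have := hy.2
      rw [if_neg y2] at this
      split_ifs at this
      omega
    · refine (Finset.card_le_card ?_).trans (h.sz x (hU hx))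
      intro y hy
      simp only [Finset.mem_filter, x1, x2, if_false] at hy
      obtain ⟨y0, h1⟩ := hy
      by_cases y1 : y ∈ P1
      · simp [y1] at h1
      by_cases y2 : y ∈ Q1
      · simp [y1, y2] at h1
      simp [y1, y2] at h1
      simp [h1, hU y0]
  · rw [Finset.card_union_of_disjoint hPQ]; omega

theorem Pth.trunc {G : V → V → Prop} {a b : V} {F : Finset V} (h : Pth G a b F) (m : ℕ) (h1 : 1 ≤ m)
    (h2 : m ≤ F.card) : ∃ b' F', F' ⊆ F ∧ Pth G a b' F' ∧ F'.card = m := by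
  obtain ⟨f, f0, fl, fi, fa, fF⟩ := h.to_fun
  obtain ⟨k, rfl⟩ : ∃ k, m = k + 1 := ⟨m - 1, by omega⟩
  have hi : ∀ i ≤ k, ∀ j ≤ k, f i = f j → i = j := fun i hi j hj => fi i (by omega) j (by omega)
  refine ⟨f k, _, ?_, f0 ▸ Pth.of_fun f k hi (fun i hi => fa i (by omega)), card_of_fun f k hi⟩
  intro x hx
  rw [← fF]
  refine Finset.image_subset_image ?_ hx
  intro y; simp; omega

theorem Multi.star (h : Multi ℓ S part R B) (hl : 1 ≤ ℓ) {H : Finset V} (hH : H ⊆ S) (hc : 4 * ℓ + 1 ≤ H.card)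
    (noR : ¬ HasCyc R S (2 * ℓ + 1)) (noB : ¬ HasCyc B S (2 * ℓ + 1)) :
    ∃ a b F, Pth R a b F ∧ F ⊆ H ∧ F.card = 2 * ℓ := by
  obtain ⟨U, P, Q, h1, h2, h3, h4, h5, h6, h7⟩ := DFS h.Rs H
  have hPH : P ⊆ H := by rw [← h1]; intro x; simp; tauto
  have hQH : Q ⊆ H := by rw [← h1]; intro x; simp; tauto
  have hUH : U ⊆ H := by rw [← h1]; intro x; simp; tauto
  have hcard : H.card = U.card + P.card + Q.card := by
    rw [← h1, Finset.card_union_of_disjoint (Finset.disjoint_union_left.2 ⟨h3, h4⟩),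
      Finset.card_union_of_disjoint h2]
  by_cases hU : 2 * ℓ ≤ U.card
  · rcases h7 with rfl | ⟨a, b, hp⟩
    · simp at hU; omega
    · obtain ⟨b', F', e1, e2, e3⟩ := hp.trunc (2 * ℓ) (by omega) hU
      exact ⟨a, b', F', e2, e1.trans hUH, e3⟩
  · exfalso
    have := h.ST hl (hPH.trans hH) (hQH.trans hH) h4
      (fun x hx y hy hxy => (h.tot x (hH (hPH hx)) y (hH (hQH hy)) hxy).resolve_left (h6 x hx y hy))
      (by omega) (by omega) noR noB
    have := Finset.card_le_card hH
    omega
end multi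
end GR

namespace GR
set_option linter.unusedSectionVars false
section cyc
variable {V : Type*} [DecidableEq V]

theorem mod_ne {N x y : ℕ} (h1 : x < y) (h2 : y < x + N) : x % N ≠ y % N := by
  intro h
  have := (Nat.modEq_iff_dvd' h1.le).1 h
  have := Nat.le_of_dvd (by omega) this
  omega

theorem seg {G : V → V → Prop} {N : ℕ} {v : ℕ → V} (hv : ∀ i j, v i = v j ↔ i % N = j % N)
    (ha : ∀ i, G (v i) (v (i + 1))) (a b : ℕ) (hab : a ≤ b) (hb : b < a + N) :
    Pth G (v a) (v b) ((Finset.Icc a b).image v) ∧ ((Finset.Icc a b).image v).card = b + 1 - a := by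
  have inj : ∀ i ∈ Finset.Icc a b, ∀ j ∈ Finset.Icc a b, v i = v j → i = j := by
    intro i hi j hj h
    rw [hv] at h
    rw [Finset.mem_Icc] at hi hj
    by_contra hne
    rcases Nat.lt_or_gt_of_ne hne with h' | h'
    · exact mod_ne h' (by omega) h
    · exact mod_ne h' (by omega) h.symm
  constructor
  · have := Pth.of_fun (G := G) (fun i => v (a + i)) (b - a) (fun i hi j hj h => by
      have := inj (a + i) (by simp; omega) (a + j) (by simp; omega) h
      omega) (fun i _ => ha (a + i))
    have e : (Finset.range (b - a + 1)).image (fun i => v (a + i)) = (Finset.Icc a b).image v := by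
      ext x
      simp only [Finset.mem_image, Finset.mem_range, Finset.mem_Icc]
      constructor
      · rintro ⟨i, hi, rfl⟩; exact ⟨a + i, by omega, rfl⟩
      · rintro ⟨i, hi, rfl⟩; exact ⟨i - a, by omega, by congr 1; omega⟩
    rw [e] at this
    simpa [hab] using this
  · rw [Finset.card_image_of_injOn, Nat.card_Icc]
    intro i hi j hj h
    exact inj i (by simpa using hi) j (by simpa using hj) h

theorem seg_disj {N : ℕ} {v : ℕ → V} (hv : ∀ i j, v i = v j ↔ i % N = j % N) {a b c d : ℕ}
    (h1 : b < c) (h2 : d < a + N) : Disjoint ((Finset.Icc a b).image v) ((Finset.Icc c d).image v) := by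
  rw [Finset.disjoint_left]
  intro x hx hx'
  simp only [Finset.mem_image, Finset.mem_Icc] at hx hx'
  obtain ⟨i, hi, rfl⟩ := hx
  obtain ⟨j, hj, h⟩ := hx'
  rw [hv] at h
  exact mod_ne (show i < j by omega) (by omega) h.symm

theorem parity {p : ℕ → Prop} (h : ∀ i, p (i + 1) ↔ ¬ p i) (m : ℕ) : ¬ (p (2 * m + 1) ↔ p 0) := by
  have : p (2 * m) ↔ p 0 := by
    induction m with
    | zero => rfl
    | succ m ih =>
      rw [show 2 * (m + 1) = 2 * m + 1 + 1 by ring, h, h, ih]; simp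
  rw [h, this]; tauto

/-- two different vertices inserted at two different edges -/
theorem two_ins {G : V → V → Prop} (hs : ∀ x y, G x y → G y x) {N : ℕ} {v : ℕ → V}
    (hv : ∀ i j, v i = v j ↔ i % N = j % N)
    (ha : ∀ i, G (v i) (v (i + 1))) {S : Finset V} (hS : ∀ i, v i ∈ S) {w w' : V} {i j : ℕ} (hij : i < j) (hj : j < i + N)
    (hw : ∀ i, w ≠ v i) (hw' : ∀ i, w' ≠ v i) (hne : w ≠ w') (wS : w ∈ S) (wS' : w' ∈ S)
    (a1 : G w (v i)) (a2 : G w (v (i + 1))) (b1 : G w' (v j)) (b2 : G w' (v (j + 1))) :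
    HasCyc G S (N + 2) := by
  obtain ⟨p1, c1⟩ := seg hv ha (i + 1) j (by omega) (by omega)
  obtain ⟨p2, c2⟩ := seg hv ha (j + 1) (i + N) (by omega) (by omega)
  have hd := seg_disj hv (a := i + 1) (b := j) (c := j + 1) (d := i + N) (by omega) (by omega)
  have e : v (i + N) = v i := by rw [hv]; simp
  have ni : ∀ (w : V), (∀ i, w ≠ v i) → ∀ s : Finset ℕ, w ∉ s.image v := by
    intro w hw s h
    obtain ⟨i, _, h⟩ := Finset.mem_image.1 h
    exact hw i h.symm
  have q2 := Pth.cons b2 (ni w' hw' _) p2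
  have q1 := p1.append (hs _ _ b1) q2 (by
    rw [Finset.disjoint_insert_right]; exact ⟨ni w' hw' _, hd⟩)
  have hwn : w ∉ (Finset.Icc (i + 1) j).image v ∪ insert w' ((Finset.Icc (j + 1) (i + N)).image v) := by
    simp only [Finset.mem_union, Finset.mem_insert, not_or]
    exact ⟨ni w hw _, hne, ni w hw _⟩
  refine ⟨_, _, _, Pth.cons a2 hwn q1, by rw [e]; exact hs _ _ a1, ?_, ?_⟩
  · intro x hx
    simp only [Finset.mem_union, Finset.mem_insert, Finset.mem_image] at hx
    rcases hx with rfl | ⟨i, _, rfl⟩ | rfl | ⟨i, _, rfl⟩ <;> first | assumption | exact hS _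
  · rw [Finset.card_insert_of_notMem hwn, Finset.card_union_of_disjoint (by
      rw [Finset.disjoint_insert_right]; exact ⟨ni w' hw' _, hd⟩), Finset.card_insert_of_notMem (ni w' hw' _),
      c1, c2]
    omega

end cyc

section Q
variable {V : Type*} [DecidableEq V] {ℓ : ℕ} {S : Finset V} {part : V → ℕ} {R B : V → V → Prop}

theorem Multi.caseY (h : Multi ℓ S part R B) (hl : 2 ≤ ℓ)
    (noR : ¬ HasCyc R S (2 * ℓ + 1)) (noB : ¬ HasCyc B S (2 * ℓ + 1)) {v : ℕ → V} {TO TE E : Finset V}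
    (hTO : TO ⊆ S) (hTE : TE ⊆ S) (hE : E ⊆ S) (cO : ℓ + 2 ≤ TO.card) (cE : ℓ + 2 ≤ TE.card)
    (cE0 : ℓ ≤ E.card) {x y : V} (hx : x ∈ E) (hy : y ∈ E) (hxy : R y x)
    (bO : Bic R TO E) (bE : Bic B TE E) : False := by
  classical
  have d1 : Disjoint TO E := by
    rw [Finset.disjoint_left]; intro a ha ha'
    exact h.Rn a a (bO a ha a ha').1 rfl
  have d2 : Disjoint TE E := by
    rw [Finset.disjoint_left]; intro a ha ha'
    exact h.Bn a a (bE a ha a ha').1 rfl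
  have dp : ∀ t ∈ TO, ∀ z ∈ TE, part t ≠ part z := by
    intro t ht z hz e
    exact h.ex z x (h.Rm t (hTO ht) z (hTE hz) x (hE hx) e (bO t ht x hx).1) (bE z hz x hx).1
  have d3 : Disjoint TO TE := by
    rw [Finset.disjoint_left]; intro a ha ha'; exact dp a ha a ha' rfl
  have xy : x ≠ y := fun e => h.Rn y x hxy (e ▸ rfl)
  have noRO : ∀ t ∈ TO, ∀ t' ∈ TO, ¬ R t t' := by
    intro t ht t' ht' hR
    exact noR ((U1 (by omega) bO d1 ht ht' (fun e => h.Rn t t' hR (e ▸ rfl)) (h.Rs _ _ hR) (by omega) cE0).mono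
      (Finset.union_subset hTO hE))
  have one : ∀ z ∈ TE, ∀ t ∈ TO, ∀ t' ∈ TO, t ≠ t' → R t z → R t' z → False := by
    intro z hz t ht t' ht' hne h1 h2
    have n1 : z ∉ TO := fun h => Finset.disjoint_left.1 d3 h hz
    have n2 : z ∉ E := fun h => Finset.disjoint_left.1 d2 hz h
    have n3 : t ∉ E := fun h => Finset.disjoint_left.1 d1 ht h
    have n4 : t' ∉ E := fun h => Finset.disjoint_left.1 d1 ht' h
    have zt' : z ≠ t' := fun e => n1 (e ▸ ht')
    have zt : t ≠ z := fun e => n1 (e ▸ ht)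
    have xz : x ≠ z := fun e => n2 (e ▸ hx)
    have yz : y ≠ z := fun e => n2 (e ▸ hy)
    have xt : x ≠ t := fun e => n3 (e ▸ hx)
    have yt : y ≠ t := fun e => n3 (e ▸ hy)
    have xt' : x ≠ t' := fun e => n4 (e ▸ hx)
    have yt' : y ≠ t' := fun e => n4 (e ▸ hy)
    have p : Pth R y t' {y, x, t, z, t'} := by
      refine Pth.cons hxy ?_ (Pth.cons (bO t ht x hx).2 ?_ (Pth.cons h1 ?_ (Pth.cons (h.Rs _ _ h2) ?_ (Pth.single t'))))
      · simp [xy.symm, yz, yt, yt']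
      · simp [xz, xt, xt']
      · simp [zt, hne]
      · simp [zt']
    have pc : ({y, x, t, z, t'} : Finset V).card = 5 := by
      rw [Finset.card_insert_of_notMem (by simp [xy.symm, yz, yt, yt']),
        Finset.card_insert_of_notMem (by simp [xz, xt, xt']), Finset.card_insert_of_notMem (by simp [zt, hne]),
        Finset.card_insert_of_notMem (by simp [zt'])]; simp
    have pS : ({y, x, t, z, t'} : Finset V) ⊆ S := by
      intro a ha
      simp only [Finset.mem_insert, Finset.mem_singleton] at ha
      rcases ha with rfl | rfl | rfl | rfl | rfl
      exacts [hE hy, hE hx, hTO ht, hTE hz, hTO ht']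
    rcases Nat.lt_or_ge 2 ℓ with hl3 | hl3
    · have cP : ((E.erase x).erase y).card = E.card - 2 := by
        rw [Finset.card_erase_of_mem (by simp [xy.symm, hy]), Finset.card_erase_of_mem hx]; omega
      have cQ : ((TO.erase t).erase t').card = TO.card - 2 := by
        rw [Finset.card_erase_of_mem (by simp [hne.symm, ht']), Finset.card_erase_of_mem ht]; omega
      have sP : ((E.erase x).erase y) ⊆ E := (Finset.erase_subset _ _).trans (Finset.erase_subset _ _)
      have sQ : ((TO.erase t).erase t') ⊆ TO := (Finset.erase_subset _ _).trans (Finset.erase_subset _ _)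
      obtain ⟨e1, he1⟩ := Finset.card_pos.1 (show 0 < ((E.erase x).erase y).card by omega)
      obtain ⟨t1, ht1⟩ := Finset.card_pos.1 (show 0 < ((TO.erase t).erase t').card by omega)
      have := closeOpp (j := ℓ - 2) (m := 2 * ℓ + 1) (bO.symm.mono sP sQ) (d1.symm.mono sP sQ) p (by
        rw [Finset.disjoint_left]; intro a ha
        simp only [Finset.mem_insert, Finset.mem_singleton] at ha
        simp only [Finset.mem_union, Finset.mem_erase]
        have n5 : x ∉ TO := fun h => Finset.disjoint_left.1 d1 h hx
        have n6 : y ∉ TO := fun h => Finset.disjoint_left.1 d1 h hy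
        rcases ha with rfl | rfl | rfl | rfl | rfl <;> tauto)
        he1 ht1 (bO t' ht' e1 (sP he1)).1 (bO t1 (sQ ht1) y hy).1 (by omega) (by omega) (by omega) (by omega)
      exact noR (this.mono (Finset.union_subset pS (Finset.union_subset (sP.trans hE) (sQ.trans hTO))))
    · exact noR ⟨y, t', _, p, (bO t' ht' y hy).1, pS, by omega⟩
  have blue : ∀ t ∈ TO, ∀ z ∈ TE, ¬ R t z → B t z := fun t ht z hz hR =>
    (h.tot t (hTO ht) z (hTE hz) (dp t ht z hz)).resolve_left hR
  -- good vertices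
  let good := TO.filter (fun t => ∃ z ∈ TE, B t z)
  have hg : good ⊆ TO := Finset.filter_subset _ _
  have cg : ℓ + 1 ≤ good.card := by
    have hbad : (TO.filter (fun t => ¬ ∃ z ∈ TE, B t z)).card ≤ 1 := by
      rw [Finset.card_le_one]
      intro t ht t' ht'
      simp only [Finset.mem_filter] at ht ht'
      obtain ⟨z, hz⟩ := Finset.card_pos.1 (show 0 < TE.card by omega)
      by_contra hne
      refine one z hz t ht.1 t' ht'.1 hne ?_ ?_
      · exact (h.tot t (hTO ht.1) z (hTE hz) (dp t ht.1 z hz)).resolve_right (fun hB => ht.2 ⟨z, hz, hB⟩)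
      · exact (h.tot t' (hTO ht'.1) z (hTE hz) (dp t' ht'.1 z hz)).resolve_right (fun hB => ht'.2 ⟨z, hz, hB⟩)
    have := Finset.card_filter_add_card_filter_not (s := TO) (fun t => ∃ z ∈ TE, B t z)
    have e : good = TO.filter (fun t => ∃ z ∈ TE, B t z) := rfl
    rw [← e] at this
    omega
  obtain ⟨t, ht, t', ht', htt⟩ := h.two (hg.trans hTO) cg
  have hne : t ≠ t' := fun e => htt (e ▸ rfl)
  have hbt : B t t' := (h.tot t (hTO (hg ht)) t' (hTO (hg ht')) htt).resolve_left (noRO t (hg ht) t' (hg ht'))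
  obtain ⟨z1, hz1, z2, hz2, hzz, e1, e2⟩ : ∃ z1 ∈ TE, ∃ z2 ∈ TE, z1 ≠ z2 ∧ B t z1 ∧ B t' z2 := by
    obtain ⟨z1, hz1, e1⟩ := (Finset.mem_filter.1 ht).2
    obtain ⟨z2, hz2, e2⟩ := (Finset.mem_filter.1 ht').2
    by_cases e : z1 = z2
    · subst e
      obtain ⟨z, hz, hne'⟩ := Finset.exists_mem_ne (show 1 < TE.card by omega) z1
      by_cases hr : R t z
      · have : B t' z := blue t' (hg ht') z hz (fun hr' => one z hz t (hg ht) t' (hg ht') hne hr hr')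
        exact ⟨z1, hz1, z, hz, hne'.symm, e1, this⟩
      · exact ⟨z, hz, z1, hz1, hne', blue t (hg ht) z hz hr, e2⟩
    · exact ⟨z1, hz1, z2, hz2, e, e1, e2⟩
  have nTE : ∀ t ∈ TO, t ∉ TE ∪ E := by
    intro t ht hc
    rcases Finset.mem_union.1 hc with hc | hc
    · exact Finset.disjoint_left.1 d3 ht hc
    · exact Finset.disjoint_left.1 d1 ht hc
  have := U3 hl bE d2 (nTE t (hg ht)) (nTE t' (hg ht')) hne hbt hz1 hz2 hzz (h.Bs _ _ e1) e2 (by omega) (by omega)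
  refine noB (this.mono ?_)
  exact Finset.insert_subset (hTO (hg ht)) (Finset.insert_subset (hTO (hg ht')) (Finset.union_subset hTE hE))

theorem Multi.Qstep (h : Multi ℓ S part R B) (hl : 2 ≤ ℓ) (hS : 7 * ℓ + 1 ≤ S.card)
    (noR : ¬ HasCyc R S (2 * ℓ + 1)) (noB : ¬ HasCyc B S (2 * ℓ + 1))
    (hC : HasCyc R S (2 * ℓ - 1)) : False := by
  classical
  obtain ⟨v, hv, ha, vS, -⟩ := hC.to_fun
  set N := 2 * ℓ - 1 with hN
  have vper : ∀ i, v (i + N) = v i := fun i => by rw [hv]; simp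
  let C := (Finset.range N).image v
  have vC : ∀ i, v i ∈ C := fun i => by
    have e : v i = v (i % N) := by rw [hv, Nat.mod_mod]
    rw [e]; exact Finset.mem_image_of_mem _ (by simpa using Nat.mod_lt _ (by omega))
  have cC : C.card ≤ N := by simpa using Finset.card_image_le (s := Finset.range N) (f := v)
  have CS : C ⊆ S := by
    intro x hx; obtain ⟨i, _, rfl⟩ := Finset.mem_image.1 hx; exact vS i
  let W := S \ C
  have hWS : W ⊆ S := Finset.sdiff_subset
  have cW : 5 * ℓ + 2 ≤ W.card := by
    have := Finset.card_sdiff_add_card_eq_card CS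
    change W.card + _ = _ at this
    omega
  have wv : ∀ w ∈ W, ∀ i, w ≠ v i := fun w hw i e => (Finset.mem_sdiff.1 hw).2 (e ▸ vC i)
  have bpath : ∀ H ⊆ W, 4 * ℓ + 1 ≤ H.card → ∃ a b F, Pth B a b F ∧ F ⊆ H ∧ F.card = 2 * ℓ := by
    intro H hH hc
    exact h.swap.star (by omega) (hH.trans hWS) hc noB noR
  -- (T)
  have tw : ∀ w ∈ W, ∀ i, part w ≠ part (v i) := by
    intro w hw i e
    have wS := hWS hw
    have key : ∀ w' ∈ W, ¬ R w w' := by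
      intro w' hw' hR
      obtain ⟨p, c⟩ := seg hv ha (i + 1) (i + N) (by omega) (by omega)
      have n1 : ∀ w ∈ W, w ∉ (Finset.Icc (i + 1) (i + N)).image v := by
        intro w hw hc; obtain ⟨j, _, hj⟩ := Finset.mem_image.1 hc; exact wv w hw j hj.symm
      have n2 : w' ∉ insert w ((Finset.Icc (i + 1) (i + N)).image v) := by
        rw [Finset.mem_insert, not_or]
        exact ⟨fun e' => h.Rn w w' hR (e' ▸ rfl), n1 w' hw'⟩
      refine noR ⟨_, _, _, Pth.cons (h.Rs _ _ hR) n2 (Pth.cons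
        (h.Rm (v i) (vS i) w wS (v (i + 1)) (vS _) e.symm (ha i)) (n1 w hw) p), ?_, ?_, ?_⟩
      · rw [vper]; exact h.Rm w wS (v i) (vS i) w' (hWS hw') e hR
      · refine Finset.insert_subset (hWS hw') (Finset.insert_subset wS ?_)
        intro x hx; obtain ⟨j, _, rfl⟩ := Finset.mem_image.1 hx; exact vS j
      · rw [Finset.card_insert_of_notMem n2, Finset.card_insert_of_notMem (n1 w hw), c]; omega
    let H := W.filter (fun y => ¬ part y = part w)
    have cH : 4 * ℓ + 1 ≤ H.card := by
      have h1 := Finset.card_filter_add_card_filter_not (s := W) (fun y => part y = part w)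
      have h2 := (Finset.card_le_card (Finset.filter_subset_filter _ hWS)).trans (h.sz w wS)
      change _ + H.card = _ at h1
      omega
    obtain ⟨a, b, F, p, hF, cF⟩ := bpath H (Finset.filter_subset _ _) cH
    have hb : ∀ y ∈ H, B w y := by
      intro y hy
      have hy' := Finset.mem_filter.1 hy
      exact (h.tot w wS y (hWS hy'.1) (fun e => hy'.2 e.symm)).resolve_left (key y hy'.1)
    have nw : w ∉ F := fun hc => (Finset.mem_filter.1 (hF hc)).2 rfl
    refine noB ⟨_, _, _, Pth.cons (hb a (hF p.head_mem)) nw p, h.Bs _ _ (hb b (hF p.last_mem)), ?_, ?_⟩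
    · exact Finset.insert_subset wS (hF.trans ((Finset.filter_subset _ _).trans hWS))
    · rw [Finset.card_insert_of_notMem nw, cF]
  have tot : ∀ w ∈ W, ∀ i, R w (v i) ∨ B w (v i) := fun w hw i => h.tot w (hWS hw) _ (vS i) (tw w hw i)
  -- ends of a blue path have no common blue neighbour
  have nocom : ∀ a b F, Pth B a b F → F ⊆ W → F.card = 2 * ℓ → ∀ i, B a (v i) → B b (v i) → False := by
    intro a b F p hF cF i h1 h2
    have nw : v i ∉ F := fun hc => wv _ (hF hc) i rfl
    refine noB ⟨_, _, _, Pth.cons (h.Bs _ _ h1) nw p, h2, Finset.insert_subset (vS i) (hF.trans hWS), ?_⟩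
    rw [Finset.card_insert_of_notMem nw, cF]
  have ins2 : ∀ w ∈ W, ∀ w' ∈ W, w ≠ w' → ∀ i j, i % N ≠ j % N → R w (v i) → R w (v (i + 1)) →
      R w' (v j) → R w' (v (j + 1)) → False := by
    have main : ∀ w ∈ W, ∀ w' ∈ W, w ≠ w' → ∀ i j, i < j → j < i + N → R w (v i) → R w (v (i + 1)) →
      R w' (v j) → R w' (v (j + 1)) → False := by
      intro w hw w' hw' hne i j h1 h2 r1 r2 r3 r4
      have := two_ins h.Rs hv ha vS h1 h2 (wv w hw) (wv w' hw') hne (hWS hw) (hWS hw') r1 r2 r3 r4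
      rw [show N + 2 = 2 * ℓ + 1 by omega] at this
      exact noR this
    intro w hw w' hw' hne i j hij r1 r2 r3 r4
    have e : ∀ i, v (i % N) = v i := fun i => by rw [hv, Nat.mod_mod]
    have e' : ∀ i, v (i % N + 1) = v (i + 1) := fun i => by rw [hv, Nat.mod_add_mod]
    have l1 := Nat.mod_lt i (show 0 < N by omega)
    have l2 := Nat.mod_lt j (show 0 < N by omega)
    rw [← e i] at r1; rw [← e' i] at r2; rw [← e j] at r3; rw [← e' j] at r4
    rcases Nat.lt_or_gt_of_ne hij with hlt | hlt
    · exact main w hw w' hw' hne _ _ hlt (by omega) r1 r2 r3 r4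
    · exact main w' hw' w hw hne.symm _ _ hlt (by omega) r3 r4 r1 r2
  by_cases hX : ∃ w0, ∀ w ∈ W, w ≠ w0 → ∀ i, ¬ (R w (v i) ∧ R w (v (i + 1)))
  · obtain ⟨w0, hw0⟩ := hX
    obtain ⟨a, b, F, p, hF, cF⟩ := bpath (W.erase w0) (Finset.erase_subset _ _) (by
      have := Finset.pred_card_le_card_erase (s := W) (a := w0)
      omega)
    have hFW : F ⊆ W := hF.trans (Finset.erase_subset _ _)
    have nc := nocom a b F p hFW cF
    have alt : ∀ x ∈ F, ∀ i, B x (v i) ∨ B x (v (i + 1)) := by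
      intro x hx i
      have h1 := hw0 x (hFW hx) (Finset.ne_of_mem_erase (hF hx)) i
      have h2 := tot x (hFW hx) i
      have h3 := tot x (hFW hx) (i + 1)
      tauto
    refine parity (p := fun i => B a (v i)) (fun i => ?_) (ℓ - 1) ?_
    · have h1 := alt a p.head_mem i
      have h2 := alt b p.last_mem i
      have h3 := nc i
      have h4 := nc (i + 1)
      tauto
    · rw [show 2 * (ℓ - 1) + 1 = 0 + N by omega, vper]
  · push Not at hX
    obtain ⟨w1, hw1, -, i1, r1, r1'⟩ := hX (v 0)
    obtain ⟨w2, hw2, hne, i2, r2, r2'⟩ := hX w1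
    have e12 : i2 % N = i1 % N := by
      by_contra hc
      exact ins2 w2 hw2 w1 hw1 hne _ _ hc r2 r2' r1 r1'
    have all : ∀ w ∈ W, ∀ i, R w (v i) → R w (v (i + 1)) → i % N = i1 % N := by
      intro w hw i h1 h2
      by_contra hc
      by_cases e : w = w1
      · subst e
        exact ins2 w hw w2 hw2 hne.symm i i2 (e12 ▸ hc) h1 h2 r2 r2'
      · exact ins2 w hw w1 hw1 e i i1 hc h1 h2 r1 r1'
    let u : ℕ → V := fun i => v (i1 + 1 + i)
    have noins : ∀ w ∈ W, ∀ i, i < 2 * ℓ - 2 → R w (u i) → R w (u (i + 1)) → False := by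
      intro w hw i hi h1 h2
      have := all w hw _ h1 h2
      exact mod_ne (show i1 < i1 + 1 + i by omega) (by omega) this.symm
    let TO := W.filter (fun w => ∀ i, i ≤ ℓ - 1 → R w (u (2 * i)))
    let TE := W.filter (fun w => ∀ i, i ≤ ℓ - 1 → B w (u (2 * i)))
    have meet : ∀ H ⊆ W, 4 * ℓ + 1 ≤ H.card → (∃ w ∈ H, w ∈ TO) ∧ (∃ w ∈ H, w ∈ TE) := by
      intro H hH hc
      obtain ⟨a, b, F, p, hF, cF⟩ := bpath H hH hc
      have hFW : F ⊆ W := hF.trans hH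
      have nc := nocom a b F p hFW cF
      have alt : ∀ x ∈ F, ∀ i < 2 * ℓ - 2, B x (u i) ∨ B x (u (i + 1)) := by
        intro x hx i hi
        have h1 := noins x (hFW hx) i hi
        have h2 := tot x (hFW hx) (i1 + 1 + i)
        have h3 := tot x (hFW hx) (i1 + 1 + (i + 1))
        by_contra hcon
        rw [not_or] at hcon
        exact h1 (h2.resolve_right hcon.1) (h3.resolve_right hcon.2)
      have step : ∀ x ∈ F, ∀ y ∈ F, (∀ i, B x (v i) → B y (v i) → False) → B x (u 0) →
          ∀ i ≤ ℓ - 1, B x (u (2 * i)) := by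
        intro x hx y hy hn h0 i hi
        induction i with
        | zero => simpa using h0
        | succ i ih =>
          have h1 := ih (by omega)
          have h2 : B y (u (2 * i + 1)) := (alt y hy (2 * i) (by omega)).resolve_left (fun h' => hn _ h1 h')
          exact (alt x hx (2 * i + 1) (by omega)).resolve_left (fun h' => hn _ h' h2)
      have half : ∀ x ∈ F, ∀ y ∈ F, (∀ i, B x (v i) → B y (v i) → False) → B x (u 0) → x ∈ TE ∧ y ∈ TO := by
        intro x hx y hy hn h0
        have h1 := step x hx y hy hn h0
        refine ⟨Finset.mem_filter.2 ⟨hFW hx, h1⟩, Finset.mem_filter.2 ⟨hFW hy, fun i hi => ?_⟩⟩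
        exact (tot y (hFW hy) _).resolve_right (fun h' => hn _ (h1 i hi) h')
      have or : B a (u 0) ∨ B b (u 0) := by
        by_contra hcon
        rw [not_or] at hcon
        have h1 := (alt a p.head_mem 0 (by omega)).resolve_left hcon.1
        have h2 := (alt b p.last_mem 0 (by omega)).resolve_left hcon.2
        exact nc _ h1 h2
      rcases or with h0 | h0
      · obtain ⟨q1, q2⟩ := half a p.head_mem b p.last_mem nc h0
        exact ⟨⟨b, hF p.last_mem, q2⟩, ⟨a, hF p.head_mem, q1⟩⟩
      · obtain ⟨q1, q2⟩ := half b p.last_mem a p.head_mem (fun i h1 h2 => nc i h2 h1) h0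
        exact ⟨⟨a, hF p.head_mem, q2⟩, ⟨b, hF p.last_mem, q1⟩⟩
    have big : ∀ T ⊆ W, (∀ H ⊆ W, 4 * ℓ + 1 ≤ H.card → ∃ w ∈ H, w ∈ T) → ℓ + 2 ≤ T.card := by
      intro T hT hm
      by_contra hc
      obtain ⟨w, hw, hw'⟩ := hm (W \ T) Finset.sdiff_subset (by
        have := Finset.card_sdiff_add_card_eq_card hT
        omega)
      exact (Finset.mem_sdiff.1 hw).2 hw'
    have cO := big TO (Finset.filter_subset _ _) (fun H h1 h2 => (meet H h1 h2).1)
    have cE := big TE (Finset.filter_subset _ _) (fun H h1 h2 => (meet H h1 h2).2)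
    let E := (Finset.range (ℓ - 1 + 1)).image (fun i => u (2 * i))
    have cE0 : E.card = ℓ - 1 + 1 := card_of_fun (fun i => u (2 * i)) (ℓ - 1) (by
      intro i hi j hj hij
      simp only [u] at hij
      rw [hv] at hij
      by_contra hne
      rcases Nat.lt_or_gt_of_ne hne with h' | h'
      · exact mod_ne (show i1 + 1 + 2 * i < i1 + 1 + 2 * j by omega) (by omega) hij
      · exact mod_ne (show i1 + 1 + 2 * j < i1 + 1 + 2 * i by omega) (by omega) hij.symm)
    have mE : ∀ i ≤ ℓ - 1, u (2 * i) ∈ E := fun i hi =>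
      Finset.mem_image.2 ⟨i, by simp; omega, rfl⟩
    have ES : E ⊆ S := by
      intro x hx; obtain ⟨j, _, rfl⟩ := Finset.mem_image.1 hx; exact vS _
    refine h.caseY (v := v) hl noR noB ((Finset.filter_subset _ _).trans hWS : TO ⊆ S)
      ((Finset.filter_subset _ _).trans hWS : TE ⊆ S) ES cO cE (by omega) (mE 0 (by omega)) (mE (ℓ - 1) le_rfl)
      ?_ ?_ ?_
    · have := ha (i1 + 1 + 2 * (ℓ - 1))
      have e : v (i1 + 1 + 2 * (ℓ - 1) + 1) = u (2 * 0) := by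
        simp only [u]
        rw [show i1 + 1 + 2 * (ℓ - 1) + 1 = i1 + 1 + 2 * 0 + N by omega, vper]
      rwa [e] at this
    · intro t ht e he
      obtain ⟨j, hj, rfl⟩ := Finset.mem_image.1 he
      have := (Finset.mem_filter.1 ht).2 j (by simp at hj; omega)
      exact ⟨this, h.Rs _ _ this⟩
    · intro t ht e he
      obtain ⟨j, hj, rfl⟩ := Finset.mem_image.1 he
      have := (Finset.mem_filter.1 ht).2 j (by simp at hj; omega)
      exact ⟨this, h.Bs _ _ this⟩
end Q
end GR

namespace GR
set_option linter.unusedSectionVars false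
section Q
variable {V : Type*} [DecidableEq V]

theorem Multi.base_aux {S : Finset V} {part : V → ℕ} {R B : V → V → Prop} (h : Multi 1 S part R B)
    {v : V} (hv : v ∈ S) {N : Finset V} (hN : N ⊆ S) (hc : 3 ≤ N.card) (hR : ∀ x ∈ N, R v x) :
    HasCyc R S 3 ∨ HasCyc B S 3 := by
  by_cases hex : ∃ x ∈ N, ∃ y ∈ N, R x y
  · left
    obtain ⟨x, hx, y, hy, hxy⟩ := hex
    have nxy : x ≠ y := fun e => h.Rn x y hxy (e ▸ rfl)
    have nvx : v ≠ x := fun e => h.Rn v x (hR x hx) (e ▸ rfl)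
    have nvy : v ≠ y := fun e => h.Rn v y (hR y hy) (e ▸ rfl)
    refine ⟨v, y, {v, x, y}, Pth.cons (hR x hx) (by simp [nvx, nvy]) (Pth.cons hxy (by simpa using nxy) (Pth.single y)),
      h.Rs _ _ (hR y hy), ?_, ?_⟩
    · intro a ha
      simp only [Finset.mem_insert, Finset.mem_singleton] at ha
      rcases ha with rfl | rfl | rfl
      exacts [hv, hN hx, hN hy]
    · rw [Finset.card_insert_of_notMem (by simp [nvx, nvy]), Finset.card_pair nxy]
  · push Not at hex
    right
    refine HasCyc.mono (MP (ℓ := 1) le_rfl N part ?_ ?_ hc) hN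
    · intro x hx y hy hxy
      exact (h.tot x (hN hx) y (hN hy) hxy).resolve_left (hex x hx y hy)
    · intro x hx
      exact (Finset.card_le_card (Finset.filter_subset_filter _ hN)).trans (h.sz x (hN hx))

theorem Multi.Q (ℓ : ℕ) : ∀ {S : Finset V} {part : V → ℕ} {R B : V → V → Prop}, 
    Multi (ℓ + 1) S part R B → 7 * (ℓ + 1) + 1 ≤ S.card →
    HasCyc R S (2 * (ℓ + 1) + 1) ∨ HasCyc B S (2 * (ℓ + 1) + 1) := by
  classical
  induction ℓ with
  | zero =>
    intro S part R B h hc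
    obtain ⟨v, hv⟩ := Finset.card_pos.1 (show 0 < S.card by omega)
    let S' := S.filter (fun y => ¬ part y = part v)
    have hS' : S' ⊆ S := Finset.filter_subset _ _
    have h1 := Finset.card_filter_add_card_filter_not (s := S) (fun y => part y = part v)
    have h2 := h.sz v hv
    change _ + S'.card = _ at h1
    have h3 := Finset.card_filter_add_card_filter_not (s := S') (fun y => R v y)
    by_cases h4 : 3 ≤ (S'.filter (fun y => R v y)).card
    · exact h.base_aux hv ((Finset.filter_subset _ _).trans hS') h4 (fun x hx => (Finset.mem_filter.1 hx).2)
    · refine (h.swap.base_aux hv (N := S'.filter (fun y => ¬ R v y)) ((Finset.filter_subset _ _).trans hS') (by omega) ?_).symm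
      intro x hx
      obtain ⟨hx1, hx2⟩ := Finset.mem_filter.1 hx
      obtain ⟨hx3, hx4⟩ := Finset.mem_filter.1 hx1
      exact (h.tot v hv x hx3 (fun e => hx4 e.symm)).resolve_left hx2
  | succ m ih =>
    intro S part R B h0 hc0
    by_contra hcon
    rw [not_or] at hcon
    obtain ⟨noR, noB⟩ := hcon
    obtain ⟨S1, hS1, hc⟩ := Finset.exists_subset_card_eq hc0
    have h := h0.sub hS1
    have noR1 : ¬ HasCyc R S1 (2 * (m + 1 + 1) + 1) := fun h' => noR (h'.mono hS1)
    have noB1 : ¬ HasCyc B S1 (2 * (m + 1 + 1) + 1) := fun h' => noB (h'.mono hS1)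
    let big := S1.filter (fun x => (S1.filter (fun y => part y = part x)).card = m + 1 + 1)
    have bigS : big ⊆ S1 := Finset.filter_subset _ _
    have ht : (big.image part).card ≤ 7 := by
      have h1 : (m + 1 + 1) * (big.image part).card ≤ big.card := by
        apply Finset.mul_card_image_le_card
        intro b hb
        obtain ⟨x, hx, rfl⟩ := Finset.mem_image.1 hb
        have hx' := Finset.mem_filter.1 hx
        have hx2 := hx'.2
        refine hx2.ge.trans (Finset.card_le_card ?_)
        intro y hy
        have hy' := Finset.mem_filter.1 hy
        refine Finset.mem_filter.2 ⟨Finset.mem_filter.2 ⟨hy'.1, ?_⟩, hy'.2⟩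
        simp only [hy'.2]; exact hx2
      have h2 := Finset.card_le_card bigS
      by_contra hlt
      have : (m + 1 + 1) * 8 ≤ (m + 1 + 1) * (big.image part).card := Nat.mul_le_mul_left _ (by omega)
      omega
    have hrep : ∀ p : ℕ, ∃ x : V, p ∈ big.image part → x ∈ big ∧ part x = p := by
      intro p
      by_cases hp : p ∈ big.image part
      · obtain ⟨x, hx, e⟩ := Finset.mem_image.1 hp
        exact ⟨x, fun _ => ⟨hx, e⟩⟩
      · obtain ⟨x, hx⟩ := Finset.card_pos.1 (show 0 < S1.card by omega)
        exact ⟨x, fun h' => absurd h' hp⟩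
    choose g hg using hrep
    let D := (big.image part).image g
    have cD : D.card ≤ 7 := Finset.card_image_le.trans ht
    let S0 := S1 \ D
    have hS0 : S0 ⊆ S1 := Finset.sdiff_subset
    have cS0 : 7 * (m + 1) + 1 ≤ S0.card := by
      have := Finset.le_card_sdiff D S1
      change _ ≤ S0.card at this
      omega
    have hM : Multi (m + 1) S0 part R B := by
      refine h.mono hS0 (fun x hx => ?_)
      have hxS := hS0 hx
      have h1 := h.sz x hxS
      have hsub : S0.filter (fun y => part y = part x) ⊆ S1.filter (fun y => part y = part x) :=
        Finset.filter_subset_filter _ hS0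
      by_contra hlt
      have heq : (S1.filter (fun y => part y = part x)).card = m + 1 + 1 := by
        have := Finset.card_le_card hsub; omega
      have hxb : x ∈ big := Finset.mem_filter.2 ⟨hxS, heq⟩
      obtain ⟨g1, g2⟩ := hg (part x) (Finset.mem_image_of_mem _ hxb)
      have : (S0.filter (fun y => part y = part x)) ⊂ (S1.filter (fun y => part y = part x)) := by
        refine Finset.ssubset_iff_subset_ne.2 ⟨hsub, fun e => ?_⟩
        have hm : g (part x) ∈ S1.filter (fun y => part y = part x) :=
          Finset.mem_filter.2 ⟨bigS g1, g2⟩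
        rw [← e] at hm
        have := (Finset.mem_sdiff.1 (Finset.mem_filter.1 hm).1).2
        exact this (Finset.mem_image_of_mem _ (Finset.mem_image_of_mem _ hxb))
      have := Finset.card_lt_card this
      omega
    rcases ih hM cS0 with h' | h'
    · exact h.Qstep (by omega) hc.ge noR1 noB1 (h'.mono hS0)
    · exact h.swap.Qstep (by omega) hc.ge noB1 noR1 (h'.mono hS0)
end Q
end GR

namespace GR
set_option linter.unusedSectionVars false
section EG
variable {V : Type*} [DecidableEq V]
open Classical in
/-- degree inside a set -/
noncomputable def dg (G : V → V → Prop) (A : Finset V) (x : V) : ℕ := (A.filter (fun y => G x y)).card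

theorem dg_disj {G : V → V → Prop} {A T : Finset V} (hT : T ⊆ A) (x : V) :
    dg G A x = dg G (A \ T) x + dg G T x := by
  classical
  unfold dg
  rw [← Finset.card_union_of_disjoint]
  · congr 1; ext y; simp only [Finset.mem_filter, Finset.mem_union, Finset.mem_sdiff]
    by_cases h : y ∈ T
    · simp [h, hT h]
    · simp [h]
  · rw [Finset.disjoint_left]; intro y hy hy'
    simp only [Finset.mem_filter, Finset.mem_sdiff] at hy hy'
    exact hy.1.2 hy'.1

theorem dg_double {G : V → V → Prop} (hs : ∀ x y, G x y → G y x) (A T : Finset V) :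
    ∑ x ∈ A, dg G T x = ∑ t ∈ T, dg G A t := by
  classical
  have := Finset.sum_card_bipartiteAbove_eq_sum_card_bipartiteBelow (s := A) (t := T) (fun x y => G x y)
  unfold dg
  simp only [Finset.bipartiteAbove, Finset.bipartiteBelow] at this
  rw [this]
  refine Finset.sum_congr rfl (fun t _ => ?_)
  congr 1; ext x; simp only [Finset.mem_filter]
  exact and_congr_right (fun _ => ⟨hs _ _, hs _ _⟩)

theorem EG {G : V → V → Prop} (hs : ∀ x y, G x y → G y x) (hirr : ∀ x, ¬ G x x) {K : ℕ} (hK : 2 ≤ K) (n : ℕ) :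
    ∀ S : Finset V, S.card = n + 1 → (∀ m, K + 1 ≤ m → ¬ HasCyc G S m) →
    ∑ x ∈ S, dg G S x ≤ K * n := by
  classical
  induction n using Nat.strong_induction_on with
  | _ n ih =>
  intro S hS hno
  -- the longest path
  let Q : ℕ → Prop := fun m => ∃ a b F, Pth G a b F ∧ F ⊆ S ∧ F.card = m
  have hQ1 : Q 1 := by
    obtain ⟨x, hx⟩ := Finset.card_pos.1 (show 0 < S.card by omega)
    exact ⟨x, x, {x}, Pth.single x, by simpa using hx, by simp⟩
  set M := Nat.findGreatest Q S.card with hM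
  have hQM : Q M := Nat.findGreatest_spec (P := Q) (show 1 ≤ S.card by omega) hQ1
  have hmax : ∀ a b F, Pth G a b F → F ⊆ S → F.card ≤ M := fun a b F h1 h2 =>
    Nat.le_findGreatest (Finset.card_le_card h2) ⟨a, b, F, h1, h2, rfl⟩
  let LP : (ℕ → V) → Prop := fun f => (∀ i < M, ∀ j < M, f i = f j → i = j) ∧
    (∀ i, i + 1 < M → G (f i) (f (i + 1))) ∧ (∀ i < M, f i ∈ S)
  have hM1 : 1 ≤ M := by obtain ⟨a, b, F, h1, -, h3⟩ := hQM; rw [← h3]; exact h1.card_pos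
  have hLP : ∃ f, LP f := by
    obtain ⟨a, b, F, h1, h2, h3⟩ := hQM
    obtain ⟨f, f0, fl, fi, fa, fF⟩ := h1.to_fun
    rw [h3] at fi fa fF
    exact ⟨f, fi, fa, fun i hi => h2 (fF ▸ Finset.mem_image_of_mem _ (by simpa using hi))⟩
  have nbr : ∀ g, LP g → ∀ y ∈ S, G (g 0) y → ∃ i, 1 ≤ i ∧ i < M ∧ i < K ∧ y = g i := by
    intro g ⟨g1, g2, g3⟩ y hy hgy
    have p := Pth.of_fun (G := G) g (M - 1) (fun i hi j hj => g1 i (by omega) j (by omega)) (fun i hi => g2 i (by omega))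
    have c := card_of_fun g (M - 1) (fun i hi j hj => g1 i (by omega) j (by omega))
    have hsub : (Finset.range (M - 1 + 1)).image g ⊆ S := by
      intro x hx; obtain ⟨i, hi, rfl⟩ := Finset.mem_image.1 hx; exact g3 i (by simp at hi; omega)
    by_cases hyF : y ∈ (Finset.range (M - 1 + 1)).image g
    · obtain ⟨i, hi, rfl⟩ := Finset.mem_image.1 hyF
      simp only [Finset.mem_range] at hi
      have hi1 : 1 ≤ i := by
        by_contra h; have : i = 0 := by omega
        subst this; exact absurd hgy (hirr _)
      refine ⟨i, hi1, by omega, ?_, rfl⟩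
      by_contra hcon
      refine hno (i + 1) (by omega) (HasCyc.of_fun g i S (fun a ha b hb => g1 a (by omega) b (by omega))
        (fun a ha => g2 a (by omega)) (hs _ _ hgy) (fun a ha => g3 a (by omega)))
    · have := hmax _ _ _ (Pth.cons (hs _ _ hgy) hyF p) (Finset.insert_subset hy hsub)
      rw [Finset.card_insert_of_notMem hyF, c] at this
      omega
  -- head of maximal degree
  obtain ⟨x0, hx0, hx0max⟩ := Finset.exists_max_image (S.filter (fun x => ∃ f, LP f ∧ f 0 = x)) (dg G S) (by
    obtain ⟨f, hf⟩ := hLP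
    exact ⟨f 0, Finset.mem_filter.2 ⟨hf.2.2 0 (by omega), f, hf, rfl⟩⟩)
  obtain ⟨x0S, f, hf, rfl⟩ := Finset.mem_filter.1 hx0
  have degmax : ∀ g, LP g → dg G S (g 0) ≤ dg G S (f 0) := fun g hg =>
    hx0max _ (Finset.mem_filter.2 ⟨hg.2.2 0 (by omega), g, hg, rfl⟩)
  obtain ⟨f1, f2, f3⟩ := hf
  let I := (Finset.range M).filter (fun i => 1 ≤ i ∧ G (f 0) (f i))
  have mI : ∀ i, i ∈ I ↔ i < M ∧ 1 ≤ i ∧ G (f 0) (f i) := fun i => by simp [I]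
  have hτ : dg G S (f 0) = I.card := by
    unfold dg
    rw [← Finset.card_image_of_injOn (s := I) (f := f)]
    · congr 1; ext y
      simp only [Finset.mem_filter, Finset.mem_image, mI]
      constructor
      · rintro ⟨h1, h2⟩
        obtain ⟨i, e1, e2, e3, rfl⟩ := nbr f ⟨f1, f2, f3⟩ y h1 h2
        exact ⟨i, ⟨e2, e1, h2⟩, rfl⟩
      · rintro ⟨i, ⟨h1, h2, h3⟩, rfl⟩
        exact ⟨f3 i h1, h3⟩
    · intro i hi' j hj h
      rw [Finset.mem_coe, mI] at hi' hj
      exact f1 i hi'.1 j hj.1 h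
  let T := I.image (fun i => f (i - 1))
  have cT : T.card = I.card := by
    apply Finset.card_image_of_injOn
    intro i hi' j hj h
    rw [Finset.mem_coe, mI] at hi' hj
    have := f1 (i - 1) (by omega) (j - 1) (by omega) h
    omega
  have TS : T ⊆ S := by
    intro x hx; obtain ⟨i, hi', rfl⟩ := Finset.mem_image.1 hx
    rw [mI] at hi'; exact f3 _ (by omega)
  rcases Nat.eq_zero_or_pos I.card with h0 | h0
  · -- isolated vertex
    rcases Nat.eq_zero_or_pos n with rfl | hn
    · obtain ⟨x, rfl⟩ := Finset.card_eq_one.1 hS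
      simp only [mul_zero, nonpos_iff_eq_zero, Finset.sum_singleton]
      unfold dg
      rw [Finset.card_eq_zero, Finset.filter_eq_empty_iff]
      intro y hy; rw [Finset.mem_singleton] at hy; rw [hy]; exact hirr x
    · have key := ih (n - 1) (by omega) (S.erase (f 0)) (by rw [Finset.card_erase_of_mem x0S]; omega)
        (fun m hm h => hno m hm (h.mono (Finset.erase_subset _ _)))
      have e : ∑ x ∈ S, dg G S x = ∑ x ∈ S.erase (f 0), dg G (S.erase (f 0)) x := by
        rw [← Finset.add_sum_erase _ _ x0S, hτ, h0, zero_add]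
        refine Finset.sum_congr rfl (fun x hx => ?_)
        unfold dg
        congr 1; ext y
        simp only [Finset.mem_filter, Finset.mem_erase]
        constructor
        · rintro ⟨h1, h2⟩
          refine ⟨⟨?_, h1⟩, h2⟩
          rintro rfl
          have : (S.filter (fun y => G (f 0) y)).card = 0 := by
            have := hτ; unfold dg at this; rw [this, h0]
          rw [Finset.card_eq_zero, Finset.filter_eq_empty_iff] at this
          exact this (Finset.mem_of_mem_erase hx) (hs _ _ h2)
        · rintro ⟨⟨_, h1⟩, h2⟩; exact ⟨h1, h2⟩
      rw [e]
      exact key.trans (Nat.mul_le_mul_left _ (by omega))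
  · let Qs := (Finset.range (min K M)).image f
    have cQ : Qs.card ≤ K := Finset.card_image_le.trans (by simp)
    have TQ : T ⊆ Qs := by
      intro x hx; obtain ⟨i, hi', rfl⟩ := Finset.mem_image.1 hx
      rw [mI] at hi'
      obtain ⟨j, e1, e2, e3, e4⟩ := nbr f ⟨f1, f2, f3⟩ (f i) (f3 i hi'.1) hi'.2.2
      have := f1 i hi'.1 j e2 e4
      exact Finset.mem_image_of_mem _ (by simp; omega)
    have tprop : ∀ t ∈ T, dg G S t ≤ I.card ∧ ∀ y ∈ S, G t y → y ∈ Qs := by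
      intro t ht
      obtain ⟨i, hi', rfl⟩ := Finset.mem_image.1 ht
      rw [mI] at hi'
      obtain ⟨h1, h2, h3⟩ := hi'
      have iK : i < K := by
        obtain ⟨j, e1, e2, e3, e4⟩ := nbr f ⟨f1, f2, f3⟩ (f i) (f3 i h1) h3
        have := f1 i h1 j e2 e4
        omega
      let g : ℕ → V := fun j => if j < i then f (i - 1 - j) else f j
      have hg : LP g := by
        refine ⟨?_, ?_, ?_⟩
        · intro a ha b hb hab
          simp only [g] at hab
          split_ifs at hab with c1 c2 c2
          · have := f1 _ (by omega) _ (by omega) hab; omega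
          · have := f1 _ (by omega) _ (by omega) hab; omega
          · have := f1 _ (by omega) _ (by omega) hab; omega
          · exact f1 _ (by omega) _ (by omega) hab
        · intro a ha
          simp only [g]
          split_ifs with c1 c2 c2
          · have := f2 (i - 1 - (a + 1)) (by omega)
            rw [show i - 1 - (a + 1) + 1 = i - 1 - a by omega] at this
            exact hs _ _ this
          · have e1 : i - 1 - a = 0 := by omega
            have e2 : a + 1 = i := by omega
            rw [e1, e2]; exact h3
          · omega
          · exact f2 a ha
        · intro a ha
          simp only [g]; split_ifs
          · exact f3 _ (by omega)
          · exact f3 _ ha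
      have g0 : g 0 = f (i - 1) := by simp only [g]; rw [if_pos (by omega)]; rfl
      refine ⟨?_, ?_⟩
      · rw [← hτ]; have := degmax g hg; rwa [g0] at this
      · intro y hy hty
        obtain ⟨j, e1, e2, e3, rfl⟩ := nbr g hg y hy (by rw [g0]; exact hty)
        simp only [g]
        split_ifs
        · exact Finset.mem_image_of_mem _ (by simp; omega)
        · exact Finset.mem_image_of_mem _ (by simp; omega)
    have hTle : T.card ≤ n := by
      -- last vertex not in T
      have hl : f (M - 1) ∉ T := by
        intro hc
        obtain ⟨i, hi', h⟩ := Finset.mem_image.1 hc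
        rw [mI] at hi'
        have := f1 _ (by omega) _ (by omega) h
        omega
      have : T ⊂ S := Finset.ssubset_iff_subset_ne.2 ⟨TS, fun e => hl (e ▸ f3 _ (by omega))⟩
      have := Finset.card_lt_card this
      omega
    have cST : (S \ T).card = n - T.card + 1 := by
      have := Finset.card_sdiff_add_card_eq_card TS
      omega
    have key := ih (n - T.card) (by omega) (S \ T) cST (fun m hm h => hno m hm (h.mono Finset.sdiff_subset))
    have e1 : ∑ x ∈ S, dg G S x = ∑ x ∈ S \ T, dg G S x + ∑ t ∈ T, dg G S t :=
      (Finset.sum_sdiff TS).symm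
    have e2 : ∑ x ∈ S \ T, dg G S x = ∑ x ∈ S \ T, dg G (S \ T) x + ∑ t ∈ T, dg G (S \ T) t := by
      rw [← dg_double hs (S \ T) T, ← Finset.sum_add_distrib]
      exact Finset.sum_congr rfl (fun x _ => dg_disj TS x)
    have e3 : ∑ t ∈ T, (dg G (S \ T) t + dg G S t) ≤ T.card * K := by
      rw [← smul_eq_mul]
      apply Finset.sum_le_card_nsmul
      intro t ht
      obtain ⟨t1, t2⟩ := tprop t ht
      have : dg G (S \ T) t ≤ (Qs \ T).card := by
        apply Finset.card_le_card
        intro y hy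
        simp only [Finset.mem_filter, Finset.mem_sdiff] at hy ⊢
        exact ⟨t2 y hy.1.1 hy.2, hy.1.2⟩
      have := Finset.card_sdiff_add_card_eq_card TQ
      omega
    rw [Finset.sum_add_distrib] at e3
    have e4 : K * (n - T.card) + T.card * K = K * n := by
      rw [mul_comm T.card K, ← mul_add]; congr 1; omega
    omega
end EG
end GR

namespace GR
set_option linter.unusedSectionVars false
section T2
variable {V : Type*} [DecidableEq V]

theorem cliquePth {G : V → V → Prop} (p : ℕ) : ∀ {K : Finset V} {a b : V},
    (∀ x ∈ K, ∀ y ∈ K, x ≠ y → G x y) → a ∈ K → b ∈ K → a ≠ b → p + 2 ≤ K.card →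
    ∃ F, F ⊆ K ∧ Pth G a b F ∧ F.card = p + 2 := by
  induction p with
  | zero =>
    intro K a b hK ha hb hab _
    refine ⟨{a, b}, ?_, Pth.cons (hK a ha b hb hab) (by simpa using hab) (Pth.single b), Finset.card_pair hab⟩
    intro x hx
    simp only [Finset.mem_insert, Finset.mem_singleton] at hx
    rcases hx with rfl | rfl <;> assumption
  | succ p ih =>
    intro K a b hK ha hb hab hc
    have c1 := Finset.card_erase_of_mem ha
    have hb1 : b ∈ K.erase a := Finset.mem_erase.2 ⟨hab.symm, hb⟩
    have c2 := Finset.card_erase_of_mem hb1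
    obtain ⟨c, hc'⟩ := Finset.card_pos.1 (show 0 < ((K.erase a).erase b).card by omega)
    rw [Finset.mem_erase, Finset.mem_erase] at hc'
    obtain ⟨F, h1, h2, h3⟩ := ih (K := K.erase a) (a := c) (b := b)
      (fun x hx y hy => hK x (Finset.mem_of_mem_erase hx) y (Finset.mem_of_mem_erase hy))
      (Finset.mem_erase.2 hc'.2) hb1 hc'.1 (by omega)
    have ha' : a ∉ F := fun h => by simpa using h1 h
    refine ⟨insert a F, ?_, Pth.cons (hK a ha c hc'.2.2 hc'.2.1.symm) ha' h2, by
      rw [Finset.card_insert_of_notMem ha']; omega⟩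
    intro x hx
    rw [Finset.mem_insert] at hx
    rcases hx with rfl | hx
    · exact ha
    · exact Finset.mem_of_mem_erase (h1 hx)

variable {ℓ : ℕ} {M : Finset V} {part : V → ℕ} {R B : V → V → Prop}

/-- two disjoint cross edges between two cliques -/
theorem twoCross {E O : Finset V} (hl : 2 ≤ ℓ) (hd : Disjoint E O) (hEM : E ⊆ M) (hOM : O ⊆ M)
    (cE : E.card = ℓ + 1) (cO : O.card = ℓ + 1) (kE : ∀ x ∈ E, ∀ y ∈ E, x ≠ y → B x y)
    (kO : ∀ x ∈ O, ∀ y ∈ O, x ≠ y → B x y) (noB : ¬ HasCyc B M (2 * ℓ + 1))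
    {e1 e2 o1 o2 : V} (he1 : e1 ∈ E) (he2 : e2 ∈ E) (ho1 : o1 ∈ O) (ho2 : o2 ∈ O) (ne : e1 ≠ e2)
    (no : o1 ≠ o2) (b1 : B e1 o1) (b2 : B o2 e2) : False := by
  obtain ⟨F, f1, f2, f3⟩ := cliquePth (G := B) (ℓ - 1) kE he2 he1 ne.symm (by omega)
  obtain ⟨F', g1, g2, g3⟩ := cliquePth (G := B) (ℓ - 2) kO ho1 ho2 no (by omega)
  have hd' : Disjoint F F' := hd.mono f1 g1
  exact noB ⟨_, _, _, f2.append b1 g2 hd', b2, Finset.union_subset (f1.trans hEM) (g1.trans hOM), by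
    rw [Finset.card_union_of_disjoint hd']; omega⟩

theorem starF (h : Multi ℓ M part R B) (hp : ∀ x ∈ M, ∀ y ∈ M, part x = part y → x = y) (hl : 3 ≤ ℓ)
    (hM : 4 * ℓ + 1 ≤ M.card) (noR : ¬ HasCyc R M (2 * ℓ + 1)) (noB : ¬ HasCyc B M (2 * ℓ + 1))
    {E O : Finset V} (hd : Disjoint E O) (hEM : E ⊆ M) (hOM : O ⊆ M)
    (cE : E.card = ℓ + 1) (cO : O.card = ℓ + 1) (kE : ∀ x ∈ E, ∀ y ∈ E, x ≠ y → B x y)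
    (kO : ∀ x ∈ O, ∀ y ∈ O, x ≠ y → B x y) {s o o1 : V} (hs : s ∈ E) (ho : o ∈ O) (ho1 : o1 ∈ O)
    (hne : o1 ≠ o) (bso : B s o) (rso : R s o1) (hred : ∀ x ∈ E, x ≠ s → ∀ y ∈ O, R x y) : False := by
  have tot : ∀ x ∈ M, ∀ y ∈ M, x ≠ y → R x y ∨ B x y := fun x hx y hy n =>
    h.tot x hx y hy (fun e => n (hp x hx y hy e))
  have cEs := Finset.card_erase_of_mem hs
  have cOo := Finset.card_erase_of_mem ho
  have bicR : Bic R (E.erase s) O := fun x hx y hy => by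
    have := hred x (Finset.mem_of_mem_erase hx) (Finset.ne_of_mem_erase hx) y hy
    exact ⟨this, h.Rs _ _ this⟩
  have dEO : Disjoint (E.erase s) O := hd.mono_left (Finset.erase_subset _ _)
  set W := M \ (E ∪ O) with hW
  have cW : 2 * ℓ - 1 ≤ W.card := by
    have h1 := Finset.card_sdiff_add_card_eq_card (Finset.union_subset hEM hOM)
    rw [Finset.card_union_of_disjoint hd] at h1
    have h2 : (M \ (E ∪ O)).card = W.card := by rw [hW]
    omega
  have WM : ∀ w ∈ W, w ∈ M ∧ w ∉ E ∧ w ∉ O := fun w hw => by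
    rw [hW, Finset.mem_sdiff, Finset.mem_union, not_or] at hw; exact hw
  have key : ∀ w ∈ W, (∀ x ∈ E.erase s, B w x) ∨ (∀ y ∈ O, B w y) := by
    intro w hw
    obtain ⟨w1, w2, w3⟩ := WM w hw
    by_contra hcon
    push Not at hcon
    obtain ⟨⟨x, hx, nx⟩, ⟨y, hy, ny⟩⟩ := hcon
    have hxE := Finset.mem_of_mem_erase hx
    have r1 : R w x := (tot w w1 x (hEM hxE) (fun e => w2 (e ▸ hxE))).resolve_right nx
    have r2 : R w y := (tot w w1 y (hOM hy) (fun e => w3 (e ▸ hy))).resolve_right ny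
    refine noR ((U2 (v := w) (ℓ := ℓ) (by omega) bicR dEO (by
      rw [Finset.mem_union, not_or]; exact ⟨fun h => w2 (Finset.mem_of_mem_erase h), w3⟩) hx hy r1 (h.Rs _ _ r2)
      (by omega) (by omega)).mono ?_)
    refine Finset.insert_subset w1 (Finset.union_subset ((Finset.erase_subset _ _).trans hEM) hOM)
  classical
  set WO := W.filter (fun w => ∀ y ∈ O, B w y) with hWO
  have cWO : WO.card < ℓ := by
    by_contra hcon
    push Not at hcon
    have hb : Bic B O WO := fun p hp q hq => by
      have := (Finset.mem_filter.1 hq).2 p hp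
      exact ⟨h.Bs _ _ this, this⟩
    refine noB ((U1 (ℓ := ℓ) (by omega) hb ?_ ho ho1 hne.symm (kO _ ho1 _ ho hne) (by omega) hcon).mono ?_)
    · rw [Finset.disjoint_right]; intro x hx; exact (WM x (Finset.mem_filter.1 hx).1).2.2
    · exact Finset.union_subset hOM (fun x hx => (WM x (Finset.mem_filter.1 hx).1).1)
  set WE := W.filter (fun w => ¬ ∀ y ∈ O, B w y) with hWE
  have cWE : ℓ ≤ WE.card := by
    have hsub : W ⊆ WO ∪ WE := fun w hw => by
      rw [Finset.mem_union, hWO, hWE, Finset.mem_filter, Finset.mem_filter]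
      by_cases hh : ∀ y ∈ O, B w y
      · exact Or.inl ⟨hw, hh⟩
      · exact Or.inr ⟨hw, hh⟩
    have h1 := Finset.card_le_card hsub
    have h2 := Finset.card_union_le WO WE
    omega
  have WEW : ∀ w ∈ WE, w ∈ M ∧ w ∉ E ∧ w ∉ O := fun w hw => WM w (Finset.mem_filter.1 hw).1
  have WEb : ∀ w ∈ WE, ∀ x ∈ E.erase s, B w x := fun w hw =>
    (key w (Finset.mem_filter.1 hw).1).resolve_right (Finset.mem_filter.1 hw).2
  obtain ⟨e, he⟩ := Finset.card_pos.1 (show 0 < (E.erase s).card by omega)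
  have heE := Finset.mem_of_mem_erase he
  have hes := Finset.ne_of_mem_erase he
  have WEs : ∀ w ∈ WE, R s w := by
    intro w hw
    obtain ⟨w1, w2, w3⟩ := WEW w hw
    refine (tot s (hEM hs) w w1 (fun e => w2 (e ▸ hs))).resolve_right (fun hb => ?_)
    have hbic : Bic B WE (E.erase s) := fun p hp q hq => ⟨WEb p hp q hq, h.Bs _ _ (WEb p hp q hq)⟩
    refine noB ((U2 (v := s) (ℓ := ℓ) (by omega) hbic ?_ ?_ hw he hb (kE e heE s hs hes) cWE (by omega)).mono ?_)
    · rw [Finset.disjoint_left]; intro x hx hx'; exact (WEW x hx).2.1 (Finset.mem_of_mem_erase hx')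
    · rw [Finset.mem_union, not_or]; exact ⟨fun hh => (WEW s hh).2.1 hs, by simp⟩
    · exact Finset.insert_subset (hEM hs) (Finset.union_subset (fun x hx => (WEW x hx).1)
        ((Finset.erase_subset _ _).trans hEM))
  have hbic2 : Bic R WE (O.erase o) := by
    intro w hw q hq
    obtain ⟨w1, w2, w3⟩ := WEW w hw
    have hqO := Finset.mem_of_mem_erase hq
    have hqo := Finset.ne_of_mem_erase hq
    suffices R w q from ⟨this, h.Rs _ _ this⟩
    refine (tot w w1 q (hOM hqO) (fun e => w3 (e ▸ hqO))).resolve_right (fun hb => ?_)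
    obtain ⟨F, f1, f2, f3⟩ := cliquePth (G := B) (ℓ - 1) kE hs heE hes.symm (by omega)
    obtain ⟨F', g1, g2, g3⟩ := cliquePth (G := B) (ℓ - 3) kO hqO ho hqo (by omega)
    have d1 : Disjoint F F' := hd.mono f1 g1
    have wF' : w ∉ F' := fun hh => w3 (g1 hh)
    have d2 : Disjoint F (insert w F') := by
      rw [Finset.disjoint_insert_right]; exact ⟨fun hh => w2 (f1 hh), d1⟩
    refine noB ⟨_, _, _, f2.append (h.Bs _ _ (WEb w hw e he)) (Pth.cons hb wF' g2) d2, h.Bs _ _ bso, ?_, ?_⟩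
    · exact Finset.union_subset (f1.trans hEM) (Finset.insert_subset w1 (g1.trans hOM))
    · rw [Finset.card_union_of_disjoint d2, Finset.card_insert_of_notMem wF']; omega
  obtain ⟨w, hw⟩ := Finset.card_pos.1 (show 0 < WE.card by omega)
  refine noR ((U2 (v := s) (ℓ := ℓ) (by omega) hbic2 ?_ ?_ hw (Finset.mem_erase.2 ⟨hne, ho1⟩) (WEs w hw) (h.Rs _ _ rso)
    cWE (by omega)).mono ?_)
  · rw [Finset.disjoint_left]; intro x hx hx'; exact (WEW x hx).2.2 (Finset.mem_of_mem_erase hx')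
  · rw [Finset.mem_union, not_or]
    exact ⟨fun hh => (WEW s hh).2.1 hs, fun hh => Finset.disjoint_left.1 hd hs (Finset.mem_of_mem_erase hh)⟩
  · exact Finset.insert_subset (hEM hs) (Finset.union_subset (fun x hx => (WEW x hx).1)
        ((Finset.erase_subset _ _).trans hOM))

theorem finF (h : Multi ℓ M part R B) (hp : ∀ x ∈ M, ∀ y ∈ M, part x = part y → x = y) (hl : 3 ≤ ℓ)
    (hM : 4 * ℓ + 1 ≤ M.card) (noR : ¬ HasCyc R M (2 * ℓ + 1)) (noB : ¬ HasCyc B M (2 * ℓ + 1))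
    {E O : Finset V} (hd : Disjoint E O) (hEM : E ⊆ M) (hOM : O ⊆ M)
    (cE : E.card = ℓ + 1) (cO : O.card = ℓ + 1) (kE : ∀ x ∈ E, ∀ y ∈ E, x ≠ y → B x y)
    (kO : ∀ x ∈ O, ∀ y ∈ O, x ≠ y → B x y) (hE : ∀ s ∈ E, ∀ o, ∃ o1 ∈ O, o1 ≠ o ∧ R s o1)
    (hO : ∀ s ∈ O, ∀ o, ∃ o1 ∈ E, o1 ≠ o ∧ R s o1) : False := by
  have tot : ∀ x ∈ E, ∀ y ∈ O, R x y ∨ B x y := fun x hx y hy =>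
    h.tot x (hEM hx) y (hOM hy) (fun e => Finset.disjoint_left.1 hd hx (hp x (hEM hx) y (hOM hy) e ▸ hy))
  have TC : ∀ e1 ∈ E, ∀ o1 ∈ O, ∀ e2 ∈ E, ∀ o2 ∈ O, B e1 o1 → B e2 o2 → e1 = e2 ∨ o1 = o2 := by
    intro e1 he1 o1 ho1 e2 he2 o2 ho2 b1 b2
    by_contra hcon
    push Not at hcon
    exact twoCross (by omega) hd hEM hOM cE cO kE kO noB he1 he2 ho1 ho2 hcon.1 hcon.2 b1 (h.Bs _ _ b2)
  by_cases hex : ∃ s ∈ E, ∃ o ∈ O, B s o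
  · obtain ⟨s, hs, o, ho, bso⟩ := hex
    by_cases hst : ∀ x ∈ E, x ≠ s → ∀ y ∈ O, R x y
    · obtain ⟨o1, ho1, hne, r⟩ := hE s hs o
      exact starF h hp hl hM noR noB hd hEM hOM cE cO kE kO hs ho ho1 hne bso r hst
    · push Not at hst
      obtain ⟨e, he, hes, y, hy, nr⟩ := hst
      have be := (tot e he y hy).resolve_left nr
      have hyo := (TC e he y hy s hs o ho be bso).resolve_left hes
      subst hyo
      obtain ⟨s1, hs1, hne, r⟩ := hO y hy s
      refine starF h hp hl hM noR noB hd.symm hOM hEM cO cE kO kE hy hs hs1 hne (h.Bs _ _ bso) r ?_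
      intro o' ho' hne' e' he'
      refine h.Rs _ _ ((tot e' he' o' ho').resolve_right (fun bb => ?_))
      have h1 := (TC e' he' o' ho' s hs y hy bb bso).resolve_right hne'
      have h2 := (TC e' he' o' ho' e he y hy bb be).resolve_right hne'
      exact hes (h2.symm.trans h1)
  · push Not at hex
    have hb : Bic R E O := fun x hx y hy => by
      have := (tot x hx y hy).resolve_right (hex x hx y hy)
      exact ⟨this, h.Rs _ _ this⟩
    have := h.swap.BL (by omega) (X := ∅) hEM hOM (by simp) (by intro x hx; simp at hx) (by simp) hb
      (by omega) (by omega) (by simpa using noB) noR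
    simp at this
    omega
end T2
end GR

namespace GR
set_option linter.unusedSectionVars false
section T3
variable {V : Type*} [DecidableEq V]

theorem mod_cases {N x y : ℕ} (h : x % N = y % N) (h1 : x < y + 2 * N) (h2 : y < x + 2 * N) :
    x = y ∨ x = y + N ∨ y = x + N := by
  by_contra hcon
  push Not at hcon
  obtain ⟨c1, c2, c3⟩ := hcon
  by_cases a1 : x < y
  · by_cases a2 : y < x + N
    · exact mod_ne a1 a2 h
    · exact mod_ne (N := N) (x := x + N) (y := y) (by omega) (by omega) (by simpa using h)
  · by_cases a2 : x < y + N
    · exact mod_ne (N := N) (x := y) (y := x) (by omega) (by omega) h.symm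
    · exact mod_ne (N := N) (x := y + N) (y := x) (by omega) (by omega) (by simpa using h.symm)

theorem chord {G : V → V → Prop} {M : Finset V} {N : ℕ} {v : ℕ → V}
    (hv : ∀ i j, v i = v j ↔ i % N = j % N) (ha : ∀ i, G (v i) (v (i + 1))) (hM : ∀ i, v i ∈ M) {i d : ℕ}
    (hd : 2 ≤ d) (hd' : d < N) (e : G (v i) (v (i + d))) : HasCyc G M (N - d + 1) := by
  obtain ⟨p, c⟩ := seg hv ha (i + d) (i + N) (by omega) (by omega)
  have e' : v (i + N) = v i := by rw [hv]; simp
  refine ⟨_, _, _, p, by rw [e']; exact e, ?_, by rw [c]; omega⟩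
  intro x hx
  obtain ⟨i, _, rfl⟩ := Finset.mem_image.1 hx
  exact hM i

theorem jumpEven {G : V → V → Prop} {M : Finset V} {m : ℕ} {v : ℕ → V} (hm : 2 ≤ m)
    (hv : ∀ i j, v i = v j ↔ i % (2 * m) = j % (2 * m)) (hM : ∀ i, v i ∈ M)
    (j2 : ∀ i, G (v i) (v (i + 2))) (j3 : ∀ i, G (v i) (v (i + 3))) : HasCyc G M (2 * m - 1) := by
  let idx : ℕ → ℕ := fun i => if i ≤ m - 2 then 2 * i + 2 else 2 * i + 3
  have hidx : ∀ i, (i ≤ m - 2 ∧ idx i = 2 * i + 2) ∨ (m - 2 < i ∧ idx i = 2 * i + 3) := by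
    intro i
    by_cases h : i ≤ m - 2
    · left; exact ⟨h, by simp [idx, h]⟩
    · right; exact ⟨by omega, by simp [idx, h]⟩
  have := HasCyc.of_fun (G := G) (fun i => v (idx i)) (2 * m - 2) M ?_ ?_ ?_ (fun i _ => hM _)
  · rwa [show 2 * m - 2 + 1 = 2 * m - 1 by omega] at this
  · intro i hi j hj h
    rw [hv] at h
    have h1 := hidx i
    have h2 := hidx j
    have := mod_cases h (by omega) (by omega)
    omega
  · intro i hi
    have h1 := hidx i
    have h2 := hidx (i + 1)
    have : idx (i + 1) = idx i + 2 ∨ idx (i + 1) = idx i + 3 := by omega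
    rcases this with e | e
    · show G (v (idx i)) (v (idx (i + 1))); rw [e]; exact j2 _
    · show G (v (idx i)) (v (idx (i + 1))); rw [e]; exact j3 _
  · have h1 := hidx 0
    have h2 := hidx (2 * m - 2)
    have e : v (idx 0) = v (idx (2 * m - 2) + 3) := by
      rw [hv, show idx (2 * m - 2) + 3 = idx 0 + 2 * m * 2 by omega]; simp
    show G (v (idx (2 * m - 2))) (v (idx 0))
    rw [e]; exact j3 _

theorem jumpOdd {G : V → V → Prop} {M : Finset V} {m : ℕ} {v : ℕ → V} (hm : 3 ≤ m)
    (hv : ∀ i j, v i = v j ↔ i % (2 * m + 1) = j % (2 * m + 1)) (hM : ∀ i, v i ∈ M)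
    (j2 : ∀ i, G (v i) (v (i + 2))) (j3 : ∀ i, G (v i) (v (i + 3))) : HasCyc G M (2 * m - 1) := by
  let idx : ℕ → ℕ := fun i => if i = 0 then 1 else if i < m then 2 * i + 2 else if i = m then 2 * m + 3 else 2 * i + 4
  have hidx : ∀ i, (i = 0 ∧ idx i = 1) ∨ (0 < i ∧ i < m ∧ idx i = 2 * i + 2) ∨ (i = m ∧ idx i = 2 * m + 3) ∨
      (m < i ∧ idx i = 2 * i + 4) := by
    intro i
    simp only [idx]
    split_ifs <;> omega
  have := HasCyc.of_fun (G := G) (fun i => v (idx i)) (2 * m - 2) M ?_ ?_ ?_ (fun i _ => hM _)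
  · rwa [show 2 * m - 2 + 1 = 2 * m - 1 by omega] at this
  · intro i hi j hj h
    rw [hv] at h
    have h1 := hidx i
    have h2 := hidx j
    have := mod_cases h (by omega) (by omega)
    omega
  · intro i hi
    have h1 := hidx i
    have h2 := hidx (i + 1)
    have : idx (i + 1) = idx i + 2 ∨ idx (i + 1) = idx i + 3 := by omega
    rcases this with e | e
    · show G (v (idx i)) (v (idx (i + 1))); rw [e]; exact j2 _
    · show G (v (idx i)) (v (idx (i + 1))); rw [e]; exact j3 _
  · have h1 := hidx 0
    have h2 := hidx (2 * m - 2)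
    have e : v (idx 0) = v (idx (2 * m - 2) + 3) := by
      rw [hv, show idx (2 * m - 2) + 3 = idx 0 + (2 * m + 1) * 2 by omega]; simp
    show G (v (idx (2 * m - 2))) (v (idx 0))
    rw [e]; exact j3 _

theorem claimA {G : V → V → Prop} (hs : ∀ x y, G x y → G y x) {M : Finset V} {N : ℕ} {v : ℕ → V}
    (hv : ∀ i j, v i = v j ↔ i % N = j % N) (ha : ∀ i, G (v i) (v (i + 1))) (hM : ∀ i, v i ∈ M) {a J : ℕ}
    (hJ : 1 ≤ J) (hJ' : J + 3 ≤ N) (e1 : G (v a) (v (a + J))) (e2 : G (v (a + 1)) (v (a + J + 2))) :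
    HasCyc G M (N - 1) := by
  obtain ⟨p1, c1⟩ := seg hv ha (a + 1) (a + J) (by omega) (by omega)
  obtain ⟨p2, c2⟩ := seg hv ha (a + J + 2) (a + N) (by omega) (by omega)
  have hd := seg_disj hv (a := a + 1) (b := a + J) (c := a + J + 2) (d := a + N) (by omega) (by omega)
  have e' : v (a + N) = v a := by rw [hv]; simp
  refine ⟨_, _, _, (p1.rev hs).append e2 p2 hd, by rw [e']; exact e1, ?_, ?_⟩
  · intro x hx
    simp only [Finset.mem_union, Finset.mem_image] at hx
    rcases hx with ⟨i, _, rfl⟩ | ⟨i, _, rfl⟩ <;> exact hM i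
  · rw [Finset.card_union_of_disjoint hd, c1, c2]; omega

theorem par2 {m x y : ℕ} (h : x % (2 * m) = y % (2 * m)) : x % 2 = y % 2 := by
  rw [← Nat.mod_mul_right_mod x 2 m, h, Nat.mod_mul_right_mod]

theorem jump2path {G : V → V → Prop} {m : ℕ} {v : ℕ → V}
    (hv : ∀ i j, v i = v j ↔ i % (2 * m) = j % (2 * m))
    (j2 : ∀ i, G (v i) (v (i + 2))) (c r : ℕ) (hr : r < m) :
    ∃ F, Pth G (v c) (v (c + 2 * r)) F ∧ F.card = r + 1 ∧ ∀ x ∈ F, ∃ i, x = v (c + 2 * i) := by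
  have inj : ∀ i ≤ r, ∀ j ≤ r, (fun i => v (c + 2 * i)) i = (fun i => v (c + 2 * i)) j → i = j := by
    intro i hi j hj h
    have h := (hv _ _).1 h
    have := mod_cases h (by omega) (by omega)
    omega
  refine ⟨_, Pth.of_fun (G := G) (fun i => v (c + 2 * i)) r inj ?_, card_of_fun _ _ inj, ?_⟩
  · intro i _; exact j2 (c + 2 * i)
  · intro x hx
    obtain ⟨i, _, rfl⟩ := Finset.mem_image.1 hx
    exact ⟨i, rfl⟩

theorem evenChord {G : V → V → Prop} (hs : ∀ x y, G x y → G y x) {M : Finset V} {m : ℕ} {v : ℕ → V}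
    (hv : ∀ i j, v i = v j ↔ i % (2 * m) = j % (2 * m)) (hM : ∀ i, v i ∈ M)
    (j2 : ∀ i, G (v i) (v (i + 2))) {a j : ℕ} (hj : 2 ≤ j) (hj' : j + 2 ≤ m)
    (b1 : G (v (a + 2)) (v (a + 2 * j + 3))) (b2 : G (v a) (v (a + 2 * j - 1))) : HasCyc G M (2 * m - 1) := by
  obtain ⟨F, f1, f2, f3⟩ := jump2path hv j2 (a + 2 * j + 3) (m - 2) (by omega)
  obtain ⟨F', g1, g2, g3⟩ := jump2path hv j2 (a + 2) (m - 1) (by omega)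
  have e1 : v (a + 2 * j + 3 + 2 * (m - 2)) = v (a + 2 * j - 1) := by
    rw [hv, show a + 2 * j + 3 + 2 * (m - 2) = a + 2 * j - 1 + 2 * m by omega]; simp
  have e2 : v (a + 2 + 2 * (m - 1)) = v a := by
    rw [hv, show a + 2 + 2 * (m - 1) = a + 2 * m by omega]; simp
  rw [e1] at f1
  rw [e2] at g1
  have hd : Disjoint F F' := by
    rw [Finset.disjoint_left]
    intro x hx hx'
    obtain ⟨i, rfl⟩ := f3 x hx
    obtain ⟨i', h⟩ := g3 _ hx'
    have := par2 ((hv _ _).1 h)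
    omega
  refine ⟨_, _, _, f1.append (hs _ _ b2) (g1.rev hs) hd, b1, ?_, ?_⟩
  · intro x hx
    rw [Finset.mem_union] at hx
    rcases hx with hx | hx
    · obtain ⟨i, rfl⟩ := f3 x hx; exact hM _
    · obtain ⟨i, rfl⟩ := g3 x hx; exact hM _
  · rw [Finset.card_union_of_disjoint hd]; omega

variable {ℓ : ℕ} {M : Finset V} {part : V → ℕ} {R B : V → V → Prop}

theorem T2main (h : Multi ℓ M part R B) (hp : ∀ x ∈ M, ∀ y ∈ M, part x = part y → x = y) (hl : 3 ≤ ℓ)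
    (hM : 4 * ℓ + 1 ≤ M.card) {L : ℕ} (hL : 2 * ℓ + 1 ≤ L) (hc : HasCyc R M L)
    (noR : ¬ HasCyc R M (2 * ℓ + 1)) (noB : ¬ HasCyc B M (2 * ℓ + 1))
    (hmin : ∀ m, 2 * ℓ + 1 ≤ m → m < L → ¬ HasCyc R M m ∧ ¬ HasCyc B M m) : False := by
  obtain ⟨v, hv, ha, hvM, -⟩ := hc.to_fun
  have tot : ∀ i j, i % L ≠ j % L → ¬ R (v i) (v j) → B (v i) (v j) := fun i j n nr =>
    (h.tot _ (hvM i) _ (hvM j) (fun e => n ((hv i j).1 (hp _ (hvM i) _ (hvM j) e)))).resolve_left nr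
  have hne : L ≠ 2 * ℓ + 1 := fun e => noR (e ▸ hc)
  have j2 : ∀ i, B (v i) (v (i + 2)) := fun i => by
    refine tot i (i + 2) (mod_ne (by omega) (by omega)) (fun r => ?_)
    exact (hmin _ (by omega) (by omega)).1 (chord hv ha hvM (le_refl 2) (by omega) r)
  by_cases hL3 : 2 * ℓ + 3 ≤ L
  · have j3 : ∀ i, B (v i) (v (i + 3)) := fun i => by
      refine tot i (i + 3) (mod_ne (by omega) (by omega)) (fun r => ?_)
      exact (hmin _ (by omega) (by omega)).1 (chord hv ha hvM (by omega) (by omega) r)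
    rcases Nat.even_or_odd' L with ⟨m, e | e⟩
    · subst e
      exact (hmin _ (by omega) (by omega)).2 (jumpEven (by omega) hv hvM j2 j3)
    · subst e
      exact (hmin _ (by omega) (by omega)).2 (jumpOdd (by omega) hv hvM j2 j3)
  · obtain rfl : L = 2 * (ℓ + 1) := by omega
    have per : ∀ i, v (i + 2 * (ℓ + 1)) = v i := fun i => by rw [hv]; simp
    have hcl : ∀ c j, 2 ≤ j → j + 2 ≤ ℓ + 1 → B (v c) (v (c + 2 * j)) := by
      intro c j h1 h2
      refine tot _ _ (mod_ne (by omega) (by omega)) (fun r => ?_)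
      obtain ⟨a, hac⟩ : ∃ a, a + 1 = c + 2 * (ℓ + 1) := ⟨c + 2 * (ℓ + 1) - 1, by omega⟩
      have r' : R (v (a + 1)) (v (a + 1 + 2 * j)) := by
        rw [hac, per, show c + 2 * (ℓ + 1) + 2 * j = c + 2 * j + 2 * (ℓ + 1) by ring, per]; exact r
      refine noB (evenChord h.Bs hv hvM j2 (a := a) h1 h2 ?_ ?_)
      · refine tot _ _ (mod_ne (by omega) (by omega)) (fun r2 => noR ?_)
        exact claimA h.Rs hv ha hvM (a := a + 1) (J := 2 * j) (by omega) (by omega) r' (by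
          rw [show a + 1 + 2 * j + 2 = a + 2 * j + 3 by ring]; exact r2)
      · refine tot _ _ (mod_ne (by omega) (by omega)) (fun r2 => noR ?_)
        exact claimA h.Rs hv ha hvM (a := a) (J := 2 * j - 1) (by omega) (by omega) (by
          rw [show a + (2 * j - 1) = a + 2 * j - 1 by omega]; exact r2) (by
          rw [show a + (2 * j - 1) + 2 = a + 1 + 2 * j by omega]; exact r')
    have hcl1 : ∀ c j, 1 ≤ j → j ≤ ℓ → B (v c) (v (c + 2 * j)) := by
      intro c j h1 h2
      by_cases e1 : j = 1
      · subst e1; exact j2 c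
      by_cases e2 : j = ℓ
      · subst e2
        have := j2 (c + 2 * j)
        rw [show c + 2 * j + 2 = c + 2 * (j + 1) by ring, per] at this
        exact h.Bs _ _ this
      · exact hcl c j (by omega) (by omega)
    have clq : ∀ t, ∀ x ∈ (Finset.range (ℓ + 1)).image (fun i => v (t + 2 * i)),
        ∀ y ∈ (Finset.range (ℓ + 1)).image (fun i => v (t + 2 * i)), x ≠ y → B x y := by
      intro t x hx y hy hxy
      obtain ⟨i, hi, rfl⟩ := Finset.mem_image.1 hx
      obtain ⟨j, hj, rfl⟩ := Finset.mem_image.1 hy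
      rw [Finset.mem_range] at hi hj
      have hij : i ≠ j := fun e => hxy (by rw [e])
      rcases Nat.lt_or_gt_of_ne hij with h' | h'
      · have := hcl1 (t + 2 * i) (j - i) (by omega) (by omega)
        rwa [show t + 2 * i + 2 * (j - i) = t + 2 * j by omega] at this
      · have := hcl1 (t + 2 * j) (i - j) (by omega) (by omega)
        rw [show t + 2 * j + 2 * (i - j) = t + 2 * i by omega] at this
        exact h.Bs _ _ this
    have crd : ∀ t, ((Finset.range (ℓ + 1)).image (fun i => v (t + 2 * i))).card = ℓ + 1 := by
      intro t
      rw [Finset.card_image_of_injOn, Finset.card_range]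
      intro i hi j hj e
      have e := (hv _ _).1 e
      simp only [Finset.coe_range, Set.mem_Iio] at hi hj
      have := mod_cases e (by omega) (by omega)
      omega
    have memE : ∀ t, t < 2 → ∀ x, x % 2 = t → v x ∈ (Finset.range (ℓ + 1)).image (fun i => v (t + 2 * i)) := by
      intro t ht x hx
      rw [Finset.mem_image]
      have h1 := Nat.mod_lt x (show 0 < 2 * (ℓ + 1) by omega)
      have h2 := par2 (m := ℓ + 1) (x := x % (2 * (ℓ + 1))) (y := x) (by simp)
      refine ⟨x % (2 * (ℓ + 1)) / 2, by rw [Finset.mem_range]; omega, ?_⟩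
      show v _ = v _
      rw [hv, show t + 2 * (x % (2 * (ℓ + 1)) / 2) = x % (2 * (ℓ + 1)) by omega]; simp
    have subM : ∀ t, (Finset.range (ℓ + 1)).image (fun i => v (t + 2 * i)) ⊆ M := by
      intro t x hx
      obtain ⟨i, hi, rfl⟩ := Finset.mem_image.1 hx
      exact hvM _
    have nbr : ∀ t t', t' < 2 → (t + 1) % 2 = t' → ∀ s ∈ (Finset.range (ℓ + 1)).image (fun i => v (t + 2 * i)), ∀ o,
        ∃ o1 ∈ (Finset.range (ℓ + 1)).image (fun i => v (t' + 2 * i)), o1 ≠ o ∧ R s o1 := by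
      intro t t' h1 h2 s hs o
      obtain ⟨i, hi, rfl⟩ := Finset.mem_image.1 hs
      by_cases ho : v (t + 2 * i + 1) = o
      · refine ⟨v (t + 2 * i + 2 * ℓ + 1), memE t' h1 _ (by omega), ?_, ?_⟩
        · rw [← ho]; intro e
          exact mod_ne (by omega) (by omega) ((hv _ _).1 e).symm
        · have := ha (t + 2 * i + 2 * ℓ + 1)
          rw [show t + 2 * i + 2 * ℓ + 1 + 1 = t + 2 * i + 2 * (ℓ + 1) by ring, per] at this
          exact h.Rs _ _ this
      · exact ⟨_, memE t' h1 _ (by omega), ho, ha _⟩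
    refine finF h hp hl hM noR noB (E := (Finset.range (ℓ + 1)).image (fun i => v (0 + 2 * i)))
      (O := (Finset.range (ℓ + 1)).image (fun i => v (1 + 2 * i))) ?_ (subM 0) (subM 1) (crd 0) (crd 1) (clq 0) (clq 1)
      (nbr 0 1 (by omega) (by omega)) (nbr 1 0 (by omega) (by omega))
    rw [Finset.disjoint_left]
    intro x hx hx'
    obtain ⟨i, hi, rfl⟩ := Finset.mem_image.1 hx
    obtain ⟨j, hj, e⟩ := Finset.mem_image.1 hx'
    have := par2 ((hv _ _).1 e)
    omega

/-- the two-coloured case -/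
theorem Ttwo (h : Multi ℓ M part R B) (hp : ∀ x ∈ M, ∀ y ∈ M, part x = part y → x = y) (hl : 3 ≤ ℓ)
    (hM : 4 * ℓ + 1 ≤ M.card)
    (noR : ¬ HasCyc R M (2 * ℓ + 1)) (noB : ¬ HasCyc B M (2 * ℓ + 1)) : False := by
  classical
  have hex : ∃ L, 2 * ℓ + 1 ≤ L ∧ (HasCyc R M L ∨ HasCyc B M L) := by
    by_contra hcon
    push Not at hcon
    obtain ⟨S, hSM, hS⟩ := Finset.exists_subset_card_eq hM
    have h1 := EG h.Rs (fun x hx => h.Rn x x hx rfl) (K := 2 * ℓ) (by omega) (4 * ℓ) S hS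
      (fun m hm hc => (hcon m hm).1 (hc.mono hSM))
    have h2 := EG h.Bs (fun x hx => h.Bn x x hx rfl) (K := 2 * ℓ) (by omega) (4 * ℓ) S hS
      (fun m hm hc => (hcon m hm).2 (hc.mono hSM))
    have h3 : ∑ x ∈ S, 4 * ℓ ≤ ∑ x ∈ S, (dg R S x + dg B S x) := by
      refine Finset.sum_le_sum (fun x hx => ?_)
      have hsub : S.erase x ⊆ S.filter (fun y => R x y) ∪ S.filter (fun y => B x y) := by
        intro y hy
        rw [Finset.mem_erase] at hy
        rw [Finset.mem_union, Finset.mem_filter, Finset.mem_filter]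
        rcases h.tot x (hSM hx) y (hSM hy.2) (fun e => hy.1 (hp _ (hSM hx) _ (hSM hy.2) e).symm) with r | r
        · exact Or.inl ⟨hy.2, r⟩
        · exact Or.inr ⟨hy.2, r⟩
      have c1 := Finset.card_le_card hsub
      have c2 := Finset.card_union_le (S.filter (fun y => R x y)) (S.filter (fun y => B x y))
      rw [Finset.card_erase_of_mem hx, hS] at c1
      have e1 : dg R S x = (S.filter (fun y => R x y)).card := by unfold dg; congr
      have e2 : dg B S x = (S.filter (fun y => B x y)).card := by unfold dg; congr
      omega
    rw [Finset.sum_add_distrib, Finset.sum_const, hS, smul_eq_mul] at h3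
    nlinarith
  have hs := Nat.find_spec hex
  have hm : ∀ m, 2 * ℓ + 1 ≤ m → m < Nat.find hex → ¬ HasCyc R M m ∧ ¬ HasCyc B M m := by
    intro m h1 h2
    have := Nat.find_min hex h2
    tauto
  rcases hs.2 with hc | hc
  · exact T2main h hp hl hM hs.1 hc noR noB hm
  · exact T2main h.swap hp hl hM hs.1 hc noB noR (fun m h1 h2 => (hm m h1 h2).symm)
end T3
end GR

namespace GR
set_option linter.unusedSectionVars false
section T4
variable {V : Type*} [DecidableEq V]

theorem Pth.drop {G : V → V → Prop} {a b : V} {F : Finset V} (h : Pth G a b F) : ∀ q, q < F.card →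
    ∃ c Q F', Pth G c b F' ∧ Disjoint Q F' ∧ Q ⊆ F ∧ F' ⊆ F ∧ Q.card = q ∧ F'.card + q = F.card := by
  induction h with
  | single a =>
    intro q hq
    rw [Finset.card_singleton] at hq
    exact ⟨a, ∅, {a}, Pth.single a, by simp, by simp, by simp, by simp; omega, by simp; omega⟩
  | @cons a b c F hab ha hp ih =>
    intro q hq
    rw [Finset.card_insert_of_notMem ha] at hq
    rcases Nat.eq_zero_or_pos q with rfl | hq0
    · exact ⟨a, ∅, _, Pth.cons hab ha hp, by simp, by simp, by simp, by simp, by simp⟩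
    · obtain ⟨d, Q, F', h1, h2, h3, h4, h5, h6⟩ := ih (q - 1) (by omega)
      have haQ : a ∉ Q := fun h => ha (h3 h)
      refine ⟨d, insert a Q, F', h1, ?_, Finset.insert_subset_insert _ h3, h4.trans (Finset.subset_insert _ _), ?_, ?_⟩
      · rw [Finset.disjoint_insert_left]; exact ⟨fun h => ha (h4 h), h2⟩
      · rw [Finset.card_insert_of_notMem haQ]; omega
      · rw [Finset.card_insert_of_notMem ha]; omega

theorem HUB {G : V → V → Prop} {ℓ : ℕ} {M X F : Finset V} {a b : V} (hX : Disjoint M X) (hb : Bic G X M)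
    (hx : 1 ≤ X.card) (hxl : X.card ≤ ℓ) (h : Pth G a b F) (hFM : F ⊆ M) (hc : 2 * ℓ + 1 ≤ F.card + X.card) :
    HasCyc G (M ∪ X) (2 * ℓ + 1) := by
  obtain ⟨b', F1, s1, p1, c1⟩ := h.trunc (2 * ℓ + 1 - X.card) (by omega) (by omega)
  have hF1M := s1.trans hFM
  obtain ⟨c, Q, F', p2, d2, sQ, sF, cQ, cF⟩ := p1.drop (X.card - 1) (by omega)
  have hQM := sQ.trans hF1M
  have hFM' := sF.trans hF1M
  rcases Nat.lt_or_ge 1 X.card with h2 | h2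
  · obtain ⟨x0, hx0, x1, hx1, hne⟩ := Finset.one_lt_card.1 h2
    have hd : Disjoint F' (X ∪ Q) := by
      rw [Finset.disjoint_union_right]; exact ⟨hX.mono_left hFM', d2.symm⟩
    refine (closeSame (j := X.card - 1) (m := 2 * ℓ + 1) (hb.mono subset_rfl hQM) (hX.symm.mono_right hQM) p2 hd
      hx0 hx1 hne (hb x0 hx0 b' (hFM' p2.last_mem)).2 (hb x1 hx1 c (hFM' p2.head_mem)).1 (by omega) (by omega)
      (by omega) (by omega)).mono ?_
    intro x hx
    simp only [Finset.mem_union] at hx ⊢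
    rcases hx with hx | hx | hx
    · exact Or.inl (hFM' hx)
    · exact Or.inr hx
    · exact Or.inl (hQM hx)
  · obtain ⟨x0, hx0⟩ := Finset.card_pos.1 hx
    have hn : x0 ∉ F1 := fun h => Finset.disjoint_left.1 hX (hF1M h) hx0
    refine ⟨_, _, _, Pth.cons (hb x0 hx0 a (hF1M p1.head_mem)).1 hn p1, (hb x0 hx0 b' (hF1M p1.last_mem)).2, ?_, ?_⟩
    · exact Finset.insert_subset (Finset.mem_union_right _ hx0) (hF1M.trans Finset.subset_union_left)
    · rw [Finset.card_insert_of_notMem hn]; omega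

variable {ℓ : ℕ} {M : Finset V} {part : V → ℕ} {R B : V → V → Prop}

theorem Ptwo_aux (h : Multi ℓ M part R B) (hp : ∀ x ∈ M, ∀ y ∈ M, part x = part y → x = y) (hl : 3 ≤ ℓ)
    {X Y : Finset V} (dX : Disjoint M X) (dY : Disjoint M Y) (bX : Bic R X M) (bY : Bic B Y M)
    (x1 : 1 ≤ X.card) (xl : X.card ≤ ℓ) (yl : Y.card ≤ ℓ)
    (noR : ¬ HasCyc R (M ∪ X) (2 * ℓ + 1)) (noB : ¬ HasCyc B (M ∪ Y) (2 * ℓ + 1)) :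
    M.card + X.card + Y.card ≤ 4 * ℓ := by
  by_contra hcon
  push Not at hcon
  obtain ⟨U, S, T, h1, h2, h3, h4, h5, h6, h7⟩ := DFS h.Rs M
  have hSM : S ⊆ M := by rw [← h1]; intro x; simp; tauto
  have hTM : T ⊆ M := by rw [← h1]; intro x; simp; tauto
  have hUM : U ⊆ M := by rw [← h1]; intro x; simp; tauto
  have hcard : M.card = U.card + S.card + T.card := by
    rw [← h1, Finset.card_union_of_disjoint (by rw [Finset.disjoint_union_left]; exact ⟨h3, h4⟩),
      Finset.card_union_of_disjoint h2]
  have hU : U.card + X.card ≤ 2 * ℓ := by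
    by_contra hU
    push Not at hU
    rcases h7 with rfl | ⟨a, b, hab⟩
    · simp at hU; omega
    · exact noR (HUB dX bX x1 xl hab hUM (by omega))
  have hbic : Bic B S T := fun x hx y hy => by
    have := (h.tot x (hSM hx) y (hTM hy) (fun e => Finset.disjoint_left.1 h4 hx
      (hp x (hSM hx) y (hTM hy) e ▸ hy))).resolve_left (h6 x hx y hy)
    exact ⟨this, h.Bs _ _ this⟩
  rcases Nat.eq_zero_or_pos Y.card with hy | hy
  · obtain rfl := Finset.card_eq_zero.1 hy
    have := h.BL (by omega) hSM hTM dX bX xl hbic (by omega) (by omega) noR (by simpa using noB)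
    omega
  · obtain ⟨s, hs⟩ := Finset.card_pos.1 (show 0 < S.card by omega)
    obtain ⟨t, ht⟩ := Finset.card_pos.1 (show 0 < T.card by omega)
    obtain ⟨F, f1, f2, f3⟩ := alt3 S.card hbic h4 hs ht (by omega) le_rfl (by omega)
    exact noB (HUB dY bY hy yl f2 (f1.trans (Finset.union_subset hSM hTM)) (by omega))

theorem Ptwo (h : Multi ℓ M part R B) (hp : ∀ x ∈ M, ∀ y ∈ M, part x = part y → x = y) (hl : 3 ≤ ℓ)
    {X Y : Finset V} (dX : Disjoint M X) (dY : Disjoint M Y) (bX : Bic R X M) (bY : Bic B Y M)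
    (xl : X.card ≤ ℓ) (yl : Y.card ≤ ℓ)
    (noR : ¬ HasCyc R (M ∪ X) (2 * ℓ + 1)) (noB : ¬ HasCyc B (M ∪ Y) (2 * ℓ + 1)) :
    M.card + X.card + Y.card ≤ 4 * ℓ := by
  rcases Nat.eq_zero_or_pos X.card with hx | hx
  · rcases Nat.eq_zero_or_pos Y.card with hy | hy
    · by_contra hcon
      exact Ttwo h hp hl (by omega) (fun hc => noR (hc.mono Finset.subset_union_left))
        (fun hc => noB (hc.mono Finset.subset_union_left))
    · have := Ptwo_aux h.swap hp hl dY dX bY bX hy yl xl noB noR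
      omega
  · exact Ptwo_aux h hp hl dX dY bX bY hx xl yl noR noB
end T4
end GR

namespace GR
set_option linter.unusedSectionVars false
section P1
variable {V : Type*} [DecidableEq V]

theorem HasCyc.imp {G G' : V → V → Prop} {S : Finset V} {n : ℕ} (h : HasCyc G S n) (hG : ∀ x y, G x y → G' x y) :
    HasCyc G' S n := by
  obtain ⟨a, b, F, h1, h2, h3, h4⟩ := h
  exact ⟨a, b, F, h1.imp (by intros; apply hG; assumption), hG _ _ h2, h3, h4⟩

theorem core {K : ℕ} {R B : V → V → Prop} (Rs : ∀ x y, R x y → R y x) (Bs : ∀ x y, B x y → B y x)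
    (ex : ∀ x y, R x y → B x y → False) {P Q : Finset V} (hd : Disjoint P Q)
    (tot : ∀ x ∈ P, ∀ y ∈ Q, R x y ∨ B x y)
    (Pb : ∀ x ∈ P, ∀ y ∈ P, ¬ B x y) (Qr : ∀ x ∈ Q, ∀ y ∈ Q, ¬ R x y)
    (Ri : ∀ x, ¬ R x x)
    (F1 : ∀ y ∈ P, ∀ y' ∈ P, R y y' → ∀ x ∈ Q, ∀ x' ∈ Q, x ≠ x' → R y x → R y' x' → False)
    (F2 : ∀ y ∈ Q, ∀ y' ∈ Q, B y y' → ∀ x ∈ P, ∀ x' ∈ P, x ≠ x' → B y x → B y' x' → False)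
    (H1 : ∀ S ⊆ P ∪ Q, (∀ x ∈ S, ∀ y ∈ S, ¬ R x y) → S.card ≤ 2 * K)
    (H2 : ∀ S ⊆ P ∪ Q, (∀ x ∈ S, ∀ y ∈ S, ¬ R x y ∧ ¬ B x y) → S.card ≤ K)
    {p p' q q' : V} (hp : p ∈ P) (hp' : p' ∈ P) (rp : R p p') (hq : q ∈ Q) (hq' : q' ∈ Q) (bq : B q q')
    (hqq : q ≠ q') (r1 : R p q) (_r2 : R p q') (b1 : B p' q) (b2 : B p' q') : P.card + Q.card ≤ 3 * K := by
  have a1 : ∀ x ∈ Q, ¬ R p' x := by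
    intro x hx r
    by_cases e : x = q
    · subst e; exact ex _ _ r b1
    · exact F1 p hp p' hp' rp q hq x hx (Ne.symm e) r1 r
  have a2 : ∀ y ∈ P, y ≠ p' → R q y ∧ R q' y := by
    intro y hy hne
    constructor
    · refine Rs _ _ ((tot y hy q hq).resolve_right (fun b => ?_))
      exact F2 q hq q' hq' bq y hy p' hp' hne (Bs _ _ b) (Bs _ _ b2)
    · refine Rs _ _ ((tot y hy q' hq').resolve_right (fun b => ?_))
      exact F2 q hq q' hq' bq p' hp' y hy hne.symm (Bs _ _ b1) (Bs _ _ b)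
  have c1 := H2 (P.erase p') ((Finset.erase_subset _ _).trans Finset.subset_union_left) (by
    intro x hx y hy
    rw [Finset.mem_erase] at hx hy
    refine ⟨fun r => ?_, Pb x hx.2 y hy.2⟩
    exact F1 x hx.2 y hy.2 r q hq q' hq' hqq (Rs _ _ (a2 x hx.2 hx.1).1) (Rs _ _ (a2 y hy.2 hy.1).2))
  have hn : p' ∉ Q := Finset.disjoint_left.1 hd hp'
  have c2 := H1 (insert p' Q) (Finset.insert_subset (Finset.mem_union_left _ hp') Finset.subset_union_right) (by
    intro x hx y hy r
    rw [Finset.mem_insert] at hx hy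
    rcases hx with rfl | hx
    · rcases hy with rfl | hy
      · exact Ri _ r
      · exact a1 y hy r
    · rcases hy with rfl | hy
      · exact a1 x hx (Rs _ _ r)
      · exact Qr x hx y hy r)
  rw [Finset.card_erase_of_mem hp'] at c1
  rw [Finset.card_insert_of_notMem hn] at c2
  omega

theorem caseIII {K ℓ : ℕ} (hl : 2 ≤ ℓ) {R B : V → V → Prop} (Rs : ∀ x y, R x y → R y x) (Bs : ∀ x y, B x y → B y x)
    (ex : ∀ x y, R x y → B x y → False) (Ri : ∀ x, ¬ R x x) (Bi : ∀ x, ¬ B x x)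
    {A P Q M : Finset V} (hd : Disjoint P Q) (dP : Disjoint A P) (dQ : Disjoint A Q) (hPM : P ⊆ M) (hQM : Q ⊆ M)
    (hAM : A ⊆ M) (cA : ℓ + 1 ≤ A.card) (cP : ℓ + 1 ≤ P.card) (cQ : ℓ + 1 ≤ Q.card)
    (bA : Bic B A P) (rA : Bic R A Q)
    (tot : ∀ x ∈ P, ∀ y ∈ Q, R x y ∨ B x y)
    (noR : ¬ HasCyc R M (2 * ℓ + 1)) (noB : ¬ HasCyc B M (2 * ℓ + 1))
    (H1 : ∀ S ⊆ M, (∀ x ∈ S, ∀ y ∈ S, ¬ R x y) → S.card ≤ 2 * K)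
    (H1' : ∀ S ⊆ M, (∀ x ∈ S, ∀ y ∈ S, ¬ B x y) → S.card ≤ 2 * K)
    (H2 : ∀ S ⊆ M, (∀ x ∈ S, ∀ y ∈ S, ¬ R x y ∧ ¬ B x y) → S.card ≤ K) : P.card + Q.card ≤ 3 * K := by
  have Pb : ∀ x ∈ P, ∀ y ∈ P, ¬ B x y := fun x hx y hy b =>
    noB ((U1 (ℓ := ℓ) (by omega) bA.symm dP.symm hy hx (fun e => Bi x (by rw [e] at b; exact b)) b cP (by omega)).mono
      (Finset.union_subset hPM hAM))
  have Qr : ∀ x ∈ Q, ∀ y ∈ Q, ¬ R x y := fun x hx y hy b =>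
    noR ((U1 (ℓ := ℓ) (by omega) rA.symm dQ.symm hy hx (fun e => Ri x (by rw [e] at b; exact b)) b cQ (by omega)).mono
      (Finset.union_subset hQM hAM))
  by_cases hP : ∀ x ∈ P, ∀ y ∈ P, ¬ R x y
  · have := H2 P hPM (fun x hx y hy => ⟨hP x hx y hy, Pb x hx y hy⟩)
    have := H1 Q hQM Qr
    omega
  by_cases hQ : ∀ x ∈ Q, ∀ y ∈ Q, ¬ B x y
  · have := H2 Q hQM (fun x hx y hy => ⟨Qr x hx y hy, hQ x hx y hy⟩)
    have := H1' P hPM Pb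
    omega
  push Not at hP hQ
  obtain ⟨p, hp, p', hp', rp⟩ := hP
  obtain ⟨q, hq, q', hq', bq⟩ := hQ
  have F1 : ∀ y ∈ P, ∀ y' ∈ P, R y y' → ∀ x ∈ Q, ∀ x' ∈ Q, x ≠ x' → R y x → R y' x' → False := by
    intro y hy y' hy' r x hx x' hx' ne r1 r2
    have nm : ∀ y ∈ P, y ∉ Q ∪ A := fun y hy => by
      rw [Finset.mem_union, not_or]; exact ⟨Finset.disjoint_left.1 hd hy, Finset.disjoint_right.1 dP hy⟩
    exact noR ((U3 hl rA.symm dQ.symm (nm y hy) (nm y' hy') (fun e => Ri y (by rw [← e] at r; exact r)) r hx hx' ne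
      (Rs _ _ r1) r2 (by omega) (by omega)).mono (Finset.insert_subset (hPM hy) (Finset.insert_subset (hPM hy')
      (Finset.union_subset hQM hAM))))
  have F2 : ∀ y ∈ Q, ∀ y' ∈ Q, B y y' → ∀ x ∈ P, ∀ x' ∈ P, x ≠ x' → B y x → B y' x' → False := by
    intro y hy y' hy' r x hx x' hx' ne r1 r2
    have nm : ∀ y ∈ Q, y ∉ P ∪ A := fun y hy => by
      rw [Finset.mem_union, not_or]; exact ⟨Finset.disjoint_right.1 hd hy, Finset.disjoint_right.1 dQ hy⟩
    exact noB ((U3 hl bA.symm dP.symm (nm y hy) (nm y' hy') (fun e => Bi y (by rw [← e] at r; exact r)) r hx hx' ne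
      (Bs _ _ r1) r2 (by omega) (by omega)).mono (Finset.insert_subset (hQM hy) (Finset.insert_subset (hQM hy')
      (Finset.union_subset hPM hAM))))
  have npp : p ≠ p' := fun e => Ri p (by rw [← e] at rp; exact rp)
  have nqq : q ≠ q' := fun e => Bi q (by rw [← e] at bq; exact bq)
  have hPQ : P ∪ Q ⊆ M := Finset.union_subset hPM hQM
  have hQP : Q ∪ P ⊆ M := Finset.union_subset hQM hPM
  have C1 : ∀ p ∈ P, ∀ p' ∈ P, R p p' → ∀ q ∈ Q, ∀ q' ∈ Q, B q q' → q ≠ q' → R p q → R p q' → B p' q → B p' q' →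
      P.card + Q.card ≤ 3 * K := by
    intro p hp p' hp' rp q hq q' hq' bq hqq r1 r2 b1 b2
    exact core Rs Bs ex hd tot Pb Qr Ri F1 F2 (fun S hS => H1 S (hS.trans hPQ)) (fun S hS => H2 S (hS.trans hPQ))
      hp hp' rp hq hq' bq hqq r1 r2 b1 b2
  have C2 : ∀ p ∈ P, ∀ p' ∈ P, R p p' → p ≠ p' → ∀ q ∈ Q, ∀ q' ∈ Q, B q q' → B q p → B q p' → R q' p → R q' p' →
      P.card + Q.card ≤ 3 * K := by
    intro p hp p' hp' rp hpp q hq q' hq' bq r1 r2 b1 b2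
    have := core (K := K) Bs Rs (fun x y h1 h2 => ex x y h2 h1) hd.symm
      (fun x hx y hy => ((tot y hy x hx).symm.imp (Bs _ _) (Rs _ _))) Qr Pb Bi F2 F1
      (fun S hS => H1' S (hS.trans hQP)) (fun S hS h => H2 S (hS.trans hQP) (fun x hx y hy => (h x hx y hy).symm))
      hq hq' bq hp hp' rp hpp r1 r2 b1 b2
    omega
  -- the four cross edges
  have t1 := tot p hp q hq
  have t2 := tot p hp q' hq'
  have t3 := tot p' hp' q hq
  have t4 := tot p' hp' q' hq'
  have f1 := F1 p hp p' hp' rp q hq q' hq' nqq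
  have f2 := F1 p hp p' hp' rp q' hq' q hq nqq.symm
  have g1 := F2 q hq q' hq' bq p hp p' hp' npp
  have g2 := F2 q hq q' hq' bq p' hp' p hp npp.symm
  rcases t1 with t1 | t1
  · have t4 := t4.resolve_left (f1 t1)
    rcases t2 with t2 | t2
    · have t3 := t3.resolve_left (f2 t2)
      exact C1 p hp p' hp' rp q hq q' hq' bq nqq t1 t2 t3 t4
    · have t3 := t3.resolve_right (fun h => g2 (Bs _ _ h) (Bs _ _ t2))
      exact C2 p hp p' hp' rp npp q' hq' q hq (Bs _ _ bq) (Bs _ _ t2) (Bs _ _ t4) (Rs _ _ t1) (Rs _ _ t3)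
  · have t4 := t4.resolve_right (fun h => g1 (Bs _ _ t1) (Bs _ _ h))
    rcases t2 with t2 | t2
    · have t3 := t3.resolve_left (f2 t2)
      exact C2 p hp p' hp' rp npp q hq q' hq' bq (Bs _ _ t1) (Bs _ _ t3) (Rs _ _ t2) (Rs _ _ t4)
    · have t3 := t3.resolve_right (fun h => g2 (Bs _ _ h) (Bs _ _ t2))
      exact C1 p' hp' p hp (Rs _ _ rp) q hq q' hq' bq nqq t3 t4 t1 t2

/-- the small part case -/
theorem smallCase {ℓ : ℕ} (hl : 1 ≤ ℓ) {M X : Finset V} {part : V → ℕ} {R B R' : V → V → Prop} (h : Multi ℓ M part R B)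
    (hX : Disjoint M X) (hRR : ∀ x y, R x y → R' x y) (hb : Bic R' X M) (hne : X.Nonempty)
    (noR : ¬ HasCyc R' (M ∪ X) (2 * ℓ + 1)) (noB : ¬ HasCyc B M (2 * ℓ + 1)) : M.card ≤ 4 * ℓ := by
  by_contra hcon
  push Not at hcon
  obtain ⟨a, b, F, h1, h2, h3⟩ := h.star hl subset_rfl hcon
    (fun hc => noR ((hc.imp hRR).mono Finset.subset_union_left)) noB
  obtain ⟨x, hx⟩ := hne
  have hx' : ({x} : Finset V) ⊆ X := by simpa using hx
  refine noR ((HUB (ℓ := ℓ) (X := {x}) (hX.mono_right hx') (hb.mono hx' subset_rfl) (by simp) (by simpa using hl)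
    (h1.imp (by intros; apply hRR; assumption)) h2 (by simp; omega)).mono (Finset.union_subset_union subset_rfl hx'))
end P1
end GR

namespace GR
set_option linter.unusedSectionVars false
section P2
variable {V α : Type*} [DecidableEq V] [Fintype V] [DecidableEq α]

/-- the induction set-up: colours in `C` on `M`, with hub sets `X i`. -/
structure Good (ℓ : ℕ) (c : Sym2 V → α) (C : Finset α) (M : Finset V) (X : α → Finset V) : Prop where
  col : ∀ x ∈ M, ∀ y ∈ M, x ≠ y → c s(x, y) ∈ C
  dis : ∀ i, Disjoint M (X i)
  hub : ∀ i, ∀ x ∈ X i, ∀ m ∈ M, c s(x, m) = i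
  sz : ∀ i, (X i).card ≤ ℓ

variable {ℓ : ℕ} {c : Sym2 V → α} {C : Finset α} {M : Finset V} {X : α → Finset V}

theorem Good.sub (h : Good ℓ c C M X) {S : Finset V} (hS : S ⊆ M) {C' : Finset α}
    (hC : ∀ x ∈ S, ∀ y ∈ S, x ≠ y → c s(x, y) ∈ C') : Good ℓ c C' S X where
  col := hC
  dis := fun i => (h.dis i).mono_left hS
  hub := fun i x hx m hm => h.hub i x hx m (hS hm)
  sz := h.sz

theorem Good.empty (h : Good ℓ c C M X) : Good ℓ c C M (fun _ => ∅) where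
  col := h.col
  dis := fun i => by simp
  hub := fun i x hx => by simp at hx
  sz := fun i => by simp

theorem Good.bic (h : Good ℓ c C M X) (i : α) : Bic (Col c i) (X i) M := fun x hx m hm => by
  have : Col c i x m := ⟨fun e => Finset.disjoint_left.1 (h.dis i) hm (e ▸ hx), h.hub i x hx m hm⟩
  exact ⟨this, Col.symm _ _ this⟩

theorem Good.add (h : Good ℓ c C M X) {r : α} {Q : Finset V} (hd : Disjoint M Q) (hb : Bic (Col c r) M Q)
    (hs : (X r).card + Q.card ≤ ℓ) : Good ℓ c C M (Function.update X r (X r ∪ Q)) where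
  col := h.col
  dis := fun i => by
    by_cases e : i = r
    · subst e; simp only [Function.update_self, Finset.disjoint_union_right]; exact ⟨h.dis i, hd⟩
    · rw [Function.update_of_ne e]; exact h.dis i
  hub := fun i x hx m hm => by
    by_cases e : i = r
    · subst e
      simp only [Function.update_self, Finset.mem_union] at hx
      rcases hx with hx | hx
      · exact h.hub i x hx m hm
      · exact (hb m hm x hx).2.2
    · rw [Function.update_of_ne e] at hx; exact h.hub i x hx m hm
  sz := fun i => by
    by_cases e : i = r
    · subst e; simp only [Function.update_self]; exact (Finset.card_union_le _ _).trans hs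
    · rw [Function.update_of_ne e]; exact h.sz i

theorem sum_upd {r : α} {Q : Finset V} (hr : r ∈ C) (hd : Disjoint (X r) Q) :
    ∑ i ∈ C, ((Function.update X r (X r ∪ Q)) i).card = ∑ i ∈ C, (X i).card + Q.card := by
  rw [← Finset.add_sum_erase C _ hr, ← Finset.add_sum_erase C (fun i => (X i).card) hr, Function.update_self,
    Finset.card_union_of_disjoint hd]
  have : ∑ i ∈ C.erase r, ((Function.update X r (X r ∪ Q)) i).card = ∑ i ∈ C.erase r, (X i).card := by
    refine Finset.sum_congr rfl (fun i hi => ?_)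
    rw [Function.update_of_ne (Finset.ne_of_mem_erase hi)]
  rw [this]; ring

theorem hubfree (hl : 3 ≤ ℓ) (noC : ∀ i, ¬ HasCyc (Col c i) Finset.univ (2 * ℓ + 1)) (h : Good ℓ c C M X) {b : α}
    {A P : Finset V} (hA : A ⊆ M) (hP : P ⊆ M) (hd : Disjoint A P) (hb : Bic (Col c b) A P)
    (cA : ℓ + 1 ≤ A.card) (hc : ℓ + 1 ≤ P.card + (X b).card) :
    X b = ∅ ∧ (∀ x ∈ A, ∀ y ∈ A, ¬ Col c b x y) ∧ (∀ x ∈ P, ∀ y ∈ P, ¬ Col c b x y) := by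
  have bU : Bic (Col c b) (P ∪ X b) A := by
    intro x hx y hy
    rw [Finset.mem_union] at hx
    rcases hx with hx | hx
    · exact (hb y hy x hx).symm
    · exact h.bic b x hx y (hA hy)
  have dU : Disjoint (P ∪ X b) A := by
    rw [Finset.disjoint_union_left]; exact ⟨hd.symm, ((h.dis b).mono_left hA).symm⟩
  have cU : (P ∪ X b).card = P.card + (X b).card := Finset.card_union_of_disjoint ((h.dis b).mono_left hP)
  have fU : ∀ x ∈ P ∪ X b, ∀ y ∈ P ∪ X b, ¬ Col c b x y := fun x hx y hy e =>
    noC b ((U1 (ℓ := ℓ) (by omega) bU dU hy hx e.1.symm e (by omega) (by omega)).mono (Finset.subset_univ _))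
  have fA : ∀ x ∈ A, ∀ y ∈ A, ¬ Col c b x y := fun x hx y hy e =>
    noC b ((U1 (ℓ := ℓ) (by omega) bU.symm dU.symm hy hx e.1.symm e (by omega) (by omega)).mono (Finset.subset_univ _))
  refine ⟨?_, fA, fun x hx y hy => fU x (Finset.mem_union_left _ hx) y (Finset.mem_union_left _ hy)⟩
  by_contra hne
  obtain ⟨x, hx⟩ := Finset.nonempty_iff_ne_empty.2 hne
  have := h.sz b
  obtain ⟨y, hy⟩ := Finset.card_pos.1 (show 0 < P.card by omega)
  exact fU x (Finset.mem_union_right _ hx) y (Finset.mem_union_left _ hy) (h.bic b x hx y (hP hy)).1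

theorem caseII (hl : 3 ≤ ℓ) (noC : ∀ i, ¬ HasCyc (Col c i) Finset.univ (2 * ℓ + 1)) (h : Good ℓ c C M X) {r b : α}
    (hr : r ∈ C) (hbC : b ∈ C) (hrb : r ≠ b) {A P Q : Finset V} (hA : A ⊆ M) (hP : P ⊆ M) (hQ : Q ⊆ M)
    (hcard : M.card = A.card + P.card + Q.card)
    (dP : Disjoint A P) (dQ : Disjoint A Q) (bA : Bic (Col c b) A P) (rA : Bic (Col c r) A Q)
    (cA : ℓ + 1 ≤ A.card)
    (ihC : ∀ C' : Finset α, C'.card < C.card → ∀ M X, Good ℓ c C' M X →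
      M.card + ∑ i ∈ C', (X i).card ≤ ℓ * 2 ^ C'.card)
    (h1 : ℓ + 1 ≤ P.card + (X b).card) (h2 : Q.card + (X r).card ≤ ℓ) :
    M.card + ∑ i ∈ C, (X i).card ≤ ℓ * 2 ^ C.card := by
  obtain ⟨e, fA, fP⟩ := hubfree hl noC h hA hP dP bA cA h1
  have hce : (C.erase b).card + 1 = C.card := Finset.card_erase_add_one hbC
  have g1 : Good ℓ c (C.erase b) A X := h.sub hA (fun x hx y hy n => Finset.mem_erase.2
    ⟨fun e => fA x hx y hy ⟨n, e⟩, h.col x (hA hx) y (hA hy) n⟩)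
  have g2 : Good ℓ c (C.erase b) P X := h.sub hP (fun x hx y hy n => Finset.mem_erase.2
    ⟨fun e => fP x hx y hy ⟨n, e⟩, h.col x (hP hx) y (hP hy) n⟩)
  have b1 := ihC (C.erase b) (by omega) A _ (g1.add (r := r) dQ rA (by omega))
  have b2 := ihC (C.erase b) (by omega) P _ g2.empty
  rw [sum_upd (Finset.mem_erase.2 ⟨hrb, hr⟩) ((h.dis r).mono_left hQ).symm] at b1
  simp only [Finset.card_empty, Finset.sum_const_zero] at b2
  rw [← Finset.add_sum_erase C (fun i => (X i).card) hbC, e, ← hce, pow_succ]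
  simp only [Finset.card_empty]
  have : ℓ * (2 ^ (C.erase b).card * 2) = 2 * (ℓ * 2 ^ (C.erase b).card) := by ring
  omega

theorem bigCase (hl : 3 ≤ ℓ) (noC : ∀ i, ¬ HasCyc (Col c i) Finset.univ (2 * ℓ + 1)) (h : Good ℓ c C M X) {r b : α}
    (hr : r ∈ C) (hbC : b ∈ C) (hrb : r ≠ b) {A P Q : Finset V} (hA : A ⊆ M) (hP : P ⊆ M) (hQ : Q ⊆ M)
    (hcard : M.card = A.card + P.card + Q.card) (hd : Disjoint P Q)
    (dP : Disjoint A P) (dQ : Disjoint A Q) (bA : Bic (Col c b) A P) (rA : Bic (Col c r) A Q)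
    (tot : ∀ x ∈ P, ∀ y ∈ Q, Col c r x y ∨ Col c b x y)
    (cA : ℓ + 1 ≤ A.card) (hAM : A.card < M.card)
    (ihC : ∀ C' : Finset α, C'.card < C.card → ∀ M X, Good ℓ c C' M X →
      M.card + ∑ i ∈ C', (X i).card ≤ ℓ * 2 ^ C'.card)
    (ihM : ∀ M' : Finset V, M'.card < M.card → ∀ X, Good ℓ c C M' X →
      M'.card + ∑ i ∈ C, (X i).card ≤ ℓ * 2 ^ C.card) :
    M.card + ∑ i ∈ C, (X i).card ≤ ℓ * 2 ^ C.card := by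
  rcases Nat.lt_or_ge ℓ (P.card + (X b).card) with h1 | h1
  · rcases Nat.lt_or_ge ℓ (Q.card + (X r).card) with h2 | h2
    · obtain ⟨e1, fA1, fP⟩ := hubfree hl noC h hA hP dP bA cA h1
      obtain ⟨e2, fA2, fQ⟩ := hubfree hl noC h hA hQ dQ rA cA h2
      have hrC' : r ∈ C.erase b := Finset.mem_erase.2 ⟨hrb, hr⟩
      have k1 : (C.erase b).card + 1 = C.card := Finset.card_erase_add_one hbC
      have k1' : (C.erase r).card + 1 = C.card := Finset.card_erase_add_one hr
      have k2 : ((C.erase b).erase r).card + 1 = (C.erase b).card := Finset.card_erase_add_one hrC'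
      set K := ℓ * 2 ^ ((C.erase b).erase r).card with hK
      have K1 : ℓ * 2 ^ (C.erase b).card = 2 * K := by rw [← k2, pow_succ, hK]; ring
      have K1' : ℓ * 2 ^ (C.erase r).card = 2 * K := by
        rw [← K1, show (C.erase r).card = (C.erase b).card by omega]
      have K0 : ℓ * 2 ^ C.card = 4 * K := by rw [← k1, pow_succ, ← mul_assoc, K1]; ring
      have gA : Good ℓ c ((C.erase b).erase r) A X := h.sub hA (fun x hx y hy n => by
        rw [Finset.mem_erase, Finset.mem_erase]
        exact ⟨fun e => fA2 x hx y hy ⟨n, e⟩, fun e => fA1 x hx y hy ⟨n, e⟩, h.col x (hA hx) y (hA hy) n⟩)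
      have bA' := ihC _ (by omega) A X gA
      have c0 : (X r).card = 0 := by rw [e2]; rfl
      have c1 : (X b).card = 0 := by rw [e1]; rfl
      have hb3 := caseIII (K := K) (ℓ := ℓ) (R := Col c r) (B := Col c b) (by omega) Col.symm Col.symm
        (fun x y h1 h2 => hrb (h1.2.symm.trans h2.2)) (fun x h => h.1 rfl) (fun x h => h.1 rfl) hd dP dQ hP hQ hA cA
        (by omega) (by omega) bA rA tot (fun hc => noC r (hc.mono (Finset.subset_univ _)))
        (fun hc => noC b (hc.mono (Finset.subset_univ _)))
        (fun S hS hf => by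
          have := ihC (C.erase r) (by omega) S _ (h.sub hS (C' := C.erase r) (fun x hx y hy n => by
            rw [Finset.mem_erase]
            exact ⟨fun e => hf x hx y hy ⟨n, e⟩, h.col x (hS hx) y (hS hy) n⟩)).empty
          simp only [Finset.card_empty, Finset.sum_const_zero] at this
          omega)
        (fun S hS hf => by
          have := ihC (C.erase b) (by omega) S _ (h.sub hS (C' := C.erase b) (fun x hx y hy n => by
            rw [Finset.mem_erase]
            exact ⟨fun e => hf x hx y hy ⟨n, e⟩, h.col x (hS hx) y (hS hy) n⟩)).empty
          simp only [Finset.card_empty, Finset.sum_const_zero] at this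
          omega)
        (fun S hS hf => by
          have := ihC ((C.erase b).erase r) (by omega) S _ (h.sub hS (C' := (C.erase b).erase r)
            (fun x hx y hy n => by
            rw [Finset.mem_erase, Finset.mem_erase]
            exact ⟨fun e => (hf x hx y hy).1 ⟨n, e⟩, fun e => (hf x hx y hy).2 ⟨n, e⟩,
              h.col x (hS hx) y (hS hy) n⟩)).empty
          simp only [Finset.card_empty, Finset.sum_const_zero] at this
          omega)
      rw [← Finset.add_sum_erase C (fun i => (X i).card) hbC,
        ← Finset.add_sum_erase (C.erase b) (fun i => (X i).card) hrC']
      simp only [c0, c1]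
      omega
    · exact caseII hl noC h hr hbC hrb hA hP hQ hcard dP dQ bA rA cA ihC h1 h2
  · rcases Nat.lt_or_ge ℓ (Q.card + (X r).card) with h2 | h2
    · exact caseII hl noC h hbC hr hrb.symm hA hQ hP (by omega) dQ dP rA bA cA ihC h2 h1
    · have gA : Good ℓ c C A X := h.sub hA (fun x hx y hy => h.col x (hA hx) y (hA hy))
      have g1 := gA.add (r := r) dQ rA (by omega)
      have g2 := g1.add (r := b) dP bA (by rw [Function.update_of_ne hrb.symm]; omega)
      have := ihM A hAM _ g2
      rw [sum_upd hbC (by rw [Function.update_of_ne hrb.symm]; exact ((h.dis b).mono_left hP).symm),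
        sum_upd hr ((h.dis r).mono_left hQ).symm] at this
      omega

theorem Pone (hl : 3 ≤ ℓ) (noC : ∀ i, ¬ HasCyc (Col c i) Finset.univ (2 * ℓ + 1)) (h : Good ℓ c C M X)
    (hC : C.card = 1) : M.card + ∑ i ∈ C, (X i).card ≤ ℓ * 2 ^ C.card := by
  obtain ⟨i, rfl⟩ := Finset.card_eq_one.1 hC
  rw [Finset.sum_singleton, hC]
  by_contra hcon
  push Not at hcon
  let cl : V → ℕ := fun x => if x ∈ X i then 0 else (Fintype.equivFin V x).1 + 1
  have cl1 : ∀ x, x ∈ X i → cl x = 0 := fun x hx => by simp [cl, hx]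
  have cl2 : ∀ x, x ∉ X i → cl x = (Fintype.equivFin V x).1 + 1 := fun x hx => by simp [cl, hx]
  refine noC i ((MP (ℓ := ℓ) (by omega) (M ∪ X i) cl ?_ ?_ ?_).mono (Finset.subset_univ _))
  · intro x hx y hy hne
    rw [Finset.mem_union] at hx hy
    by_cases x1 : x ∈ X i
    · by_cases y1 : y ∈ X i
      · exact absurd (by rw [cl1 x x1, cl1 y y1]) hne
      · exact (h.bic i x x1 y (hy.resolve_right y1)).1
    · by_cases y1 : y ∈ X i
      · exact (h.bic i y y1 x (hx.resolve_right x1)).2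
      · have n : x ≠ y := fun e => hne (by rw [e])
        exact ⟨n, by simpa using h.col x (hx.resolve_right x1) y (hy.resolve_right y1) n⟩
  · intro x hx
    by_cases x1 : x ∈ X i
    · refine (Finset.card_le_card (t := X i) ?_).trans (h.sz i)
      intro y hy
      by_contra y1
      have := (Finset.mem_filter.1 hy).2
      rw [cl1 x x1, cl2 y y1] at this
      omega
    · refine (Finset.card_le_card (t := {x}) ?_).trans (by simp; omega)
      intro y hy
      have := (Finset.mem_filter.1 hy).2
      rw [cl2 x x1] at this
      by_cases y1 : y ∈ X i
      · rw [cl1 y y1] at this; omega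
      · rw [cl2 y y1] at this
        simp only [Nat.add_right_cancel_iff] at this
        rw [Finset.mem_singleton]
        exact (Fintype.equivFin V).injective (Fin.ext this)
  · rw [Finset.card_union_of_disjoint (h.dis i)]; omega

theorem Ptwo' (hl : 3 ≤ ℓ) (noC : ∀ i, ¬ HasCyc (Col c i) Finset.univ (2 * ℓ + 1)) (h : Good ℓ c C M X)
    (hC : C.card = 2) : M.card + ∑ i ∈ C, (X i).card ≤ ℓ * 2 ^ C.card := by
  obtain ⟨r, b, hrb, rfl⟩ := Finset.card_eq_two.1 hC
  rw [Finset.sum_pair hrb, hC]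
  have pinj : ∀ x y : V, (Fintype.equivFin V x).1 = (Fintype.equivFin V y).1 → x = y := fun x y e =>
    (Fintype.equivFin V).injective (Fin.ext e)
  have hm : Multi ℓ M (fun x => (Fintype.equivFin V x).1) (Col c r) (Col c b) :=
    { Rs := Col.symm
      Bs := Col.symm
      Rn := fun x y e e' => e.1 (pinj x y e')
      Bn := fun x y e e' => e.1 (pinj x y e')
      tot := fun x hx y hy n => by
        have n' : x ≠ y := fun e => n (by rw [e])
        have := h.col x hx y hy n'
        rw [Finset.mem_insert, Finset.mem_singleton] at this
        exact this.imp (fun e => ⟨n', e⟩) (fun e => ⟨n', e⟩)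
      ex := fun x y h1 h2 => hrb (h1.2.symm.trans h2.2)
      Rm := fun x _ x' _ y _ e e' => by rw [← pinj x x' e]; exact e'
      Bm := fun x _ x' _ y _ e e' => by rw [← pinj x x' e]; exact e'
      sz := fun x hx => by
        refine (Finset.card_le_card (t := {x}) ?_).trans (by simp; omega)
        intro y hy
        rw [Finset.mem_singleton]
        exact pinj y x (Finset.mem_filter.1 hy).2 }
  have := Ptwo hm (fun x _ y _ => pinj x y) hl (h.dis r) (h.dis b) (h.bic r) (h.bic b) (h.sz r) (h.sz b)
    (fun hc => noC r (hc.mono (Finset.subset_univ _))) (fun hc => noC b (hc.mono (Finset.subset_univ _)))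
  omega
end P2
end GR

namespace GR
set_option linter.unusedSectionVars false
section P3
variable {V α : Type*} [DecidableEq V] [Fintype V] [DecidableEq α]
variable {ℓ : ℕ} {c : Sym2 V → α}

theorem k3 (k : ℕ) (hk : 3 ≤ k) : k + 5 ≤ 2 ^ k := by
  induction k, hk using Nat.le_induction with
  | base => norm_num
  | succ k hk ih => rw [pow_succ]; omega

theorem Pmain (hl : 3 ≤ ℓ) (noC : ∀ i, ¬ HasCyc (Col c i) Finset.univ (2 * ℓ + 1)) (hnr : ¬ HasRainbowTriangle c)
    (k : ℕ) : ∀ C : Finset α, C.card = k → ∀ M X, Good ℓ c C M X →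
      M.card + ∑ i ∈ C, (X i).card ≤ ℓ * 2 ^ C.card := by
  induction k using Nat.strong_induction_on with
  | _ k ihk =>
  intro C hC
  have ihC : ∀ C' : Finset α, C'.card < C.card → ∀ M X, Good ℓ c C' M X →
      M.card + ∑ i ∈ C', (X i).card ≤ ℓ * 2 ^ C'.card := fun C' h' => ihk C'.card (by omega) C' rfl
  suffices hh : ∀ n, ∀ M : Finset V, M.card = n → ∀ X, Good ℓ c C M X →
      M.card + ∑ i ∈ C, (X i).card ≤ ℓ * 2 ^ C.card from fun M => hh M.card M rfl
  intro n
  induction n using Nat.strong_induction_on with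
  | _ n ihn =>
  intro M hM X h
  have ihM : ∀ M' : Finset V, M'.card < M.card → ∀ X, Good ℓ c C M' X →
      M'.card + ∑ i ∈ C, (X i).card ≤ ℓ * 2 ^ C.card := fun M' h' => ihn M'.card (by omega) M' rfl
  have hsum : ∀ D : Finset α, ∑ i ∈ D, (X i).card ≤ D.card * ℓ := fun D => by
    have := Finset.sum_le_card_nsmul D (fun i => (X i).card) ℓ (fun i _ => h.sz i)
    simpa using this
  by_cases hMl : M.card ≤ ℓ
  · have h1 := hsum C
    have h2 : C.card + 1 ≤ 2 ^ C.card := Nat.lt_two_pow_self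
    nlinarith
  by_cases hC0 : C.card = 0
  · have := Finset.card_eq_zero.1 hC0
    subst this
    obtain ⟨x, hx, y, hy, hxy⟩ := Finset.one_lt_card.1 (show 1 < M.card by omega)
    have := h.col x hx y hy hxy
    simp at this
  by_cases hC1 : C.card = 1
  · exact Pone hl noC h hC1
  by_cases hC2 : C.card = 2
  · exact Ptwo' hl noC h hC2
  have hk3 : 3 ≤ C.card := by omega
  have hpw := k3 _ hk3
  obtain ⟨part, r, b, hr, hb, hrb, ⟨x0, hx0, y0, hy0, hne⟩, htot, hmod⟩ := gallai_part (V := V) (α := α)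
    (χ := fun x y => c s(x, y)) (fun x y => by rw [Sym2.eq_swap]) (fun x y z h1 h2 h3 => by
      by_contra hcon
      push Not at hcon
      exact hnr ⟨x, y, z, h1, h2, h3, hcon⟩) C (by omega) M.card M rfl (by omega) h.col
  by_cases hbig : ∃ a ∈ M, ℓ + 1 ≤ (M.filter (fun y => part y = part a)).card
  · obtain ⟨a, ha, hA⟩ := hbig
    set A := M.filter (fun y => part y = part a) with hAdef
    set P := M.filter (fun y => part y ≠ part a ∧ c s(a, y) = b) with hPdef
    set Q := M.filter (fun y => part y ≠ part a ∧ c s(a, y) = r) with hQdef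
    have mA : ∀ x, x ∈ A ↔ x ∈ M ∧ part x = part a := fun x => by rw [hAdef, Finset.mem_filter]
    have mP : ∀ x, x ∈ P ↔ x ∈ M ∧ part x ≠ part a ∧ c s(a, x) = b := fun x => by rw [hPdef, Finset.mem_filter]
    have mQ : ∀ x, x ∈ Q ↔ x ∈ M ∧ part x ≠ part a ∧ c s(a, x) = r := fun x => by rw [hQdef, Finset.mem_filter]
    clear_value A P Q
    have dP : Disjoint A P := by
      rw [Finset.disjoint_left]; intro x h1 h2; exact ((mP x).1 h2).2.1 ((mA x).1 h1).2
    have dQ : Disjoint A Q := by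
      rw [Finset.disjoint_left]; intro x h1 h2; exact ((mQ x).1 h2).2.1 ((mA x).1 h1).2
    have hd : Disjoint P Q := by
      rw [Finset.disjoint_left]; intro x h1 h2
      exact hrb (((mQ x).1 h2).2.2.symm.trans ((mP x).1 h1).2.2)
    have hAM : A ⊆ M := fun x hx => ((mA x).1 hx).1
    have hPM : P ⊆ M := fun x hx => ((mP x).1 hx).1
    have hQM : Q ⊆ M := fun x hx => ((mQ x).1 hx).1
    have hun : A ∪ P ∪ Q = M := by
      refine Finset.Subset.antisymm (Finset.union_subset (Finset.union_subset hAM hPM) hQM) (fun x hx => ?_)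
      rw [Finset.mem_union, Finset.mem_union, mA, mP, mQ]
      by_cases e : part x = part a
      · exact Or.inl (Or.inl ⟨hx, e⟩)
      · rcases htot a ha x hx (Ne.symm e) with e' | e'
        · exact Or.inr ⟨hx, e, e'⟩
        · exact Or.inl (Or.inr ⟨hx, e, e'⟩)
    have hcard : M.card = A.card + P.card + Q.card := by
      rw [← hun, Finset.card_union_of_disjoint (by rw [Finset.disjoint_union_left]; exact ⟨dQ, hd⟩),
        Finset.card_union_of_disjoint dP]
    have bic : ∀ i, ∀ x ∈ A, ∀ y ∈ M, part y ≠ part a → c s(a, y) = i → Col c i x y ∧ Col c i y x := by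
      intro i x hx y hy h1 h2
      have hx' := (mA x).1 hx
      have : Col c i x y := ⟨fun e => h1 (e ▸ hx'.2), by
        rw [← hmod a ha x hx'.1 y hy hx'.2.symm h1.symm]; exact h2⟩
      exact ⟨this, Col.symm _ _ this⟩
    refine bigCase hl noC h hr hb hrb hAM hPM hQM hcard hd dP dQ
      (fun x hx y hy => bic b x hx y (hPM hy) ((mP y).1 hy).2.1 ((mP y).1 hy).2.2)
      (fun x hx y hy => bic r x hx y (hQM hy) ((mQ y).1 hy).2.1 ((mQ y).1 hy).2.2) ?_ hA ?_ ihC ihM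
    · intro x hx y hy
      have hxy : x ≠ y := fun e => Finset.disjoint_left.1 hd hx (e ▸ hy)
      by_cases e : part x = part y
      · exfalso
        have h1 := ((mP x).1 hx).2
        have h2 := ((mQ y).1 hy).2
        have h3 := hmod x (hPM hx) y (hQM hy) a ha e h1.1
        rw [Sym2.eq_swap (a := x), Sym2.eq_swap (a := y), h1.2, h2.2] at h3
        exact hrb h3.symm
      · exact (htot x (hPM hx) y (hQM hy) e).imp (fun e => ⟨hxy, e⟩) (fun e => ⟨hxy, e⟩)
    · refine Finset.card_lt_card ⟨hAM, fun hs => hne ?_⟩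
      rw [((mA x0).1 (hs hx0)).2, ((mA y0).1 (hs hy0)).2]
  · push Not at hbig
    have hm : Multi ℓ M part (fun x y => Col c r x y ∧ part x ≠ part y) (fun x y => Col c b x y ∧ part x ≠ part y) :=
      { Rs := fun x y e => ⟨Col.symm _ _ e.1, e.2.symm⟩
        Bs := fun x y e => ⟨Col.symm _ _ e.1, e.2.symm⟩
        Rn := fun x y e => e.2
        Bn := fun x y e => e.2
        tot := fun x hx y hy n => by
          have n' : x ≠ y := fun e => n (by rw [e])
          exact (htot x hx y hy n).imp (fun e => ⟨⟨n', e⟩, n⟩) (fun e => ⟨⟨n', e⟩, n⟩)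
        ex := fun x y h1 h2 => hrb (h1.1.2.symm.trans h2.1.2)
        Rm := fun x hx x' hx' y hy e e' => by
          have n : part x' ≠ part y := e ▸ e'.2
          exact ⟨⟨fun q => n (by rw [q]), by rw [← hmod x hx x' hx' y hy e e'.2]; exact e'.1.2⟩, n⟩
        Bm := fun x hx x' hx' y hy e e' => by
          have n : part x' ≠ part y := e ▸ e'.2
          exact ⟨⟨fun q => n (by rw [q]), by rw [← hmod x hx x' hx' y hy e e'.2]; exact e'.1.2⟩, n⟩
        sz := fun x hx => by have := hbig x hx; omega }
    have nr : ∀ S, ¬ HasCyc (fun x y => Col c r x y ∧ part x ≠ part y) S (2 * ℓ + 1) := fun S hc =>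
      noC r ((hc.imp (fun x y e => e.1)).mono (Finset.subset_univ _))
    have nb : ∀ S, ¬ HasCyc (fun x y => Col c b x y ∧ part x ≠ part y) S (2 * ℓ + 1) := fun S hc =>
      noC b ((hc.imp (fun x y e => e.1)).mono (Finset.subset_univ _))
    have hs := hsum C
    rcases Finset.eq_empty_or_nonempty (X r) with e1 | e1
    · rcases Finset.eq_empty_or_nonempty (X b) with e2 | e2
      · have h7 : M.card ≤ 7 * ℓ := by
          by_contra hcon
          obtain ⟨l, rfl⟩ : ∃ l, ℓ = l + 1 := ⟨ℓ - 1, by omega⟩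
          rcases Multi.Q l hm (by omega) with hc | hc
          · exact nr _ hc
          · exact nb _ hc
        have hrC' : r ∈ C.erase b := Finset.mem_erase.2 ⟨hrb, hr⟩
        have k1 : (C.erase b).card + 1 = C.card := Finset.card_erase_add_one hb
        have k2 : ((C.erase b).erase r).card + 1 = (C.erase b).card := Finset.card_erase_add_one hrC'
        have hs' := hsum ((C.erase b).erase r)
        rw [← Finset.add_sum_erase C (fun i => (X i).card) hb,
          ← Finset.add_sum_erase (C.erase b) (fun i => (X i).card) hrC']
        simp only [e1, e2, Finset.card_empty]
        have : ((C.erase b).erase r).card + 7 ≤ 2 ^ C.card := by omega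
        nlinarith
      · have := smallCase (by omega) hm.swap (h.dis b) (fun x y e => e.1) (h.bic b) e2
          (fun hc => noC b (hc.mono (Finset.subset_univ _))) (nr _)
        nlinarith
    · have := smallCase (by omega) hm (h.dis r) (fun x y e => e.1) (h.bic r) e1
        (fun hc => noC r (hc.mono (Finset.subset_univ _))) (nb _)
      nlinarith

theorem upper (ℓ k : ℕ) (hℓ : 3 ≤ ℓ) (n : ℕ) (hn : ℓ * 2 ^ k + 1 ≤ n) (c : Sym2 (Fin n) → Fin k) :
    HasRainbowTriangle c ∨ HasMonoCopy c (SimpleGraph.cycleGraph (2 * ℓ + 1)) := by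
  by_contra hcon
  push Not at hcon
  have noC : ∀ i, ¬ HasCyc (Col c i) Finset.univ (2 * ℓ + 1) := by
    intro i hc
    obtain ⟨m, hm⟩ : ∃ m, 2 * ℓ + 1 = m + 2 := ⟨2 * ℓ - 1, by omega⟩
    rw [hm] at hc hcon
    exact hcon.2 ⟨i, mono_of_cyc hc⟩
  have := Pmain hℓ noC hcon.1 k Finset.univ (by simp) Finset.univ (fun _ => ∅)
    { col := fun _ _ _ _ _ => Finset.mem_univ _
      dis := fun i => by simp
      hub := fun i x hx => by simp at hx
      sz := fun i => by simp }
  simp at this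
  omega
end P3
end GR

theorem gallai_ramsey_odd_cycles (ℓ k : ℕ) (hℓ : 3 ≤ ℓ) (hk : 1 ≤ k) :
    gr k (cycleGraph (2 * ℓ + 1)) = ℓ * 2 ^ k + 1 ∧
    (∀ n, ℓ * 2 ^ k + 1 ≤ n → ∀ c : Sym2 (Fin n) → Fin k,
      HasRainbowTriangle c ∨ HasMonoCopy c (cycleGraph (2 * ℓ + 1))) ∧
    (∃ c : Sym2 (Fin (ℓ * 2 ^ k)) → Fin k,
      ¬ HasRainbowTriangle c ∧ ¬ HasMonoCopy c (cycleGraph (2 * ℓ + 1))) := by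
  have hu := fun n hn c => GR.upper ℓ k hℓ n hn c
  have hlow := GR.lower ℓ k hℓ hk
  refine ⟨?_, hu, hlow⟩
  unfold gr
  apply le_antisymm
  · exact Nat.sInf_le (fun n hn c => hu n hn c)
  · refine le_csInf ⟨_, fun n hn c => hu n hn c⟩ (fun N hN => ?_)
    by_contra hcon
    obtain ⟨c, h1, h2⟩ := hlow
    exact (hN (ℓ*2^k) (by omega) c).elim h1 h2
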